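/- Let n ≥ 2, let ν ∈ ℂ^n be regular, let P ⊆ {1,…,n−1}, and suppose p_0 ∈ P̃. Let σ ∈ W_{n−1} be the transposition exchanging the p_0-th and (p_0+1)-th coordinates. Then for every x ∈ (ℝ_{>0})^n, Γ^P(ν) S^P_ν(x) + Γ^P(σν) S^P_{σν}(x) = 0, where for μ ∈ ℂ^n regular, S^P_μ(x) = Σ_{l∈ℕ^n} b^P_l(μ) ∏_{i∈P∪{n}} (πx_i)^{2(l_i+μ_1+⋯+μ_i)} ∏_{i∈P^c} (πx_i)^{2(l_i+μ_1+⋯+μ_{i−1}+μ_n)} (an absolutely convergent series). -/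

import Mathlib

noncomputable section

open MeasureTheory Finset

namespace SO

/-- Extend a `Fin n`-indexed real tuple to a `1`-based function on `ℕ` (default value `0`). -/
def extR (n : ℕ) (t : Fin n → ℝ) : ℕ → ℝ :=
  fun i => if h : 1 ≤ i ∧ i ≤ n then t ⟨i - 1, by omega⟩ else 0

/-- Extend a `Fin n`-indexed tuple of naturals to a `1`-based function on `ℕ` (default `0`). -/
def extN (n : ℕ) (t : Fin n → ℕ) : ℕ → ℕ :=
  fun i => if h : 1 ≤ i ∧ i ≤ n then t ⟨i - 1, by omega⟩ else 0

/-- The quadratic form `q_n(m, ν)`. -/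
def qB (n : ℕ) (m : ℕ → ℕ) (ν : ℕ → ℂ) : ℂ :=
  (∑ i ∈ Finset.Icc 1 (n - 1), ((m i : ℂ)) ^ 2) + (1 / 2) * (m n : ℂ) ^ 2
    - (∑ i ∈ Finset.Icc 1 (n - 1), (m i : ℂ) * (m (i + 1) : ℂ))
    + (∑ i ∈ Finset.Icc 1 (n - 1), (ν i - ν (i + 1)) * (m i : ℂ))
    + ν n * (m n : ℂ)

/-- Decrement the `i`-th coordinate by one. -/
def dec (m : ℕ → ℕ) (i : ℕ) : ℕ → ℕ := Function.update m i (m i - 1)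

/-- Auxiliary (fuel-indexed) recursion computing the coefficients `c_{n,m}(ν)`. -/
def cAux (n : ℕ) (ν : ℕ → ℂ) : ℕ → (ℕ → ℕ) → ℂ
  | 0, _ => 1
  | d + 1, m =>
      ((∑ i ∈ Finset.Icc 1 (n - 1), if m i = 0 then 0 else cAux n ν d (dec m i))
        + (1 / 2) * (if m n = 0 then 0 else cAux n ν d (dec m n))) / qB n m ν

/-- The coefficients `c_{n,m}(ν)`, determined by `c_{n,0} = 1` and the recurrence
`q_n(m,ν) c_{n,m}(ν) = ∑_{i=1}^{n-1} c_{n,m-e_i}(ν) + (1/2) c_{n,m-e_n}(ν)`. -/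
def cB (n : ℕ) (ν : ℕ → ℂ) (m : ℕ → ℕ) : ℂ :=
  cAux n ν (∑ i ∈ Finset.Icc 1 n, m i) m

/-- Pochhammer symbol `(a)_k = Γ(a+k)/Γ(a)` for `k ∈ ℤ`. -/
def poch (a : ℂ) (k : ℤ) : ℂ := Complex.Gamma (a + k) / Complex.Gamma a

/-- `z! ∈ ℂ` for `z ∈ ℤ`, with value `0` at negative integers (so that a factor `1/zfact z`
kills a summand containing the factorial of a negative integer). -/
def zfact (z : ℤ) : ℂ := if 0 ≤ z then (Nat.factorial z.toNat : ℂ) else 0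

/-- `Γ_n(ν) = ∏_{1≤i<j≤n} Γ(-ν_i-ν_j)Γ(-ν_i+ν_j) ∏_{i=1}^n Γ(-2ν_i)`. -/
def GammaN (n : ℕ) (ν : ℕ → ℂ) : ℂ :=
  (∏ i ∈ Finset.Icc 1 n, ∏ j ∈ Finset.Icc (i + 1) n,
      Complex.Gamma (-ν i - ν j) * Complex.Gamma (-ν i + ν j)) *
    ∏ i ∈ Finset.Icc 1 n, Complex.Gamma (-(2 * ν i))

/-- The Weyl group of type `B_n`: pairs of a permutation and a sign change. -/
abbrev SignedPerm (n : ℕ) := Equiv.Perm (Fin n) × (Fin n → Bool)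

/-- Action of a signed permutation on `ν ∈ ℂ^n` (1-based indexing). -/
def wAct (n : ℕ) (w : SignedPerm n) (ν : ℕ → ℂ) : ℕ → ℂ :=
  fun i =>
    if h : 1 ≤ i ∧ i ≤ n then
      (if w.2 ⟨i - 1, by omega⟩ then -1 else 1) * ν ((w.1 ⟨i - 1, by omega⟩ : Fin n).val + 1)
    else ν i

/-- Regularity of `ν ∈ ℂ^n`. -/
def Regular (n : ℕ) (ν : ℕ → ℂ) : Prop :=
  (∀ w : SignedPerm n, ∀ m : ℕ → ℕ,
      0 < ∑ i ∈ Finset.Icc 1 n, m i → qB n m (wAct n w ν) ≠ 0) ∧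
    ∀ w w' : SignedPerm n, w ≠ w' →
      ¬ ∀ i ∈ Finset.Icc 1 n, ∃ k : ℤ, wAct n w ν i - wAct n w' ν i = (k : ℂ)

/-- The fundamental Whittaker power series `M̃^n_ν(y)`. -/
def Mt (n : ℕ) (ν : ℕ → ℂ) (y : ℕ → ℝ) : ℂ :=
  ∑' m : Fin n → ℕ,
    cB n ν (extN n m) *
      ∏ i ∈ Finset.Icc 1 n,
        ((Real.pi * y i : ℝ) : ℂ) ^ (2 * ((extN n m i : ℂ) + ∑ j ∈ Finset.Icc 1 i, ν j))

/-- The modified Bessel function `K_s(z)` (for `Re z > 0`). -/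
def besselK (s z : ℂ) : ℂ :=
  (1 / 2) * ∫ t in Set.Ioi (0 : ℝ),
    Complex.exp (-(z / 2) * ((t : ℂ) + 1 / (t : ℂ))) * (t : ℂ) ^ s / (t : ℂ)

/-- The positive orthant in `(ℝ)^n`. -/
def posSet (n : ℕ) : Set (Fin n → ℝ) := {t | ∀ i, 0 < t i}

/-- The integrand in the recursive definition of `W̃^N_ν(y)`; `W` stands for `W̃^{N-1}_ν̃`. -/
def WtKernel (N : ℕ) (ν : ℕ → ℂ) (y : ℕ → ℝ) (W : (ℕ → ℝ) → ℂ)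
    (t : Fin N → ℝ) (u : Fin (N - 1) → ℝ) : ℂ :=
  ((∏ i ∈ Finset.Icc 1 N,
      Real.exp (-(Real.pi * y i) ^ 2 * extR N t i - 1 / extR N t i) : ℝ) : ℂ) *
    (∏ i ∈ Finset.Icc 1 N, ((Real.pi * y i : ℝ) : ℂ) ^ (2 * ν N)) *
    ((∏ i ∈ Finset.Icc 1 (N - 1),
        Real.exp (-(Real.pi * y i) ^ 2 * (extR N t i / extR N t (i + 1)) * extR (N - 1) u i
          - 1 / extR (N - 1) u i) : ℝ) : ℂ) *
    ((extR N t 1 : ℝ) : ℂ) ^ (2 * ν N) *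
    (∏ i ∈ Finset.Icc 1 (N - 1),
      ((extR N t (i + 1) * extR (N - 1) u i : ℝ) : ℂ) ^ (ν N)) *
    W (fun j => if j = N - 1 then y N * Real.sqrt (extR N t N / extR (N - 1) u (N - 1))
        else y (j + 1) * Real.sqrt (extR N t (j + 1) * extR (N - 1) u (j + 1) /
          (extR N t (j + 2) * extR (N - 1) u j))) *
    (((∏ i ∈ Finset.Icc 1 (N - 1), extR (N - 1) u i)⁻¹ : ℝ) : ℂ) *
    (((∏ i ∈ Finset.Icc 1 N, extR N t i)⁻¹ : ℝ) : ℂ)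

/-- The class one Whittaker function `W̃^n_ν(y)`, defined recursively. -/
def Wt : ℕ → (ℕ → ℂ) → (ℕ → ℝ) → ℂ
  | 0, _, _ => 0
  | 1, ν, y => 2 * besselK (2 * ν 1) (2 * Real.pi * y 1)
  | n + 2, ν, y =>
      ∫ t in posSet (n + 2), ∫ u in posSet (n + 1),
        WtKernel (n + 2) ν y (fun z => Wt (n + 1) ν z) t u

/-- The auxiliary function `V_ν(x)`. -/
def Vnu (n : ℕ) (ν : ℕ → ℂ) (x : ℕ → ℝ) : ℂ :=
  ∫ u in posSet (n - 1),
    ((∏ i ∈ Finset.Icc 1 (n - 1),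
        Real.exp (-(Real.pi * x i) ^ 2 * extR (n - 1) u i - 1 / extR (n - 1) u i) : ℝ) : ℂ) *
      (∏ i ∈ Finset.Icc 1 n, ((Real.pi * x i : ℝ) : ℂ) ^ (2 * ν n)) *
      (∏ i ∈ Finset.Icc 1 (n - 1), ((extR (n - 1) u i : ℝ) : ℂ) ^ (ν n)) *
      Wt (n - 1) ν (fun j => if j = n - 1 then x n * Real.sqrt (1 / extR (n - 1) u (n - 1))
          else x (j + 1) * Real.sqrt (extR (n - 1) u (j + 1) / extR (n - 1) u j)) *
      (((∏ i ∈ Finset.Icc 1 (n - 1), extR (n - 1) u i)⁻¹ : ℝ) : ℂ)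

/-- The coefficients `b_l(ν)` (zero unless all `l_i ≥ 0` and `l_{n-1} ≥ l_n`). -/
def bB (n : ℕ) (ν : ℕ → ℂ) (l : ℕ → ℤ) : ℂ :=
  if (∀ i ∈ Finset.Icc 1 n, 0 ≤ l i) ∧ l n ≤ l (n - 1) then
    (-1 : ℂ) ^ (l n) *
      ∑' k : Fin (n - 2) → ℕ,
        cB (n - 1) ν (fun i => if i = n - 1 then (l n).toNat else extN (n - 2) k i) /
          ((∏ i ∈ Finset.Icc 1 (n - 2), zfact (l i - (extN (n - 2) k i : ℤ))) *
            zfact (l (n - 1) - l n) *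
            ∏ i ∈ Finset.Icc 1 (n - 1),
              poch (ν i - ν n + 1) (l i - (extN (n - 2) k (i - 1) : ℤ)))
  else 0

/-- The coefficients `b^P_l(ν)` (zero unless all `l_i ≥ 0` and `l_{n-1} ≥ l_n`). -/
def bP (n : ℕ) (P : Finset ℕ) (ν : ℕ → ℂ) (l : ℕ → ℤ) : ℂ :=
  if (∀ i ∈ Finset.Icc 1 n, 0 ≤ l i) ∧ l n ≤ l (n - 1) then
    (-1 : ℂ) ^ (l n) *
      ∑' k : Fin (n - 2) → ℕ,
        cB (n - 1) ν (fun i => if i = n - 1 then (l n).toNat else extN (n - 2) k i) /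
          ((∏ i ∈ (Finset.Icc 1 (n - 2)).filter (· ∈ P),
              zfact (l i - (extN (n - 2) k i : ℤ)) *
                poch (ν i - ν n + 1) (l i - (extN (n - 2) k (i - 1) : ℤ))) *
            (∏ i ∈ (Finset.Icc 1 (n - 2)).filter (· ∉ P),
              zfact (l i - (extN (n - 2) k (i - 1) : ℤ)) *
                poch (-ν i + ν n + 1) (l i - (extN (n - 2) k i : ℤ))) *
            (if n - 1 ∈ P then
                zfact (l (n - 1) - l n) *
                  poch (ν (n - 1) - ν n + 1) (l (n - 1) - (extN (n - 2) k (n - 2) : ℤ))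
              else
                zfact (l (n - 1) - (extN (n - 2) k (n - 2) : ℤ)) *
                  poch (-ν (n - 1) + ν n + 1) (l (n - 1) - l n)))
  else 0

/-- `ν^{(p)} = (ν_1, …, ν_{p-1}, ν_n, ν_p, …, ν_{n-1})`. -/
def nuP (n p : ℕ) (ν : ℕ → ℂ) : ℕ → ℂ :=
  fun i => if i < p then ν i else if i = p then ν n else ν (i - 1)

/-- `ν̄^{(q)} = (ν_1, …, ν_{q-1}, -ν_n, ν_q, …, ν_{n-1})`. -/
def nuBar (n q : ℕ) (ν : ℕ → ℂ) : ℕ → ℂ :=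
  fun i => if i < q then ν i else if i = q then -ν n else ν (i - 1)

/-- `Γ^P(ν)`. -/
def GammaP (n : ℕ) (P : Finset ℕ) (ν : ℕ → ℂ) : ℂ :=
  GammaN (n - 1) ν *
    (∏ i ∈ (Finset.Icc 1 (n - 1)).filter (· ∈ P), Complex.Gamma (-ν i + ν n)) *
    ∏ i ∈ (Finset.Icc 1 (n - 1)).filter (· ∉ P), Complex.Gamma (ν i - ν n)

/-- `Γ^p(ν) = Γ^P(ν)` with `P = {1, …, p-1}`. -/
def Gammap (n p : ℕ) (ν : ℕ → ℂ) : ℂ := GammaP n (Finset.Icc 1 (p - 1)) ν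

/-- `b^p_l(ν) = b^P_l(ν)` with `P = {1, …, p-1}`. -/
def bp (n p : ℕ) (ν : ℕ → ℂ) (l : ℕ → ℤ) : ℂ := bP n (Finset.Icc 1 (p - 1)) ν l

/-- `Γ^{p,Q}(ν)`. -/
def GammaPQ (n p : ℕ) (Q : Finset ℕ) (ν : ℕ → ℂ) : ℂ :=
  Gammap n p ν *
    (∏ i ∈ (Finset.Icc 1 n).filter (· ∈ Q), Complex.Gamma (-(nuP n p ν i) - ν n)) *
    ∏ i ∈ (Finset.Icc 1 n).filter (· ∉ Q), Complex.Gamma (nuP n p ν i + ν n)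

/-- The coefficients `c^{p,Q}_m(ν)` (zero if some `m_i < 0`). -/
def cPQ (n p : ℕ) (Q : Finset ℕ) (ν : ℕ → ℂ) (m : ℕ → ℤ) : ℂ :=
  if ∀ i ∈ Finset.Icc 1 n, 0 ≤ m i then
    ∑' l : Fin n → ℕ,
      (-1 : ℂ) ^ ((extN n l n : ℤ)) * bp n p ν (fun i => (extN n l i : ℤ)) /
        ((∏ i ∈ (Finset.Icc 1 n).filter (· ∈ Q),
            zfact (m i - (extN n l i : ℤ)) *
              poch (nuP n p ν i + ν n + 1) (m i - (extN n l (i - 1) : ℤ))) *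
          ∏ i ∈ (Finset.Icc 1 n).filter (· ∉ Q),
            zfact (m i - (extN n l (i - 1) : ℤ)) *
              poch (-(nuP n p ν i) - ν n + 1) (m i - (extN n l i : ℤ)))
  else 0

/-- The power series `M̃^{p,Q}_ν(y)`. -/
def MPQ (n p : ℕ) (Q : Finset ℕ) (ν : ℕ → ℂ) (y : ℕ → ℝ) : ℂ :=
  ∑' m : Fin n → ℕ,
    cPQ n p Q ν (fun i => (extN n m i : ℤ)) *
      (∏ i ∈ (Finset.Icc 1 n).filter (· ∈ Q),
        ((Real.pi * y i : ℝ) : ℂ) ^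
          (2 * ((extN n m i : ℂ) + ∑ j ∈ Finset.Icc 1 i, nuP n p ν j))) *
      ∏ i ∈ (Finset.Icc 1 n).filter (· ∉ Q),
        ((Real.pi * y i : ℝ) : ℂ) ^
          (2 * ((extN n m i : ℂ) + ∑ j ∈ Finset.Icc 1 (i - 1), nuP n p ν j - ν n))

/-- The Mellin-transform integrand. -/
def Tintegrand (n : ℕ) (ν : ℕ → ℂ) (s : ℕ → ℂ) (y : Fin n → ℝ) : ℂ :=
  Wt n ν (extR n y) *
    (∏ i ∈ Finset.Icc 1 n, ((Real.pi * extR n y i : ℝ) : ℂ) ^ (2 * s i)) *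
    (((∏ i ∈ Finset.Icc 1 n, extR n y i)⁻¹ : ℝ) : ℂ)

/-- The multiple Mellin transform `T^n_ν(s)` of the class one Whittaker function. -/
def Tn (n : ℕ) (ν : ℕ → ℂ) (s : ℕ → ℂ) : ℂ := ∫ y in posSet n, Tintegrand n ν s y


/-- The `l`-th term of the series `S^P_μ(x)`. -/
def SPt (n : ℕ) (P : Finset ℕ) (μ : ℕ → ℂ) (x : ℕ → ℝ) (l : Fin n → ℕ) : ℂ :=
  bP n P μ (fun i => (extN n l i : ℤ)) *
    (∏ i ∈ (Finset.Icc 1 n).filter (fun i => i = n ∨ i ∈ P),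
      ((Real.pi * x i : ℝ) : ℂ) ^
        (2 * ((extN n l i : ℂ) + ∑ j ∈ Finset.Icc 1 i, μ j))) *
    ∏ i ∈ (Finset.Icc 1 (n - 1)).filter (· ∉ P),
      ((Real.pi * x i : ℝ) : ℂ) ^
        (2 * ((extN n l i : ℂ) + (∑ j ∈ Finset.Icc 1 (i - 1), μ j) + μ n))

/-- The series `S^P_μ(x)`. -/
def SP (n : ℕ) (P : Finset ℕ) (μ : ℕ → ℂ) (x : ℕ → ℝ) : ℂ := ∑' l : Fin n → ℕ, SPt n P μ x l

/-- difference of consecutive entries -/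
def dl (K : ℕ → ℕ) (i : ℕ) : ℤ := (K i : ℤ) - (K (i - 1) : ℤ)

def wt (N j : ℕ) : ℂ := if j = N then 1 / 2 else 1

lemma qB_eq (N : ℕ) (hN : 1 ≤ N) (K : ℕ → ℕ) (h0 : K 0 = 0) (ν : ℕ → ℂ) :
    qB N K ν = ∑ i ∈ Icc 1 N, (((dl K i : ℤ) : ℂ) ^ 2 / 2 + ν i * ((dl K i : ℤ) : ℂ)) := by
  obtain ⟨m, rfl⟩ : ∃ m, N = m + 1 := ⟨N - 1, by omega⟩
  induction m with
  | zero => simp [qB, dl, h0]; ring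
  | succ m ih =>
    rw [Finset.sum_Icc_succ_top (by omega), ← ih (by omega)]
    simp only [qB, Nat.add_sub_cancel, dl]
    rw [Finset.sum_Icc_succ_top (by omega), Finset.sum_Icc_succ_top (by omega),
      Finset.sum_Icc_succ_top (by omega)]
    push_cast
    ring

lemma sum_dec (N : ℕ) (K : ℕ → ℕ) (j : ℕ) (hj : j ∈ Icc 1 N) (hK : K j ≠ 0) :
    ∑ i ∈ Icc 1 N, dec K j i + 1 = ∑ i ∈ Icc 1 N, K i := by
  rw [← Finset.add_sum_erase _ _ hj, ← Finset.add_sum_erase (Icc 1 N) K hj]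
  have : ∑ x ∈ (Icc 1 N).erase j, dec K j x = ∑ x ∈ (Icc 1 N).erase j, K x := by
    apply Finset.sum_congr rfl
    intro x hx
    simp [dec, Function.update_of_ne (Finset.ne_of_mem_erase hx)]
  rw [this]
  simp [dec]
  omega

lemma cB_rec (N : ℕ) (hN : 1 ≤ N) (ν : ℕ → ℂ) (K : ℕ → ℕ) (hq : qB N K ν ≠ 0)
    (hpos : 0 < ∑ i ∈ Icc 1 N, K i) :
    qB N K ν * cB N ν K =
      ∑ j ∈ Icc 1 N, wt N j * (if K j = 0 then 0 else cB N ν (dec K j)) := by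
  obtain ⟨d, hd⟩ : ∃ d, ∑ i ∈ Icc 1 N, K i = d + 1 := ⟨_, (Nat.sub_add_cancel hpos).symm⟩
  have key : ∀ j ∈ Icc 1 N, K j ≠ 0 → cB N ν (dec K j) = cAux N ν d (dec K j) := by
    intro j hj h
    have := sum_dec N K j hj h
    unfold cB
    congr 1
    omega
  obtain ⟨m, rfl⟩ : ∃ m, N = m + 1 := ⟨N - 1, by omega⟩
  rw [Finset.sum_Icc_succ_top (by omega)]
  unfold cB at *
  rw [hd, cAux, mul_div_cancel₀ _ hq]
  simp only [Nat.add_sub_cancel]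
  congr 1
  · apply Finset.sum_congr rfl
    intro j hj
    have hj' : j ∈ Icc 1 (m+1) := by simp at hj ⊢; omega
    have : j ≠ m + 1 := by simp at hj; omega
    simp only [wt, this, if_false, one_mul]
    split_ifs with h
    · rfl
    · exact (key j hj' h).symm
  · simp only [wt, if_true]
    split_ifs with h
    · rfl
    · rw [key (m+1) (by simp) h]

lemma cB_zero (N : ℕ) (ν : ℕ → ℂ) (K : ℕ → ℕ) (h : ∑ i ∈ Icc 1 N, K i = 0) : cB N ν K = 1 := by
  unfold cB; rw [h]; rfl

/-- distance to the integers -/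
lemma exists_dist (z : ℂ) (hz : ∀ k : ℤ, z ≠ k) : ∃ ε > 0, ε ≤ 1 ∧ ∀ m : ℤ, ε ≤ ‖z + m‖ := by
  refine ⟨min 1 (max |z.im| |z.re - round z.re|), ?_, min_le_left _ _, ?_⟩
  · refine lt_min one_pos ?_
    by_contra h
    push Not at h
    have h1 := (le_max_left _ _).trans h
    have h2 := (le_max_right _ _).trans h
    have h1' : z.im = 0 := abs_eq_zero.1 (le_antisymm h1 (abs_nonneg _))
    have h2' : z.re - round z.re = 0 := abs_eq_zero.1 (le_antisymm h2 (abs_nonneg _))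
    apply hz (round z.re)
    apply Complex.ext
    · simp; linarith
    · simp [h1']
  · intro m
    refine (min_le_right _ _).trans (max_le ?_ ?_)
    · have := Complex.abs_im_le_norm (z + m)
      simpa using this
    · have := Complex.abs_re_le_norm (z + m)
      have h2 := round_le z.re (-m)
      simp at this h2
      exact h2.trans this

lemma dec_supp {N : ℕ} {K : ℕ → ℕ} (hK : ∀ i, i ∉ Icc 1 N → K i = 0) (j : ℕ) :
    ∀ i, i ∉ Icc 1 N → dec K j i = 0 := by
  intro i hi
  by_cases h : i = j
  · subst h; simp [dec, hK i hi]
  · simp [dec, h, hK i hi]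

set_option maxHeartbeats 1000000 in
lemma block (a b v : ℂ) : ∃ C : ℝ, 0 ≤ C ∧ ∀ k kl kr κ : ℕ, kl ≤ κ → kr ≤ κ → ∀ ρ X Y : ℝ, 0 ≤ ρ →
    X = (k : ℝ) - kl → Y = (kr : ℝ) - k →
    (k ≤ κ → ρ ≤ 3 / 4) → (κ < k → ρ ≤ 1 + (3 / (2 * (k:ℝ)) + 1 / (2 * (k:ℝ) ^ 2))) →
    (X + Y) ^ 2 / 16 + (if k ≤ κ then 0 else (k : ℝ) / 2) - C * (1 + κ) ≤
      (X ^ 2 / 2 + (a.re + v.re) * X) + (Y ^ 2 / 2 + (b.re + v.re) * Y)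
        - ρ * (‖a + X - 1‖ * ‖b + Y + 1‖) := by
  set A := ‖a - 1‖ with hA
  set B := ‖b + 1‖ with hB
  set D := A + B + A * B with hD
  set c1 := a.re + v.re - 3 / 4 * (a.re - 1) with hc1
  set c2 := b.re + v.re - 3 / 4 * (b.re + 1) with hc2
  have hA0 : 0 ≤ A := norm_nonneg _
  have hB0 : 0 ≤ B := norm_nonneg _
  have hD0 : 0 ≤ D := by positivity
  refine ⟨|c1| + |c2| + A ^ 2 + B ^ 2 + (A + B) ^ 2 + 2 * D + 1 + 2 + 2 * |v.re|, by positivity, ?_⟩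
  intro k kl kr κ hkl hkr ρ X Y hρ hX hY hnear hfar
  set U := ‖a + X - 1‖ with hU
  set V := ‖b + Y + 1‖ with hV
  have hU0 : 0 ≤ U := norm_nonneg _
  have hV0 : 0 ≤ V := norm_nonneg _
  have hU2 : U ^ 2 = X ^ 2 + 2 * X * (a.re - 1) + A ^ 2 := by
    rw [hU, hA, ← Complex.normSq_eq_norm_sq, ← Complex.normSq_eq_norm_sq, Complex.normSq_apply,
      Complex.normSq_apply]
    simp
    ring
  have hV2 : V ^ 2 = Y ^ 2 + 2 * Y * (b.re + 1) + B ^ 2 := by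
    rw [hV, hB, ← Complex.normSq_eq_norm_sq, ← Complex.normSq_eq_norm_sq, Complex.normSq_apply,
      Complex.normSq_apply]
    simp
    ring
  have hklR : (kl : ℝ) ≤ κ := by exact_mod_cast hkl
  have hkrR : (kr : ℝ) ≤ κ := by exact_mod_cast hkr
  have hkl0 : (0:ℝ) ≤ kl := by positivity
  have hkr0 : (0:ℝ) ≤ kr := by positivity
  have hk0 : (0:ℝ) ≤ k := by positivity
  have hκ0 : (0:ℝ) ≤ κ := by positivity
  by_cases h : k ≤ κ
  · rw [if_pos h]
    have hkR : (k : ℝ) ≤ κ := by exact_mod_cast h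
    have hρ' := hnear h
    have h1 : ρ * (U * V) ≤ 3 / 8 * (U ^ 2 + V ^ 2) := by
      have : U * V ≤ (U ^ 2 + V ^ 2) / 2 := by nlinarith [sq_nonneg (U - V)]
      have h2 : ρ * (U * V) ≤ 3 / 4 * (U * V) := by gcongr
      linarith
    have hXk : |X| ≤ κ := by rw [abs_le]; constructor <;> linarith
    have hYk : |Y| ≤ κ := by rw [abs_le]; constructor <;> linarith
    have e1 : -(|c1| * κ) ≤ c1 * X := by
      have := neg_abs_le (c1 * X)
      rw [abs_mul] at this
      have h3 : |c1| * |X| ≤ |c1| * κ := by gcongr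
      linarith
    have e2 : -(|c2| * κ) ≤ c2 * Y := by
      have := neg_abs_le (c2 * Y)
      rw [abs_mul] at this
      have h3 : |c2| * |Y| ≤ |c2| * κ := by gcongr
      linarith
    have e3 : 0 ≤ (A ^ 2 + B ^ 2 + (A + B) ^ 2 + 2 * D + 1 + 2 + 2 * |v.re|) * κ := by positivity
    have e4 : 0 ≤ |c1| + |c2| + (A + B) ^ 2 + 2 * D + 1 + 2 + 2 * |v.re| := by positivity
    rw [hU2, hV2] at h1
    have e5 : (X + Y) ^ 2 / 16 ≤ X ^ 2 / 8 + Y ^ 2 / 8 := by nlinarith [sq_nonneg (X - Y)]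
    have e6 : c1 * X = (a.re + v.re) * X - 3 / 4 * (a.re - 1) * X := by rw [hc1]; ring
    have e7 : c2 * Y = (b.re + v.re) * Y - 3 / 4 * (b.re + 1) * Y := by rw [hc2]; ring
    clear_value c1 c2 A B U V D
    linarith [sq_nonneg A, sq_nonneg B]
  · rw [if_neg h]
    push Not at h
    have hρ' := hfar h
    have hkR : (κ : ℝ) < k := by exact_mod_cast h
    have hk1 : (1:ℝ) ≤ k := by exact_mod_cast (by omega : 1 ≤ k)
    have hX0 : 0 ≤ X := by linarith
    have hY0 : 0 ≤ -Y := by linarith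
    have hUX : |U - X| ≤ A := by
      have h1 := abs_norm_sub_norm_le (a + X - 1) (X : ℂ)
      have h2 : ‖(X:ℂ)‖ = X := by rw [Complex.norm_real]; exact abs_of_nonneg hX0
      rw [h2] at h1
      refine h1.trans (le_of_eq ?_)
      rw [hA]; congr 1; ring
    have hVY : |V - (-Y)| ≤ B := by
      have h1 := abs_norm_sub_norm_le (b + Y + 1) (Y : ℂ)
      have h2 : ‖(Y:ℂ)‖ = -Y := by rw [Complex.norm_real]; exact abs_of_nonpos (by linarith)
      rw [h2] at h1
      refine h1.trans (le_of_eq ?_)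
      rw [hB]; congr 1; ring
    rw [abs_le] at hUX hVY
    have hUk : U ≤ k + A := by linarith
    have hVk : V ≤ k + B := by linarith
    have hUV : U * V ≤ (k:ℝ) ^ 2 + D * k := by
      have : U * V ≤ (k + A) * (k + B) := by gcongr
      have h2 : A * B ≤ A * B * k := le_mul_of_one_le_right (by positivity) hk1
      nlinarith
    have g1 : (3 / (2 * (k:ℝ)) + 1 / (2 * (k:ℝ) ^ 2)) * (U * V) ≤ 3 / 2 * k + 2 * D + 1 := by
      have hkp : (0:ℝ) < k := by linarith
      have : (3 / (2 * (k:ℝ)) + 1 / (2 * (k:ℝ) ^ 2)) * (U * V)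
          ≤ (3 / (2 * (k:ℝ)) + 1 / (2 * (k:ℝ) ^ 2)) * ((k:ℝ) ^ 2 + D * k) := by gcongr
      refine this.trans ?_
      have e : (3 / (2 * (k:ℝ)) + 1 / (2 * (k:ℝ) ^ 2)) * ((k:ℝ) ^ 2 + D * k)
        = 3 / 2 * k + 3 / 2 * D + 1 / 2 + D / (2 * k) := by field_simp; ring
      rw [e]
      have : D / (2 * k) ≤ D / 2 := by
        apply div_le_div_of_nonneg_left hD0 (by norm_num); linarith
      linarith
    have g2 : ρ * (U * V) ≤ U * V + (3 / 2 * k + 2 * D + 1) := by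
      have : ρ * (U * V) ≤ (1 + (3 / (2 * (k:ℝ)) + 1 / (2 * (k:ℝ) ^ 2))) * (U * V) := by gcongr
      linarith
    have g3 : (X + Y) ^ 2 / 2 - (A + B) ^ 2 ≤ (U - V) ^ 2 := by
      have h1 : ((X + Y) - (U - V)) ^ 2 ≤ (A + B) ^ 2 := by
        apply sq_le_sq'  <;> linarith
      nlinarith [sq_nonneg ((X+Y) - 2 * (U - V))]
    have g4 : U * V = (U ^ 2 + V ^ 2) / 2 - (U - V) ^ 2 / 2 := by ring
    have g5 : -(|v.re| * κ) ≤ v.re * (X + Y) := by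
      have h3 : |X + Y| ≤ κ := by rw [abs_le]; constructor <;> linarith
      have := neg_abs_le (v.re * (X + Y))
      rw [abs_mul] at this
      have h3 : |v.re| * |X + Y| ≤ |v.re| * κ := by gcongr
      linarith
    have e3 : 0 ≤ (|c1| + |c2| + A ^ 2 + B ^ 2 + (A + B) ^ 2 + 2 * D + 1 + |v.re|) * κ := by
      positivity
    have e4 : 0 ≤ |c1| + |c2| + 2 * |v.re| := by positivity
    clear_value c1 c2 A B U V D
    linarith [sq_nonneg A, sq_nonneg B, sq_nonneg (A + B), sq_nonneg (X + Y)]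

abbrev Pt (P : Finset ℕ) (p : ℕ) : Prop := 1 ≤ p ∧ p ∉ P ∧ p + 1 ∈ P

def kap (N : ℕ) (P : Finset ℕ) (K : ℕ → ℕ) : ℕ := ∑ j ∈ Icc 1 N, if Pt P j then 0 else K j

lemma Pt_succ {P : Finset ℕ} {p : ℕ} (h : Pt P p) : ¬ Pt P (p + 1) := fun h' => h'.2.1 h.2.2

lemma regroup_aux (P : Finset ℕ) (F : ℕ → ℝ) (m : ℕ) :
    ∑ i ∈ Icc 1 m, (if Pt P i then F i + F (i + 1) else if Pt P (i - 1) then 0 else F i)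
      = ∑ i ∈ Icc 1 m, F i + if Pt P m then F (m + 1) else 0 := by
  induction m with
  | zero => simp
  | succ m ih =>
    rw [Finset.sum_Icc_succ_top (by omega), Finset.sum_Icc_succ_top (by omega), ih]
    simp only [Nat.add_sub_cancel]
    by_cases h1 : Pt P (m + 1)
    · have h2 : ¬ Pt P m := fun h => Pt_succ h h1
      simp only [if_pos h1, if_neg h2]; try ring
    · by_cases h2 : Pt P m
      · simp only [if_neg h1, if_pos h2]; try ring
      · simp only [if_neg h1, if_neg h2]; try ring

lemma not_Pt_top {N : ℕ} {P : Finset ℕ} (hP : P ⊆ Icc 1 N) : ¬ Pt P N := by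
  intro h
  have := hP h.2.2
  simp at this

lemma regroup {N : ℕ} {P : Finset ℕ} (hP : P ⊆ Icc 1 N) (F : ℕ → ℝ) :
    ∑ i ∈ Icc 1 N, F i =
    ∑ i ∈ Icc 1 N, (if Pt P i then F i + F (i + 1) else if Pt P (i - 1) then 0 else F i) := by
  rw [regroup_aux, if_neg (not_Pt_top hP), add_zero]

lemma sum_dl (K : ℕ → ℕ) (h0 : K 0 = 0) (m : ℕ) :
    ∑ i ∈ Icc 1 m, ((dl K i : ℤ) : ℝ) = K m := by
  induction m with
  | zero => simp [h0]
  | succ m ih =>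
    rw [Finset.sum_Icc_succ_top (by omega), ih]; simp [dl]

def Dd (P : Finset ℕ) (K : ℕ → ℕ) (i : ℕ) : ℝ :=
  if Pt P i then ((dl K i : ℤ) : ℝ) + ((dl K (i + 1) : ℤ) : ℝ)
    else if Pt P (i - 1) then 0 else ((dl K i : ℤ) : ℝ)

lemma kap_sq (N : ℕ) (P : Finset ℕ) (K : ℕ → ℕ) (h0 : K 0 = 0) :
    (kap N P K : ℝ) ^ 2 ≤ (N:ℝ) ^ 3 * ∑ i ∈ Icc 1 N, Dd P K i ^ 2 := by
  have hj : ∀ j ∈ Icc 1 N, ((if Pt P j then 0 else K j : ℕ) : ℝ) ^ 2 ≤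
      N * ∑ i ∈ Icc 1 N, Dd P K i ^ 2 := by
    intro j hj
    have hpos : 0 ≤ (N:ℝ) * ∑ i ∈ Icc 1 N, Dd P K i ^ 2 :=
      mul_nonneg (by positivity) (Finset.sum_nonneg fun i _ => sq_nonneg _)
    split_ifs with h
    · simpa using hpos
    · have h1 := regroup_aux P (fun i => ((dl K i : ℤ) : ℝ)) j
      rw [if_neg h, add_zero, sum_dl K h0] at h1
      rw [← h1]
      have h2 := sq_sum_le_card_mul_sum_sq (s := Icc 1 j) (f := Dd P K)
      refine h2.trans ?_
      simp only [Nat.card_Icc, Nat.add_sub_cancel]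
      have hjN : j ≤ N := (Finset.mem_Icc.1 hj).2
      have hs : ∑ i ∈ Icc 1 j, Dd P K i ^ 2 ≤ ∑ i ∈ Icc 1 N, Dd P K i ^ 2 :=
        Finset.sum_le_sum_of_subset_of_nonneg (Finset.Icc_subset_Icc_right hjN)
          (fun i _ _ => sq_nonneg _)
      have : (j:ℝ) ≤ N := by exact_mod_cast hjN
      gcongr
  unfold kap
  push_cast
  have h2 := sq_sum_le_card_mul_sum_sq (s := Icc 1 N)
    (f := fun j => (((if Pt P j then 0 else K j : ℕ)) : ℝ))
  push_cast at h2
  refine h2.trans ?_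
  simp only [Nat.card_Icc, Nat.add_sub_cancel]
  have h3 := Finset.sum_le_sum hj
  rw [Finset.sum_const, Nat.card_Icc, nsmul_eq_mul] at h3
  simp only [Nat.add_sub_cancel] at h3
  push_cast at h3
  calc _ ≤ (N:ℝ) * (N * (N * ∑ i ∈ Icc 1 N, Dd P K i ^ 2)) := by gcongr
    _ = _ := by ring

lemma le_kap {N : ℕ} {P : Finset ℕ} {K : ℕ → ℕ} (hs : ∀ i, i ∉ Icc 1 N → K i = 0) (j : ℕ)
    (hj : ¬ Pt P j) : K j ≤ kap N P K := by
  by_cases h : j ∈ Icc 1 N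
  · have := Finset.single_le_sum (f := fun j => if Pt P j then 0 else K j)
      (fun i _ => Nat.zero_le _) h
    simpa [kap, hj] using this
  · rw [hs j h]; exact Nat.zero_le _

lemma Pt_pred {P : Finset ℕ} {p : ℕ} (h : Pt P p) : ¬ Pt P (p - 1) := by
  intro h'
  have : p - 1 + 1 = p := by have := h.1; omega
  rw [Pt, this] at h'
  exact h.2.1 h'.2.2

set_option maxHeartbeats 1000000 in
lemma gap (N : ℕ) (hN : 1 ≤ N) (P : Finset ℕ) (hP : P ⊆ Icc 1 N) (ν : ℕ → ℂ) (v : ℂ) :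
    ∃ c C : ℝ, 0 < c ∧ 0 ≤ C ∧ ∀ K : ℕ → ℕ, (∀ i, i ∉ Icc 1 N → K i = 0) → ∀ ρ : ℕ → ℝ,
      (∀ p, 0 ≤ ρ p) → (∀ p ∈ Icc 1 N, Pt P p → K p ≤ kap N P K → ρ p ≤ 3 / 4) →
      (∀ p ∈ Icc 1 N, Pt P p → kap N P K < K p →
        ρ p ≤ 1 + (3 / (2 * (K p:ℝ)) + 1 / (2 * (K p:ℝ) ^ 2))) →
      c * (kap N P K : ℝ) ^ 2
        + (∑ p ∈ Icc 1 N, if Pt P p ∧ kap N P K < K p then (K p : ℝ) / 2 else 0)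
        - C * (1 + kap N P K) ≤ (qB N K ν).re - ∑ p ∈ Icc 1 N, if Pt P p then
          ρ p * (‖ν p - v + (dl K p : ℤ) - 1‖ * ‖ν (p + 1) - v + (dl K (p + 1) : ℤ) + 1‖) else 0 := by
  have hb := fun p => block (ν p - v) (ν (p + 1) - v) v
  choose Cb hCb0 hCb using hb
  have hN3 : (0:ℝ) < (N:ℝ) ^ 3 := by positivity
  refine ⟨1 / (16 * (N:ℝ) ^ 3), ∑ i ∈ Icc 1 N, (Cb i + 2 * (ν i).re ^ 2), by positivity,
    Finset.sum_nonneg fun i _ => add_nonneg (hCb0 i) (by positivity), ?_⟩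
  intro K hs ρ hρ hnear hfar
  have h0 : K 0 = 0 := hs 0 (by simp)
  set κ := kap N P K with hκ
  have hq : (qB N K ν).re =
      ∑ i ∈ Icc 1 N, (((dl K i : ℤ) : ℝ) ^ 2 / 2 + (ν i).re * ((dl K i : ℤ) : ℝ)) := by
    rw [qB_eq N hN K h0, Complex.re_sum]
    apply Finset.sum_congr rfl
    intro i _
    have : (((dl K i : ℤ) : ℂ) ^ 2 / 2 + ν i * ((dl K i : ℤ) : ℂ))
      = ((((dl K i : ℤ) : ℝ) ^ 2 / 2 : ℝ) : ℂ) + (((dl K i : ℤ) : ℝ) : ℂ) * ν i := by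
      push_cast; ring
    rw [this, Complex.add_re, Complex.ofReal_re, Complex.re_ofReal_mul]
    ring
  rw [hq, regroup hP (fun i => ((dl K i : ℤ) : ℝ) ^ 2 / 2 + (ν i).re * ((dl K i : ℤ) : ℝ)), ← Finset.sum_sub_distrib]
  have hk2 : 1 / (16 * (N:ℝ) ^ 3) * (κ:ℝ) ^ 2 ≤ ∑ i ∈ Icc 1 N, Dd P K i ^ 2 / 16 := by
    rw [← Finset.sum_div, div_mul_eq_mul_div, one_mul, div_le_div_iff₀ (by positivity) (by norm_num)]
    have := kap_sq N P K h0
    nlinarith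
  have key : ∀ i ∈ Icc 1 N, Dd P K i ^ 2 / 16 + (if Pt P i ∧ κ < K i then (K i : ℝ) / 2 else 0)
      - (Cb i + 2 * (ν i).re ^ 2) * (1 + κ) ≤
      (if Pt P i then (((dl K i : ℤ) : ℝ) ^ 2 / 2 + (ν i).re * ((dl K i : ℤ) : ℝ)) +
        (((dl K (i + 1) : ℤ) : ℝ) ^ 2 / 2 + (ν (i + 1)).re * ((dl K (i + 1) : ℤ) : ℝ))
        else if Pt P (i - 1) then 0 else
        ((dl K i : ℤ) : ℝ) ^ 2 / 2 + (ν i).re * ((dl K i : ℤ) : ℝ)) -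
      (if Pt P i then
          ρ i * (‖ν i - v + (dl K i : ℤ) - 1‖ * ‖ν (i + 1) - v + (dl K (i + 1) : ℤ) + 1‖) else 0) := by
    intro i hi
    have hcc : 0 ≤ (Cb i + 2 * (ν i).re ^ 2) * (1 + κ) :=
      mul_nonneg (add_nonneg (hCb0 i) (by positivity)) (by positivity)
    have hκ0 : (0:ℝ) ≤ κ := by positivity
    by_cases h : Pt P i
    · have h1 := hCb i (K i) (K (i - 1)) (K (i + 1)) κ (le_kap hs _ (Pt_pred h))
        (le_kap hs _ (Pt_succ h)) (ρ i) ((dl K i : ℤ) : ℝ) ((dl K (i + 1) : ℤ) : ℝ) (hρ i)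
        (by simp [dl]) (by simp [dl]) (hnear i hi h) (hfar i hi h)
      simp only [Dd, if_pos h]
      have e : (if Pt P i ∧ κ < K i then (K i : ℝ) / 2 else 0) =
          (if K i ≤ κ then 0 else (K i : ℝ) / 2) := by
        by_cases h2 : K i ≤ κ
        · rw [if_pos h2, if_neg (by rintro ⟨_, h3⟩; omega)]
        · rw [if_neg h2, if_pos ⟨h, by omega⟩]
      rw [e]
      have h3 : 0 ≤ 2 * (ν i).re ^ 2 * (1 + κ) := by positivity
      simp only [Complex.sub_re, sub_add_cancel, Complex.ofReal_intCast] at h1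
      linarith
    · have hn : ¬ (Pt P i ∧ κ < K i) := fun h' => h h'.1
      simp only [Dd, if_neg h, if_neg hn]
      by_cases h2 : Pt P (i - 1)
      · simp only [if_pos h2]; linarith
      · simp only [if_neg h2]
        have h3 : 0 ≤ Cb i * (1 + κ) := mul_nonneg (hCb0 i) (by positivity)
        have h4 : 0 ≤ 2 * (ν i).re ^ 2 * κ := by positivity
        nlinarith [sq_nonneg (((dl K i : ℤ) : ℝ) / 2 + (ν i).re), sq_nonneg ((dl K i : ℤ) : ℝ)]
  have := Finset.sum_le_sum key
  rw [Finset.sum_sub_distrib, Finset.sum_add_distrib, ← Finset.sum_mul] at this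
  linarith

def Bf (P : Finset ℕ) (ν : ℕ → ℂ) (v : ℂ) (i : ℕ) (δ : ℤ) : ℝ :=
  if i ∈ P then ‖Complex.Gamma (ν i - v + 1 + δ)‖⁻¹ else ‖Complex.Gamma (ν i - v + δ)‖

def gB (N : ℕ) (P : Finset ℕ) (ν : ℕ → ℂ) (v : ℂ) (K : ℕ → ℕ) : ℝ :=
  ‖cB N ν K‖ * ∏ i ∈ Icc 1 N, Bf P ν v i (dl K i)

def rA (P : Finset ℕ) (ν : ℕ → ℂ) (v : ℂ) (i : ℕ) (δ : ℤ) : ℝ :=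
  if i ∈ P then ‖ν i - v + δ‖⁻¹ else ‖ν i - v + δ - 1‖

def rB (P : Finset ℕ) (ν : ℕ → ℂ) (v : ℂ) (i : ℕ) (δ : ℤ) : ℝ :=
  if i ∈ P then ‖ν i - v + δ + 1‖ else ‖ν i - v + δ‖⁻¹

def rr (N : ℕ) (P : Finset ℕ) (ν : ℕ → ℂ) (v : ℂ) (K : ℕ → ℕ) (j : ℕ) : ℝ :=
  rA P ν v j (dl K j) * (if j = N then 1 else rB P ν v (j + 1) (dl K (j + 1)))

lemma ne_zero_of_nonint {z : ℂ} (hz : ∀ k : ℤ, z ≠ k) (m : ℤ) : z + m ≠ 0 := by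
  intro h
  apply hz (-m)
  push_cast
  linear_combination h

lemma Bf_rA (P : Finset ℕ) (ν : ℕ → ℂ) (v : ℂ) (i : ℕ) (hz : ∀ k : ℤ, ν i - v ≠ k) (δ : ℤ) :
    Bf P ν v i δ = rA P ν v i δ * Bf P ν v i (δ - 1) := by
  unfold Bf rA
  split_ifs with h
  · have h1 := ne_zero_of_nonint hz δ
    have : ν i - v + 1 + δ = (ν i - v + δ) + 1 := by ring
    rw [this, Complex.Gamma_add_one _ h1, norm_mul, mul_inv]
    congr 4
    push_cast; ring
  · have h1 := ne_zero_of_nonint hz (δ - 1)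
    have : ν i - v + δ = (ν i - v + (δ - 1 : ℤ)) + 1 := by push_cast; ring
    rw [this, Complex.Gamma_add_one _ h1, norm_mul]
    congr 2
    push_cast; ring

lemma Bf_rB (P : Finset ℕ) (ν : ℕ → ℂ) (v : ℂ) (i : ℕ) (hz : ∀ k : ℤ, ν i - v ≠ k) (δ : ℤ) :
    Bf P ν v i δ = rB P ν v i δ * Bf P ν v i (δ + 1) := by
  unfold Bf rB
  split_ifs with h
  · have h1 := ne_zero_of_nonint hz (δ + 1)
    have : ν i - v + 1 + ((δ + 1 : ℤ) : ℂ) = (ν i - v + (δ + 1 : ℤ)) + 1 := by ring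
    have h2 : ν i - v + (δ:ℂ) + 1 = (ν i - v + (δ + 1 : ℤ)) := by push_cast; ring
    have h3 : ν i - v + 1 + (δ:ℂ) = (ν i - v + (δ + 1 : ℤ)) := by push_cast; ring
    rw [this, Complex.Gamma_add_one _ h1, norm_mul, mul_inv, h2, h3, mul_inv_cancel_left₀]
    exact norm_ne_zero_iff.2 h1
  · have h1 := ne_zero_of_nonint hz δ
    have : ν i - v + ((δ + 1 : ℤ) : ℂ) = (ν i - v + δ) + 1 := by push_cast; ring
    rw [this, Complex.Gamma_add_one _ h1, norm_mul, inv_mul_cancel_left₀]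
    exact norm_ne_zero_iff.2 h1

lemma Bf_nonneg (P : Finset ℕ) (ν : ℕ → ℂ) (v : ℂ) (i : ℕ) (δ : ℤ) : 0 ≤ Bf P ν v i δ := by
  unfold Bf; split_ifs <;> positivity

lemma rr_nonneg (N : ℕ) (P : Finset ℕ) (ν : ℕ → ℂ) (v : ℂ) (K : ℕ → ℕ) (j : ℕ) :
    0 ≤ rr N P ν v K j := by
  unfold rr rA rB; split_ifs <;> positivity

lemma dl_dec {K : ℕ → ℕ} {j : ℕ} (hj : 1 ≤ j) (hK : K j ≠ 0) (i : ℕ) (hi : 1 ≤ i) :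
    dl (dec K j) i = if i = j then dl K j - 1 else if i = j + 1 then dl K (j + 1) + 1 else dl K i := by
  unfold dl dec
  split_ifs with h1 h2
  · subst h1
    rw [Function.update_self, Function.update_of_ne (by omega)]
    omega
  · subst h2
    rw [Function.update_of_ne (by omega)]
    simp
    omega
  · rw [Function.update_of_ne h1, Function.update_of_ne (by omega)]

lemma prod_Bf_dec (N : ℕ) (P : Finset ℕ) (ν : ℕ → ℂ) (v : ℂ)
    (hz : ∀ i ∈ Icc 1 N, ∀ k : ℤ, ν i - v ≠ k) (K : ℕ → ℕ) (j : ℕ) (hj : j ∈ Icc 1 N)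
    (hK : K j ≠ 0) :
    ∏ i ∈ Icc 1 N, Bf P ν v i (dl K i) =
      rr N P ν v K j * ∏ i ∈ Icc 1 N, Bf P ν v i (dl (dec K j) i) := by
  have hj1 := (Finset.mem_Icc.1 hj).1
  have hj2 := (Finset.mem_Icc.1 hj).2
  have h1 : ∀ i ∈ Icc 1 N, Bf P ν v i (dl K i) =
      ((if i = j then rA P ν v j (dl K j) else 1) *
        (if i = j + 1 then rB P ν v (j + 1) (dl K (j + 1)) else 1)) *
        Bf P ν v i (dl (dec K j) i) := by
    intro i hi
    rw [dl_dec hj1 hK i (Finset.mem_Icc.1 hi).1]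
    by_cases h1 : i = j
    · subst h1
      rw [if_pos rfl, if_neg (by omega), if_pos rfl, mul_one]
      exact Bf_rA P ν v i (hz i hi) _
    · rw [if_neg h1, if_neg h1, one_mul]
      by_cases h2 : i = j + 1
      · rw [if_pos h2, if_pos h2]
        subst h2
        exact Bf_rB P ν v _ (hz _ hi) _
      · rw [if_neg h2, if_neg h2, one_mul]
  rw [Finset.prod_congr rfl h1, Finset.prod_mul_distrib, Finset.prod_mul_distrib]
  congr 1
  rw [Finset.prod_ite_eq', Finset.prod_ite_eq', if_pos hj, rr]
  congr 1
  by_cases h : j = N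
  · rw [if_pos h, if_neg]; simp; omega
  · rw [if_neg h, if_pos]; simp; omega

lemma rr_bound (N : ℕ) (P : Finset ℕ) (hP : P ⊆ Icc 1 N) (ν : ℕ → ℂ) (v : ℂ)
    (hz : ∀ i ∈ Icc 1 N, ∀ k : ℤ, ν i - v ≠ k) :
    ∃ C : ℝ, 0 ≤ C ∧ ∀ K : ℕ → ℕ, (∀ i, i ∉ Icc 1 N → K i = 0) → ∀ j ∈ Icc 1 N, ¬ Pt P j →
      rr N P ν v K j ≤ C * (1 + kap N P K) := by
  have : ∀ j, ∃ C : ℝ, 0 ≤ C ∧ (j ∈ Icc 1 N → ∀ K : ℕ → ℕ, (∀ i, i ∉ Icc 1 N → K i = 0) →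
      ¬ Pt P j → rr N P ν v K j ≤ C * (1 + kap N P K)) := by
    intro j
    by_cases hj : j ∈ Icc 1 N
    swap
    · exact ⟨0, le_rfl, fun h => absurd h hj⟩
    have hj1 := (Finset.mem_Icc.1 hj).1
    have hj2 := (Finset.mem_Icc.1 hj).2
    -- bounds for inverse factors
    have hinv : ∀ i ∈ Icc 1 N, ∃ E : ℝ, 1 ≤ E ∧ ∀ m : ℤ, ‖ν i - v + m‖⁻¹ ≤ E := by
      intro i hi
      obtain ⟨ε, h1, h2, h3⟩ := exists_dist (ν i - v) (hz i hi)
      exact ⟨ε⁻¹, (one_le_inv₀ h1).2 h2, fun m => inv_anti₀ h1 (h3 m)⟩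
    have hdl : ∀ K : ℕ → ℕ, (∀ i, i ∉ Icc 1 N → K i = 0) → ∀ i, ¬ Pt P i → ¬ Pt P (i - 1) →
        |((dl K i : ℤ) : ℝ)| ≤ kap N P K := by
      intro K hs i h1 h2
      have e1 := le_kap hs i h1
      have e2 := le_kap hs (i - 1) h2
      have : |dl K i| ≤ (kap N P K : ℤ) := by
        unfold dl
        rw [abs_le]; constructor <;> omega
      exact_mod_cast this
    have hnum : ∀ (z : ℂ) (m : ℤ) (κ : ℕ), |(m : ℝ)| ≤ κ → ‖z + m‖ ≤ (‖z‖ + 1) * (1 + κ) := by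
      intro z m κ h
      have h1 := norm_add_le z (m : ℂ)
      rw [Complex.norm_intCast] at h1
      have : 0 ≤ ‖z‖ * κ := by positivity
      linarith
    obtain ⟨E1, hE1, hE1'⟩ := hinv j hj
    by_cases hjN : j = N
    · refine ⟨E1 + (‖ν j - v - 1‖ + 1), by positivity, ?_⟩
      intro _ K hs hpt
      have hκ0 : (0:ℝ) ≤ kap N P K := by positivity
      have hEk : 0 ≤ E1 * kap N P K := by positivity
      have hEk2 : 0 ≤ (‖ν j - v - 1‖ + 1) * (1 + kap N P K) := by positivity
      unfold rr rA
      rw [if_pos hjN, mul_one]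
      split_ifs with h
      · have := hE1' (dl K j)
        linarith
      · have h2 : ¬ Pt P (j - 1) := by
          intro h'
          have e : j - 1 + 1 = j := by omega
          exact h (e ▸ h'.2.2)
        have := hnum (ν j - v - 1) (dl K j) _ (hdl K hs j hpt h2)
        have e : ν j - v + (dl K j : ℂ) - 1 = ν j - v - 1 + (dl K j : ℂ) := by ring
        rw [e]
        have : 0 ≤ E1 * (1 + kap N P K) := by positivity
        linarith
    · have hj' : j + 1 ∈ Icc 1 N := by simp; omega
      obtain ⟨E2, hE2, hE2'⟩ := hinv (j + 1) hj'
      refine ⟨E1 * E2 + (‖ν j - v - 1‖ + 1) * E2 + E1 * (‖ν (j + 1) - v + 1‖ + 1), by positivity, ?_⟩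
      intro _ K hs hpt
      have hκ0 : (0:ℝ) ≤ kap N P K := by positivity
      have n1 : 0 ≤ E1 * E2 * (1 + kap N P K) := by positivity
      have n1' : 0 ≤ E1 * E2 * (kap N P K) := by positivity
      have n2 : 0 ≤ (‖ν j - v - 1‖ + 1) * E2 * (1 + kap N P K) := by positivity
      have n3 : 0 ≤ E1 * (‖ν (j + 1) - v + 1‖ + 1) * (1 + kap N P K) := by positivity
      have f1 := hE1' (dl K j)
      have f2 := hE2' (dl K (j + 1))
      unfold rr rA rB
      rw [if_neg hjN]
      by_cases h1 : j ∈ P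
      · rw [if_pos h1]
        by_cases h2 : j + 1 ∈ P
        · rw [if_pos h2]
          have h3 : ¬ Pt P (j + 1) := fun h => h.2.1 h2
          have := hnum (ν (j + 1) - v + 1) (dl K (j + 1)) _ (hdl K hs (j + 1) h3 hpt)
          have e : ν (j + 1) - v + (dl K (j + 1) : ℂ) + 1 = ν (j + 1) - v + 1 + (dl K (j + 1) : ℂ) := by
            ring
          rw [e]
          have : ‖ν j - v + (dl K j : ℂ)‖⁻¹ * ‖ν (j + 1) - v + 1 + (dl K (j + 1) : ℂ)‖ ≤
            E1 * ((‖ν (j + 1) - v + 1‖ + 1) * (1 + kap N P K)) := by gcongr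
          linarith
        · rw [if_neg h2]
          have : ‖ν j - v + (dl K j : ℂ)‖⁻¹ * ‖ν (j + 1) - v + (dl K (j + 1) : ℂ)‖⁻¹ ≤ E1 * E2 := by
            gcongr
          linarith
      · have h2 : j + 1 ∉ P := fun h => hpt ⟨hj1, h1, h⟩
        rw [if_neg h1, if_neg h2]
        have h2 : ¬ Pt P (j - 1) := by
          intro h'
          have e : j - 1 + 1 = j := by omega
          exact h1 (e ▸ h'.2.2)
        have := hnum (ν j - v - 1) (dl K j) _ (hdl K hs j hpt h2)
        have e : ν j - v + (dl K j : ℂ) - 1 = ν j - v - 1 + (dl K j : ℂ) := by ring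
        rw [e]
        have : ‖ν j - v - 1 + (dl K j : ℂ)‖ * ‖ν (j + 1) - v + (dl K (j + 1) : ℂ)‖⁻¹ ≤
            ((‖ν j - v - 1‖ + 1) * (1 + kap N P K)) * E2 := by gcongr
        linarith
  choose C hC0 hC using this
  refine ⟨∑ j ∈ Icc 1 N, C j, Finset.sum_nonneg fun j _ => hC0 j, ?_⟩
  intro K hs j hj hpt
  refine (hC j hj K hs hpt).trans ?_
  have := Finset.single_le_sum (f := C) (fun i _ => hC0 i) hj
  gcongr

def uu (k : ℕ) : ℝ := (((k:ℝ) + 4) * √((k:ℝ) + 4))⁻¹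

lemma uu_pos (k : ℕ) : 0 < uu k := by unfold uu; positivity

lemma uu_ratio (k : ℕ) (hk : 1 ≤ k) :
    uu (k - 1) / uu k ≤ 3 / 2 ∧
    uu (k - 1) / uu k ≤ 1 + (3 / (2 * (k:ℝ)) + 1 / (2 * (k:ℝ) ^ 2)) := by
  have hk' : (1:ℝ) ≤ k := by exact_mod_cast hk
  set x : ℝ := k + 3 with hx
  have hx4 : 4 ≤ x := by linarith
  have hx0 : 0 < x := by linarith
  have e : uu (k - 1) / uu k = ((x + 1) * √(x + 1)) / (x * √x) := by
    unfold uu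
    rw [Nat.cast_sub hk, div_inv_eq_mul, inv_mul_eq_div]
    have e1 : (k:ℝ) - (1:ℕ) + 4 = x := by rw [hx]; push_cast; ring
    have e2 : (k:ℝ) + 4 = x + 1 := by rw [hx]; ring
    rw [e1, e2]
  have hs : √(x + 1) ≤ √x * (1 + 1 / (2 * x)) := by
    rw [Real.sqrt_le_left (by positivity), mul_pow, Real.sq_sqrt hx0.le]
    have : x * (1 + 1 / (2 * x)) ^ 2 = x + 1 + 1 / (4 * x) := by field_simp; ring
    rw [this]
    have : 0 < 1 / (4 * x) := by positivity
    linarith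
  have h1 : uu (k - 1) / uu k ≤ 1 + (3 / (2 * x) + 1 / (2 * x ^ 2)) := by
    rw [e, div_le_iff₀ (by positivity)]
    calc (x + 1) * √(x + 1) ≤ (x + 1) * (√x * (1 + 1 / (2 * x))) := by gcongr
      _ = _ := by field_simp; ring
  constructor
  · refine h1.trans ?_
    have a1 : 3 / (2 * x) ≤ 3 / (2 * 4) := by gcongr
    have a2 : 1 / (2 * x ^ 2) ≤ 1 / (2 * 4 ^ 2) := by gcongr
    norm_num at a1 a2 ⊢
    linarith
  · refine h1.trans ?_
    have : (k:ℝ) ≤ x := by linarith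
    gcongr

lemma uu_summable : Summable uu := by
  have h := (summable_nat_add_iff 4).2 (Real.summable_nat_rpow_inv.2 (by norm_num : (1:ℝ) < 3 / 2))
  refine h.congr ?_
  intro k
  unfold uu
  congr 1
  have : (3/2:ℝ) = 1 + 1 / 2 := by norm_num
  rw [this, Real.rpow_add (by positivity), Real.rpow_one, Real.sqrt_eq_rpow]
  push_cast; rfl

def Hm (N : ℕ) (P : Finset ℕ) (Λ : ℝ) (K : ℕ → ℕ) : ℝ :=
  ∏ j ∈ Icc 1 N, if Pt P j then uu (K j) * 2 ^ (min (K j) (kap N P K)) else (Λ⁻¹) ^ (K j)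

lemma Hm_pos (N : ℕ) (P : Finset ℕ) (Λ : ℝ) (hΛ : 1 ≤ Λ) (K : ℕ → ℕ) : 0 < Hm N P Λ K := by
  unfold Hm
  refine Finset.prod_pos fun j _ => ?_
  have := uu_pos (K j)
  split_ifs <;> positivity

lemma dec_le (K : ℕ → ℕ) (j i : ℕ) : dec K j i ≤ K i := by
  unfold dec
  by_cases h : i = j
  · subst h; simp
  · rw [Function.update_of_ne h]

lemma dec_ne (K : ℕ → ℕ) (j i : ℕ) (h : i ≠ j) : dec K j i = K i := by
  unfold dec; rw [Function.update_of_ne h]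

lemma dec_self (K : ℕ → ℕ) (j : ℕ) : dec K j j = K j - 1 := by
  unfold dec; rw [Function.update_self]

lemma kap_dec_le (N : ℕ) (P : Finset ℕ) (K : ℕ → ℕ) (j : ℕ) :
    kap N P (dec K j) ≤ kap N P K := by
  unfold kap
  refine Finset.sum_le_sum fun i _ => ?_
  split_ifs
  · rfl
  · exact dec_le K j i

lemma kap_dec_Pt (N : ℕ) (P : Finset ℕ) (K : ℕ → ℕ) (j : ℕ) (hj : Pt P j) :
    kap N P (dec K j) = kap N P K := by
  unfold kap
  refine Finset.sum_congr rfl fun i _ => ?_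
  split_ifs with h
  · rfl
  · exact dec_ne K j i (by rintro rfl; exact h hj)

lemma Hm_dec_nonPt (N : ℕ) (P : Finset ℕ) (Λ : ℝ) (hΛ : 1 ≤ Λ) (K : ℕ → ℕ) (j : ℕ)
    (hj : j ∈ Icc 1 N) (hPt : ¬ Pt P j) (hK : K j ≠ 0) :
    Hm N P Λ (dec K j) ≤ Λ * Hm N P Λ K := by
  have e : Λ * Hm N P Λ K = ∏ i ∈ Icc 1 N, (if i = j then Λ else 1) *
      (if Pt P i then uu (K i) * 2 ^ (min (K i) (kap N P K)) else (Λ⁻¹) ^ (K i)) := by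
    rw [Finset.prod_mul_distrib, Finset.prod_ite_eq' _ j (fun _ => Λ), if_pos hj]; rfl
  rw [e]
  unfold Hm
  have hΛ0 : 0 < Λ := by linarith
  refine Finset.prod_le_prod (fun i _ => ?_) (fun i _ => ?_)
  · have := uu_pos (dec K j i)
    split_ifs <;> positivity
  · by_cases hij : i = j
    · subst hij
      rw [if_neg hPt, if_neg hPt, if_pos rfl, dec_self]
      obtain ⟨m, hm⟩ := Nat.exists_eq_succ_of_ne_zero hK
      rw [hm, Nat.succ_sub_one, pow_succ]
      apply le_of_eq; field_simp
    · rw [if_neg hij, one_mul, dec_ne _ _ _ hij]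
      split_ifs with h
      · have := uu_pos (K i)
        have h2 := kap_dec_le N P K j
        gcongr
        norm_num
      · rfl

lemma Hm_dec_Pt (N : ℕ) (P : Finset ℕ) (Λ : ℝ) (hΛ : 1 ≤ Λ) (K : ℕ → ℕ) (j : ℕ)
    (hj : j ∈ Icc 1 N) (hPt : Pt P j) (hK : K j ≠ 0) :
    Hm N P Λ (dec K j) =
      (uu (K j - 1) / uu (K j) * (if K j ≤ kap N P K then 1 / 2 else 1)) * Hm N P Λ K := by
  set r := (uu (K j - 1) / uu (K j) * (if K j ≤ kap N P K then (1:ℝ) / 2 else 1)) with hr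
  have e : r * Hm N P Λ K = ∏ i ∈ Icc 1 N, (if i = j then r else 1) *
      (if Pt P i then uu (K i) * 2 ^ (min (K i) (kap N P K)) else (Λ⁻¹) ^ (K i)) := by
    rw [Finset.prod_mul_distrib, Finset.prod_ite_eq' _ j (fun _ => r), if_pos hj]; rfl
  rw [e]
  unfold Hm
  refine Finset.prod_congr rfl (fun i _ => ?_)
  by_cases hij : i = j
  · subst hij
    rw [if_pos hPt, if_pos hPt, if_pos rfl, dec_self, kap_dec_Pt _ _ _ _ hPt, hr]
    have := uu_pos (K i)
    split_ifs with h
    · rw [min_eq_left h, min_eq_left (by omega)]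
      obtain ⟨m, hm⟩ := Nat.exists_eq_succ_of_ne_zero hK
      rw [hm, Nat.succ_sub_one, pow_succ]
      rw [hm] at this
      field_simp
    · rw [min_eq_right (by omega), min_eq_right (by omega)]
      field_simp
  · rw [if_neg hij, one_mul, dec_ne _ _ _ hij, kap_dec_Pt _ _ _ _ hPt]

lemma sumK_le (N : ℕ) (P : Finset ℕ) (K : ℕ → ℕ) :
    ((∑ i ∈ Icc 1 N, K i : ℕ) : ℝ) ≤ (N + 1) * kap N P K +
      2 * (∑ p ∈ Icc 1 N, if Pt P p ∧ kap N P K < K p then (K p : ℝ) / 2 else 0) := by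
  have h : ∀ i ∈ Icc 1 N, (K i : ℝ) ≤ ((if Pt P i then 0 else K i : ℕ) : ℝ) + kap N P K +
      2 * (if Pt P i ∧ kap N P K < K i then (K i : ℝ) / 2 else 0) := by
    intro i _
    have hk : (0:ℝ) ≤ kap N P K := by positivity
    by_cases h1 : Pt P i
    · by_cases h2 : kap N P K < K i
      · rw [if_pos h1, if_pos ⟨h1, h2⟩]; push_cast; linarith
      · rw [if_pos h1, if_neg (fun h => h2 h.2)]; push_cast
        have : (K i : ℝ) ≤ kap N P K := by exact_mod_cast not_lt.1 h2
        linarith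
    · rw [if_neg h1, if_neg (fun h => h1 h.1)]; linarith
  have := Finset.sum_le_sum h
  rw [Finset.sum_add_distrib, Finset.sum_add_distrib, ← Finset.mul_sum, Finset.sum_const,
    ← Nat.cast_sum, ← Nat.cast_sum] at this
  simp only [Nat.card_Icc, nsmul_eq_mul, Nat.add_sub_cancel] at this
  have e : (kap N P K : ℝ) = ((∑ i ∈ Icc 1 N, if Pt P i then 0 else K i : ℕ) : ℝ) := rfl
  rw [← e] at this
  linarith

set_option maxHeartbeats 1000000 in
lemma main_ineq (N : ℕ) (hN : 1 ≤ N) (P : Finset ℕ) (hP : P ⊆ Icc 1 N) (ν : ℕ → ℂ) (v : ℂ)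
    (hz : ∀ i ∈ Icc 1 N, ∀ k : ℤ, ν i - v ≠ k) (Λ : ℝ) (hΛ : 1 ≤ Λ) :
    ∃ M0 : ℕ, ∀ K : ℕ → ℕ, (∀ i, i ∉ Icc 1 N → K i = 0) → M0 ≤ ∑ i ∈ Icc 1 N, K i →
      ∑ j ∈ Icc 1 N, rr N P ν v K j * (if K j = 0 then 0 else Hm N P Λ (dec K j)) ≤
        ‖qB N K ν‖ * Hm N P Λ K := by
  obtain ⟨c, C, hc, hC, hg⟩ := gap N hN P hP ν v
  obtain ⟨C1, hC1, hr⟩ := rr_bound N P hP ν v hz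
  set C2 := C + N * (C1 * Λ) with hC2
  have hC20 : 0 ≤ C2 := by positivity
  set κ0 : ℕ := ⌈2 * C2 / c⌉₊ + 1 with hκ0
  refine ⟨(N + 1) * κ0 + ⌈2 * (C2 * (1 + κ0))⌉₊, fun K hs hM => ?_⟩
  set κ := kap N P K with hκ
  set S2 := (∑ p ∈ Icc 1 N, if Pt P p ∧ kap N P K < K p then (K p : ℝ) / 2 else 0) with hS2
  have hS20 : 0 ≤ S2 := Finset.sum_nonneg fun i _ => by split_ifs <;> positivity
  set ρ : ℕ → ℝ := fun p => if K p = 0 then 0 else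
    (uu (K p - 1) / uu (K p) * (if K p ≤ kap N P K then 1 / 2 else 1)) with hρ
  have hρ0 : ∀ p, 0 ≤ ρ p := by
    intro p
    have := uu_pos (K p); have := uu_pos (K p - 1)
    simp only [hρ]; split_ifs <;> positivity
  have h3 := hg K hs ρ hρ0 (by
    intro p _ _ h
    simp only [hρ]
    split_ifs with h1
    · norm_num
    · have := (uu_ratio (K p) (by omega)).1
      linarith) (by
    intro p _ _ h
    simp only [hρ]
    have h1 : K p ≠ 0 := by omega
    rw [if_neg h1, if_neg (by omega), mul_one]
    exact (uu_ratio (K p) (by omega)).2)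
  rw [← hS2, ← hκ] at h3
  have key : C2 * (1 + κ) ≤ c * (κ:ℝ) ^ 2 + S2 := by
    by_cases hk : κ0 ≤ κ
    · have h4 : (κ0:ℝ) ≤ κ := by exact_mod_cast hk
      have h5 : 2 * C2 / c ≤ κ0 := by
        rw [hκ0]; push_cast
        have := Nat.le_ceil (2 * C2 / c); linarith
      have h6 : 2 * C2 ≤ c * κ0 := by rw [div_le_iff₀ hc] at h5; linarith
      have h7 : (1:ℝ) ≤ κ := by
        have : (1:ℝ) ≤ κ0 := by rw [hκ0]; push_cast; linarith [Nat.cast_nonneg (α := ℝ) ⌈2 * C2 / c⌉₊]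
        linarith
      have h8 : 2 * C2 ≤ c * κ := h6.trans (by gcongr)
      nlinarith
    · have h4 : (κ:ℝ) ≤ κ0 := by exact_mod_cast (not_le.1 hk).le
      have h5 := sumK_le N P K
      rw [← hS2, ← hκ] at h5
      have h6 : (((N + 1) * κ0 + ⌈2 * (C2 * (1 + κ0))⌉₊ : ℕ) : ℝ) ≤ ((∑ i ∈ Icc 1 N, K i : ℕ) : ℝ) := by
        exact_mod_cast hM
      push_cast at h6
      push_cast at h5
      have h7 := Nat.le_ceil (2 * (C2 * (1 + (κ0:ℝ))))
      have h8 : ((N:ℝ) + 1) * κ ≤ (N + 1) * κ0 := by gcongr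
      have h9 : C2 * (1 + κ) ≤ C2 * (1 + κ0) := by gcongr
      have h10 : 0 ≤ c * (κ:ℝ)^2 := by positivity
      linarith
  have hH := Hm_pos N P Λ hΛ K
  have hterm : ∀ j ∈ Icc 1 N, rr N P ν v K j * (if K j = 0 then 0 else Hm N P Λ (dec K j)) ≤
      (C1 * Λ * (1 + κ) + (if Pt P j then ρ j *
        (‖ν j - v + (dl K j : ℤ) - 1‖ * ‖ν (j + 1) - v + (dl K (j + 1) : ℤ) + 1‖) else 0)) *
        Hm N P Λ K := by
    intro j hj
    have hpos : 0 ≤ C1 * Λ * (1 + (κ:ℝ)) := by positivity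
    by_cases hPt : Pt P j
    · rw [if_pos hPt]
      have hjN : j ≠ N := by rintro rfl; exact not_Pt_top hP hPt
      have e : rr N P ν v K j =
          ‖ν j - v + (dl K j : ℤ) - 1‖ * ‖ν (j + 1) - v + (dl K (j + 1) : ℤ) + 1‖ := by
        unfold rr rA rB
        rw [if_neg hPt.2.1, if_neg hjN, if_pos hPt.2.2]
      rw [← e]
      have e2 : (if K j = 0 then 0 else Hm N P Λ (dec K j)) = ρ j * Hm N P Λ K := by
        simp only [hρ]
        split_ifs with h1 h2
        · simp
        · rw [Hm_dec_Pt N P Λ hΛ K j hj hPt h1, if_pos h2]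
        · rw [Hm_dec_Pt N P Λ hΛ K j hj hPt h1, if_neg h2]
      rw [e2]
      have : 0 ≤ C1 * Λ * (1 + (κ:ℝ)) * Hm N P Λ K := by positivity
      nlinarith
    · rw [if_neg hPt, add_zero]
      have h1 := hr K hs j hj hPt
      have h0 := rr_nonneg N P ν v K j
      by_cases hK : K j = 0
      · rw [if_pos hK, mul_zero]; positivity
      · rw [if_neg hK]
        calc _ ≤ (C1 * (1 + κ)) * (Λ * Hm N P Λ K) :=
              mul_le_mul h1 (Hm_dec_nonPt N P Λ hΛ K j hj hPt hK) (Hm_pos N P Λ hΛ _).le (by positivity)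
          _ = _ := by ring
  refine (Finset.sum_le_sum hterm).trans ?_
  rw [← Finset.sum_mul, Finset.sum_add_distrib, Finset.sum_const]
  simp only [Nat.card_Icc, nsmul_eq_mul, Nat.add_sub_cancel]
  refine mul_le_mul_of_nonneg_right ?_ hH.le
  refine le_trans ?_ (Complex.re_le_norm _)
  rw [hC2] at key
  nlinarith

lemma extN_supp (N : ℕ) (k : Fin N → ℕ) : ∀ i, i ∉ Icc 1 N → extN N k i = 0 := by
  intro i hi
  unfold extN
  rw [dif_neg]
  simpa using hi

lemma supp_extN (N : ℕ) (K : ℕ → ℕ) (hs : ∀ i, i ∉ Icc 1 N → K i = 0) :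
    K = extN N (fun i => K (i.val + 1)) := by
  funext i
  by_cases h : i ∈ Icc 1 N
  · have h' : 1 ≤ i ∧ i ≤ N := by simpa using h
    unfold extN
    rw [dif_pos h']
    congr 1
    simp; omega
  · rw [hs i h, extN_supp _ _ _ h]

lemma wt_norm_le (N j : ℕ) : ‖wt N j‖ ≤ 1 := by
  unfold wt; split_ifs <;> norm_num

set_option maxHeartbeats 1000000 in
theorem gB_bound (N : ℕ) (hN : 1 ≤ N) (P : Finset ℕ) (hP : P ⊆ Icc 1 N) (ν : ℕ → ℂ) (v : ℂ)
    (hz : ∀ i ∈ Icc 1 N, ∀ k : ℤ, ν i - v ≠ k)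
    (hq : ∀ K : ℕ → ℕ, (∀ i, i ∉ Icc 1 N → K i = 0) → 0 < ∑ i ∈ Icc 1 N, K i → qB N K ν ≠ 0)
    (Λ : ℝ) (hΛ : 1 ≤ Λ) :
    ∃ C : ℝ, 0 ≤ C ∧ ∀ K : ℕ → ℕ, (∀ i, i ∉ Icc 1 N → K i = 0) →
      gB N P ν v K ≤ C * Hm N P Λ K := by
  obtain ⟨M0, hM⟩ := main_ineq N hN P hP ν v hz Λ hΛ
  have hfin : (Set.Iic (fun _ : Fin N => M0)).Finite := Set.finite_Iic _
  set C := ∑ k ∈ hfin.toFinset, gB N P ν v (extN N k) / Hm N P Λ (extN N k) with hC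
  have hgB0 : ∀ K, 0 ≤ gB N P ν v K := fun K =>
    mul_nonneg (norm_nonneg _) (Finset.prod_nonneg fun i _ => Bf_nonneg _ _ _ _ _)
  have hpos : ∀ k : Fin N → ℕ, 0 ≤ gB N P ν v (extN N k) / Hm N P Λ (extN N k) := fun k =>
    div_nonneg (hgB0 _) (Hm_pos N P Λ hΛ _).le
  have hC0 : 0 ≤ C := Finset.sum_nonneg fun k _ => hpos k
  refine ⟨C, hC0, ?_⟩
  have hmain : ∀ m : ℕ, ∀ K : ℕ → ℕ, (∀ i, i ∉ Icc 1 N → K i = 0) → ∑ i ∈ Icc 1 N, K i = m →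
      gB N P ν v K ≤ C * Hm N P Λ K := by
    intro m
    induction m using Nat.strong_induction_on with
    | _ m ih =>
      intro K hs hm
      by_cases hsm : ∑ i ∈ Icc 1 N, K i ≤ M0
      · have e := supp_extN N K hs
        set k : Fin N → ℕ := (fun i => K (i.val + 1))
        have hk : k ∈ hfin.toFinset := by
          rw [Set.Finite.mem_toFinset]
          intro i
          refine le_trans ?_ hsm
          exact Finset.single_le_sum (f := K) (fun i _ => Nat.zero_le _)
            (Finset.mem_Icc.2 ⟨by omega, by omega⟩)
        have := Finset.single_le_sum (f := fun k => gB N P ν v (extN N k) / Hm N P Λ (extN N k))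
          (fun k _ => hpos k) hk
        rw [← hC, div_le_iff₀ (Hm_pos N P Λ hΛ _)] at this
        rwa [← e] at this
      · have hpos : 0 < ∑ i ∈ Icc 1 N, K i := by omega
        have hq' := hq K hs hpos
        have hqn : 0 < ‖qB N K ν‖ := norm_pos_iff.2 hq'
        have h1 := cB_rec N hN ν K hq' hpos
        have hB0 : 0 ≤ ∏ i ∈ Icc 1 N, Bf P ν v i (dl K i) :=
          Finset.prod_nonneg fun i _ => Bf_nonneg _ _ _ _ _
        have h2 : ‖qB N K ν‖ * gB N P ν v K ≤
            ∑ j ∈ Icc 1 N, rr N P ν v K j * (if K j = 0 then 0 else gB N P ν v (dec K j)) := by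
          unfold gB
          rw [← mul_assoc, ← norm_mul, h1]
          refine (mul_le_mul_of_nonneg_right (norm_sum_le _ _) hB0).trans ?_
          rw [Finset.sum_mul]
          refine Finset.sum_le_sum fun j hj => ?_
          by_cases hK : K j = 0
          · simp [hK]
          · rw [if_neg hK, if_neg hK, prod_Bf_dec N P ν v hz K j hj hK, norm_mul]
            have := wt_norm_le N j
            have h5 : 0 ≤ ‖cB N ν (dec K j)‖ * (rr N P ν v K j * ∏ i ∈ Icc 1 N, Bf P ν v i (dl (dec K j) i)) :=
              mul_nonneg (norm_nonneg _) (mul_nonneg (rr_nonneg _ _ _ _ _ _)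
                (Finset.prod_nonneg fun i _ => Bf_nonneg _ _ _ _ _))
            calc _ = ‖wt N j‖ * (‖cB N ν (dec K j)‖ * (rr N P ν v K j * ∏ i ∈ Icc 1 N, Bf P ν v i (dl (dec K j) i))) := by ring
              _ ≤ 1 * (‖cB N ν (dec K j)‖ * (rr N P ν v K j * ∏ i ∈ Icc 1 N, Bf P ν v i (dl (dec K j) i))) :=
                mul_le_mul_of_nonneg_right this h5
              _ = _ := by ring
        have h3 : ∑ j ∈ Icc 1 N, rr N P ν v K j * (if K j = 0 then 0 else gB N P ν v (dec K j)) ≤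
            C * ∑ j ∈ Icc 1 N, rr N P ν v K j * (if K j = 0 then 0 else Hm N P Λ (dec K j)) := by
          rw [Finset.mul_sum]
          refine Finset.sum_le_sum fun j hj => ?_
          by_cases hK : K j = 0
          · simp [hK]
          · rw [if_neg hK, if_neg hK]
            have h6 := sum_dec N K j hj hK
            have := ih (∑ i ∈ Icc 1 N, dec K j i) (by omega) (dec K j) (dec_supp hs j) rfl
            have := mul_le_mul_of_nonneg_left this (rr_nonneg N P ν v K j)
            linarith
        have h4 := mul_le_mul_of_nonneg_left (hM K hs (by omega)) hC0
        have h5 : ‖qB N K ν‖ * gB N P ν v K ≤ ‖qB N K ν‖ * (C * Hm N P Λ K) := by linarith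
        exact le_of_mul_le_mul_left h5 hqn
  intro K hs
  exact hmain _ K hs rfl

lemma summable_pi {f : ℕ → ℝ} (h0 : ∀ k, 0 ≤ f k) (hf : Summable f) (N : ℕ) :
    Summable (fun t : Fin N → ℕ => ∏ i, f (t i)) := by
  induction N with
  | zero => exact Summable.of_finite
  | succ N ih =>
    rw [← (Fin.consEquiv (fun _ : Fin (N+1) => ℕ)).summable_iff]
    have := hf.mul_of_nonneg ih h0 (fun t => Finset.prod_nonneg fun i _ => h0 _)
    refine this.congr ?_
    rintro ⟨a, t⟩
    simp [Fin.prod_univ_succ, Fin.consEquiv]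

lemma prod_Icc_fin {M : Type*} [CommMonoid M] (N : ℕ) (F : ℕ → M) :
    ∏ i ∈ Icc 1 N, F i = ∏ i : Fin N, F (i.val + 1) := by
  rw [Fin.prod_univ_eq_prod_range (fun i => F (i + 1)) N, Finset.range_eq_Ico,
    Finset.prod_Ico_add' F 0 N 1]
  rfl

lemma extN_val (N : ℕ) (k : Fin N → ℕ) (i : Fin N) : extN N k (i.val + 1) = k i := by
  unfold extN
  rw [dif_pos ⟨by omega, by omega⟩]
  congr 1

lemma Gamma_shift {z : ℂ} {ε : ℝ} (hε : 0 < ε) (h : ∀ m : ℤ, ε ≤ ‖z + m‖) (δ : ℤ) (t : ℕ) :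
    ‖Complex.Gamma (z + δ + t)‖⁻¹ ≤ (ε⁻¹) ^ t * ‖Complex.Gamma (z + δ)‖⁻¹ := by
  induction t with
  | zero => simp
  | succ t ih =>
    have e : z + δ + ((t + 1 : ℕ) : ℂ) = (z + δ + t) + 1 := by push_cast; ring
    have h1 := h (δ + t)
    have e2 : z + ((δ + t : ℤ) : ℂ) = z + δ + t := by push_cast; ring
    rw [e2] at h1
    have hne : z + δ + t ≠ 0 := by
      intro h0; rw [h0] at h1; simp at h1; linarith
    rw [e, Complex.Gamma_add_one _ hne, norm_mul, mul_inv, pow_succ]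
    calc _ ≤ ε⁻¹ * ((ε⁻¹) ^ t * ‖Complex.Gamma (z + δ)‖⁻¹) := by
            apply mul_le_mul (inv_anti₀ hε h1) ih (by positivity) (by positivity)
      _ = _ := by ring

lemma Gamma_refl_norm (z : ℂ) (δ : ℤ) :
    ‖Complex.Gamma (-z + 1 - δ)‖⁻¹ ≤ (‖Complex.sin (Real.pi * z)‖ / Real.pi) * ‖Complex.Gamma (z + δ)‖ ∨
    Complex.sin (Real.pi * z) = 0 := by
  by_cases hs : Complex.sin (Real.pi * z) = 0
  · exact Or.inr hs
  left
  have h1 := Complex.Gamma_mul_Gamma_one_sub (z + δ)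
  have h2 : ‖Complex.sin (Real.pi * (z + δ))‖ = ‖Complex.sin (Real.pi * z)‖ := by
    have : (Real.pi : ℂ) * (z + δ) = Real.pi * z + δ * Real.pi := by ring
    rw [this, Complex.sin_antiperiodic.add_int_mul_eq, norm_mul]
    have : ‖((δ.negOnePow : ℤ) : ℂ)‖ = 1 := by simp
    rw [this, one_mul]
  have e : 1 - (z + δ) = -z + 1 - δ := by ring
  rw [e] at h1
  have h3 := congrArg norm h1
  rw [norm_mul, norm_div, h2] at h3
  have hsp : 0 < ‖Complex.sin (Real.pi * z)‖ := norm_pos_iff.2 hs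
  have hpi : ‖(Real.pi : ℂ)‖ = Real.pi := by simp [abs_of_pos Real.pi_pos]
  rw [hpi] at h3
  have hpp := Real.pi_pos
  have hG : ‖Complex.Gamma (-z + 1 - δ)‖ ≠ 0 := by
    intro h0; rw [h0, mul_zero] at h3
    have : 0 < Real.pi / ‖Complex.sin (Real.pi * z)‖ := by positivity
    linarith
  apply le_of_eq
  generalize ‖Complex.sin (Real.pi * z)‖ = w at *
  field_simp at h3 ⊢
  linarith

lemma sin_ne_of_nonint {z : ℂ} (hz : ∀ k : ℤ, z ≠ k) : Complex.sin (Real.pi * z) ≠ 0 := by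
  intro h
  rw [Complex.sin_eq_zero_iff] at h
  obtain ⟨k, hk⟩ := h
  apply hz k
  have : (Real.pi : ℂ) ≠ 0 := by exact_mod_cast Real.pi_ne_zero
  apply mul_left_cancel₀ this
  rw [hk]; ring

def den (P : Finset ℕ) (ν : ℕ → ℂ) (v : ℂ) (K L : ℕ → ℕ) (i : ℕ) : ℂ :=
  if i ∈ P then zfact ((L i : ℤ) - K i) * poch (ν i - v + 1) ((L i : ℤ) - K (i - 1))
  else zfact ((L i : ℤ) - K (i - 1)) * poch (-ν i + v + 1) ((L i : ℤ) - K i)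

def base (P : Finset ℕ) (K : ℕ → ℕ) (i : ℕ) : ℕ := if i ∈ P then K i else K (i - 1)

lemma zfact_nat (t : ℕ) : zfact (t : ℤ) = (t.factorial : ℂ) := by
  unfold zfact; simp

lemma zfact_neg {z : ℤ} (h : z < 0) : zfact z = 0 := by
  unfold zfact; rw [if_neg (by omega)]

lemma den_bound1 (P : Finset ℕ) (ν : ℕ → ℂ) (v : ℂ) (i : ℕ) (hz : ∀ k : ℤ, ν i - v ≠ k) :
    ∃ D E : ℝ, 0 ≤ D ∧ 1 ≤ E ∧ ∀ K L : ℕ → ℕ,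
      ‖den P ν v K L i‖⁻¹ ≤ if base P K i ≤ L i then
        D * (E ^ (L i - base P K i) / (L i - base P K i).factorial) * Bf P ν v i (dl K i) else 0 := by
  by_cases hi : i ∈ P
  · have hz1 : ∀ k : ℤ, ν i - v + 1 ≠ k := by
      intro k h; apply hz (k - 1); push_cast; linear_combination h
    obtain ⟨ε, hε, hε1, hd⟩ := exists_dist _ hz1
    refine ⟨‖Complex.Gamma (ν i - v + 1)‖, ε⁻¹, by positivity, (one_le_inv₀ hε).2 hε1, ?_⟩
    intro K L
    unfold den base Bf
    simp only [if_pos hi]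
    split_ifs with h
    · obtain ⟨t, ht⟩ := Nat.exists_eq_add_of_le h
      have e1 : (L i : ℤ) - K i = (t : ℤ) := by omega
      have e2 : (L i : ℤ) - K (i - 1) = dl K i + t := by unfold dl; omega
      have e3 : L i - K i = t := by omega
      rw [e1, e2, e3, zfact_nat, norm_mul, mul_inv, poch, norm_div, inv_div]
      have e4 : ν i - v + 1 + ((dl K i + t : ℤ) : ℂ) = ν i - v + 1 + (dl K i : ℤ) + t := by
        push_cast; ring
      have := Gamma_shift hε hd (dl K i) t
      rw [e4, div_eq_mul_inv ‖_‖]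
      have ef : ‖((t.factorial : ℕ) : ℂ)‖ = t.factorial := by simp
      rw [ef]
      calc _ ≤ ((t.factorial : ℝ))⁻¹ * (‖Complex.Gamma (ν i - v + 1)‖ * ((ε⁻¹) ^ t *
            ‖Complex.Gamma (ν i - v + 1 + (dl K i : ℤ))‖⁻¹)) := by gcongr
        _ = _ := by ring
    · rw [zfact_neg (by omega)]; simp
  · have hz1 : ∀ k : ℤ, -ν i + v + 1 ≠ k := by
      intro k h; apply hz (-k + 1); push_cast; linear_combination -h
    obtain ⟨ε, hε, hε1, hd⟩ := exists_dist _ hz1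
    refine ⟨‖Complex.Gamma (-ν i + v + 1)‖ * (‖Complex.sin (Real.pi * (ν i - v))‖ / Real.pi), ε⁻¹,
      by positivity, (one_le_inv₀ hε).2 hε1, ?_⟩
    intro K L
    unfold den base Bf
    simp only [if_neg hi]
    split_ifs with h
    · obtain ⟨t, ht⟩ := Nat.exists_eq_add_of_le h
      have e1 : (L i : ℤ) - K (i - 1) = (t : ℤ) := by omega
      have e2 : (L i : ℤ) - K i = -dl K i + t := by unfold dl; omega
      have e3 : L i - K (i - 1) = t := by omega
      rw [e1, e2, e3, zfact_nat, norm_mul, mul_inv, poch, norm_div, inv_div]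
      have e4 : -ν i + v + 1 + ((-dl K i + t : ℤ) : ℂ) = -ν i + v + 1 + ((-dl K i : ℤ) : ℂ) + t := by
        push_cast; ring
      have h1 := Gamma_shift hε hd (-dl K i) t
      have h2 := (Gamma_refl_norm (ν i - v) (dl K i)).resolve_right (sin_ne_of_nonint hz)
      have e5 : -(ν i - v) + 1 - (dl K i : ℤ) = -ν i + v + 1 + ((-dl K i : ℤ) : ℂ) := by
        push_cast; ring
      rw [e5] at h2
      rw [e4, div_eq_mul_inv ‖Complex.Gamma (-ν i + v + 1)‖]
      have ef : ‖((t.factorial : ℕ) : ℂ)‖ = t.factorial := by simp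
      rw [ef]
      calc _ ≤ ((t.factorial : ℝ))⁻¹ * (‖Complex.Gamma (-ν i + v + 1)‖ * ((ε⁻¹) ^ t *
            ((‖Complex.sin (Real.pi * (ν i - v))‖ / Real.pi) * ‖Complex.Gamma (ν i - v + (dl K i : ℤ))‖))) := by
            gcongr
            exact h1.trans (by gcongr)
        _ = _ := by ring
    · rw [zfact_neg (by omega)]; simp

lemma den_bound (N : ℕ) (P : Finset ℕ) (ν : ℕ → ℂ) (v : ℂ)
    (hz : ∀ i ∈ Icc 1 N, ∀ k : ℤ, ν i - v ≠ k) :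
    ∃ D E : ℝ, 0 ≤ D ∧ 1 ≤ E ∧ ∀ K L : ℕ → ℕ, ∀ i ∈ Icc 1 N,
      ‖den P ν v K L i‖⁻¹ ≤ if base P K i ≤ L i then
        D * (E ^ (L i - base P K i) / (L i - base P K i).factorial) * Bf P ν v i (dl K i) else 0 := by
  have h : ∀ i, ∃ D E : ℝ, 0 ≤ D ∧ 1 ≤ E ∧ (i ∈ Icc 1 N → ∀ K L : ℕ → ℕ,
      ‖den P ν v K L i‖⁻¹ ≤ if base P K i ≤ L i then
        D * (E ^ (L i - base P K i) / (L i - base P K i).factorial) * Bf P ν v i (dl K i) else 0) := by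
    intro i
    by_cases hi : i ∈ Icc 1 N
    · obtain ⟨D, E, h1, h2, h3⟩ := den_bound1 P ν v i (hz i hi)
      exact ⟨D, E, h1, h2, fun _ => h3⟩
    · exact ⟨0, 1, le_rfl, le_rfl, fun h => absurd h hi⟩
  choose D E h1 h2 h3 using h
  refine ⟨∑ i ∈ Icc 1 N, D i, 1 + ∑ i ∈ Icc 1 N, E i, Finset.sum_nonneg fun i _ => h1 i, ?_, ?_⟩
  · have : 0 ≤ ∑ i ∈ Icc 1 N, E i := Finset.sum_nonneg fun i _ => by linarith [h2 i]
    linarith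
  · intro K L i hi
    refine (h3 i hi K L).trans ?_
    split_ifs with h
    · have hD : D i ≤ ∑ i ∈ Icc 1 N, D i := Finset.single_le_sum (fun i _ => h1 i) hi
      have hE : E i ≤ 1 + ∑ i ∈ Icc 1 N, E i := by
        have : E i ≤ ∑ i ∈ Icc 1 N, E i :=
          Finset.single_le_sum (f := E) (fun i _ => by linarith [h2 i]) hi
        linarith
      have := Bf_nonneg P ν v i (dl K i)
      have := h1 i
      have := h2 i
      have : 0 ≤ ∑ i ∈ Icc 1 N, D i := Finset.sum_nonneg fun i _ => h1 i
      gcongr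
    · rfl

lemma base_le (N : ℕ) (P : Finset ℕ) (K : ℕ → ℕ) (hs : ∀ i, i ∉ Icc 1 N → K i = 0) (i : ℕ) (hi : 1 ≤ i) :
    base P K i ≤ kap N P K := by
  unfold base
  split_ifs with h
  · exact le_kap hs i (fun h' => h'.2.1 h)
  · refine le_kap hs (i - 1) (fun h' => h ?_)
    have := h'.2.2
    rwa [Nat.sub_add_cancel hi] at this

lemma Hm_le (N : ℕ) (P : Finset ℕ) (A : ℝ) (hA : 1 ≤ A) (K : ℕ → ℕ) :
    Hm N P (2 * (2 ^ N * A)) K * A ^ kap N P K ≤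
      ∏ i ∈ Icc 1 N, (uu (K i) + (1 / 2) ^ (K i)) := by
  set κ := kap N P K with hκ
  set B : ℝ := 2 ^ N * A with hB
  have hB1 : 0 < B := by positivity
  have hNf : ∏ _i ∈ Icc 1 N, (2:ℝ) ^ κ = (2 ^ N) ^ κ := by
    rw [Finset.prod_const, Nat.card_Icc, Nat.add_sub_cancel, ← pow_mul, ← pow_mul, mul_comm]
  have hB' : B ^ κ = ∏ i ∈ Icc 1 N, if Pt P i then 1 else B ^ (K i) := by
    have : ∀ i ∈ Icc 1 N, (if Pt P i then 1 else B ^ (K i)) = B ^ (if Pt P i then 0 else K i) := by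
      intro i _; split_ifs <;> simp
    rw [Finset.prod_congr rfl this, Finset.prod_pow_eq_pow_sum]; rfl
  have h1 : Hm N P (2 * B) K ≤ ∏ i ∈ Icc 1 N, (2:ℝ) ^ κ *
      (if Pt P i then uu (K i) else ((2 * B)⁻¹) ^ (K i)) := by
    unfold Hm
    refine Finset.prod_le_prod (fun i _ => ?_) (fun i _ => ?_)
    · have := uu_pos (K i)
      split_ifs <;> positivity
    · have := uu_pos (K i)
      split_ifs
      · rw [mul_comm]
        gcongr
        · norm_num
        · exact min_le_right _ _
      · have h2 : (1:ℝ) ≤ 2 ^ κ := one_le_pow₀ (by norm_num)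
        have h3 : 0 ≤ ((2 * B)⁻¹) ^ (K i) := by positivity
        nlinarith
  rw [Finset.prod_mul_distrib, hNf] at h1
  calc _ ≤ ((2 ^ N) ^ κ * ∏ i ∈ Icc 1 N, (if Pt P i then uu (K i) else ((2 * B)⁻¹) ^ (K i))) * A ^ κ := by
        gcongr
    _ = B ^ κ * ∏ i ∈ Icc 1 N, (if Pt P i then uu (K i) else ((2 * B)⁻¹) ^ (K i)) := by
        rw [hB, mul_pow]; ring
    _ = ∏ i ∈ Icc 1 N, ((if Pt P i then 1 else B ^ (K i)) * (if Pt P i then uu (K i) else ((2 * B)⁻¹) ^ (K i))) := by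
        rw [hB', Finset.prod_mul_distrib]
    _ ≤ _ := by
        refine Finset.prod_le_prod (fun i _ => ?_) (fun i _ => ?_)
        · have := uu_pos (K i)
          split_ifs <;> positivity
        · have := uu_pos (K i)
          split_ifs
          · rw [one_mul]; have : (0:ℝ) ≤ (1/2) ^ (K i) := by positivity
            linarith
          · rw [← mul_pow]
            have : B * (2 * B)⁻¹ = 1 / 2 := by field_simp
            rw [this]; linarith

set_option maxHeartbeats 1000000 in
theorem joint_summable (N : ℕ) (hN : 1 ≤ N) (P : Finset ℕ) (hP : P ⊆ Icc 1 N) (ν : ℕ → ℂ) (v : ℂ)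
    (hz : ∀ i ∈ Icc 1 N, ∀ k : ℤ, ν i - v ≠ k)
    (hq : ∀ K : ℕ → ℕ, (∀ i, i ∉ Icc 1 N → K i = 0) → 0 < ∑ i ∈ Icc 1 N, K i → qB N K ν ≠ 0)
    (R : ℝ) (hR : 1 ≤ R) :
    Summable (fun q : (Fin N → ℕ) × (Fin N → ℕ) =>
      ‖cB N ν (extN N q.1)‖ * (∏ i ∈ Icc 1 N, ‖den P ν v (extN N q.1) (extN N q.2) i‖⁻¹) *
        R ^ (∑ i ∈ Icc 1 N, extN N q.2 i + extN N q.1 N)) := by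
  obtain ⟨D, E, hD, hE, hden⟩ := den_bound N P ν v hz
  set A : ℝ := R ^ (N + 1) with hA
  have hA1 : 1 ≤ A := one_le_pow₀ hR
  have hΛ : (1:ℝ) ≤ 2 * (2 ^ N * A) := by
    have : (1:ℝ) ≤ 2 ^ N := one_le_pow₀ (by norm_num)
    nlinarith
  obtain ⟨C, hC, hgB⟩ := gB_bound N hN P hP ν v hz hq _ hΛ
  set f : ℕ → ℝ := fun k => uu k + (1 / 2) ^ k with hf
  set g : ℕ → ℝ := fun t => D * ((E * R) ^ t / t.factorial) with hg
  have hf0 : ∀ k, 0 ≤ f k := fun k => by have := uu_pos k; simp only [hf]; positivity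
  have hg0 : ∀ k, 0 ≤ g k := fun k => by simp only [hg]; positivity
  have hfs : Summable f := uu_summable.add (summable_geometric_of_lt_one (by norm_num) (by norm_num))
  have hgs : Summable g := (Real.summable_pow_div_factorial (E * R)).mul_left D
  have hFG := (summable_pi hf0 hfs N).mul_of_nonneg (summable_pi hg0 hgs N)
    (fun t => Finset.prod_nonneg fun i _ => hf0 _) (fun t => Finset.prod_nonneg fun i _ => hg0 _)
  let S : Set ((Fin N → ℕ) × (Fin N → ℕ)) :=
    {q | ∀ i : Fin N, base P (extN N q.1) (i.val + 1) ≤ q.2 i}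
  let Φ : S → (Fin N → ℕ) × (Fin N → ℕ) := fun q =>
    (q.1.1, fun i => q.1.2 i - base P (extN N q.1.1) (i.val + 1))
  have hΦ : Function.Injective Φ := by
    rintro ⟨⟨a, b⟩, h⟩ ⟨⟨a', b'⟩, h'⟩ e
    simp only [Φ, Prod.mk.injEq] at e
    obtain ⟨e1, e2⟩ := e
    subst e1
    have : b = b' := by
      funext i
      have := congrFun e2 i
      have h1 := h i
      have h2 := h' i
      simp only at this h1 h2
      omega
    subst this
    rfl
  have hsum := hFG.comp_injective hΦ
  have hsum2 := (summable_subtype_iff_indicator (s := S) (f := fun q : (Fin N → ℕ) × (Fin N → ℕ) =>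
    (∏ i, f (q.1 i)) * ∏ i : Fin N, g (q.2 i - base P (extN N q.1) (i.val + 1)))).1 hsum
  refine Summable.of_nonneg_of_le (fun q => ?_) (fun q => ?_) (hsum2.mul_left C)
  · refine mul_nonneg (mul_nonneg (norm_nonneg _) (Finset.prod_nonneg fun i _ => by positivity)) (by positivity)
  · obtain ⟨k, l⟩ := q
    simp only
    set K := extN N k with hK
    set L := extN N l with hL
    have hs := extN_supp N k
    by_cases hq : (k, l) ∈ S
    · rw [Set.indicator_of_mem hq]
      have hb : ∀ i ∈ Icc 1 N, base P K i ≤ L i := by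
        intro i hi
        rw [Finset.mem_Icc] at hi
        have := hq ⟨i - 1, by omega⟩
        simp only [Nat.sub_add_cancel hi.1] at this
        rw [hL]
        unfold extN
        rw [dif_pos hi]
        exact this
      set T : ℕ → ℕ := fun i => L i - base P K i with hT
      have h1 : ∏ i ∈ Icc 1 N, ‖den P ν v K L i‖⁻¹ ≤ (∏ i ∈ Icc 1 N,
          (D * (E ^ (T i) / (T i).factorial))) * ∏ i ∈ Icc 1 N, Bf P ν v i (dl K i) := by
        rw [← Finset.prod_mul_distrib]
        refine Finset.prod_le_prod (fun i _ => by positivity) (fun i hi => ?_)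
        have := hden K L i hi
        rwa [if_pos (hb i hi)] at this
      have hexp : ∑ i ∈ Icc 1 N, L i + K N ≤ ∑ i ∈ Icc 1 N, T i + (N + 1) * kap N P K := by
        have e : ∑ i ∈ Icc 1 N, L i ≤ ∑ i ∈ Icc 1 N, (T i + kap N P K) := by
          refine Finset.sum_le_sum fun i hi => ?_
          have h1 := hb i hi
          have h2 := base_le N P K hs i (Finset.mem_Icc.1 hi).1
          simp only [hT]; omega
        rw [Finset.sum_add_distrib, Finset.sum_const, Nat.card_Icc, Nat.add_sub_cancel, smul_eq_mul] at e
        have := le_kap (P := P) hs N (not_Pt_top hP)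
        rw [← hK] at this
        linarith
      have hB0 : 0 ≤ ∏ i ∈ Icc 1 N, Bf P ν v i (dl K i) :=
          Finset.prod_nonneg fun i _ => Bf_nonneg _ _ _ _ _
      have hDE0 : 0 ≤ (∏ i ∈ Icc 1 N, (D * (E ^ (T i) / (T i).factorial))) :=
        Finset.prod_nonneg fun i _ => by positivity
      have hg2 : (∏ i ∈ Icc 1 N, (D * (E ^ (T i) / (T i).factorial))) * R ^ (∑ i ∈ Icc 1 N, T i) =
          ∏ i : Fin N, g (l i - base P K (i.val + 1)) := by
        rw [← Finset.prod_pow_eq_pow_sum, ← Finset.prod_mul_distrib, prod_Icc_fin]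
        refine Finset.prod_congr rfl fun i _ => ?_
        simp only [hg, hT, hL, extN_val]
        rw [mul_pow]; ring
      have hf2 : ∏ i ∈ Icc 1 N, (uu (K i) + (1 / 2) ^ (K i)) = ∏ i, f (k i) := by
        rw [prod_Icc_fin]
        refine Finset.prod_congr rfl fun i _ => ?_
        simp only [hf, hK, extN_val]
      calc _ ≤ ‖cB N ν K‖ * ((∏ i ∈ Icc 1 N,
          (D * (E ^ (T i) / (T i).factorial))) * ∏ i ∈ Icc 1 N, Bf P ν v i (dl K i)) *
            R ^ (∑ i ∈ Icc 1 N, T i + (N + 1) * kap N P K) := by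
            gcongr
        _ = gB N P ν v K * A ^ kap N P K * ((∏ i ∈ Icc 1 N, (D * (E ^ (T i) / (T i).factorial))) * R ^ (∑ i ∈ Icc 1 N, T i)) := by
            rw [hA, pow_add, pow_mul]; unfold gB; ring
        _ ≤ (C * Hm N P (2 * (2 ^ N * A)) K) * A ^ kap N P K * ((∏ i ∈ Icc 1 N, (D * (E ^ (T i) / (T i).factorial))) * R ^ (∑ i ∈ Icc 1 N, T i)) := by
            have := hgB K hs
            gcongr
        _ = C * (Hm N P (2 * (2 ^ N * A)) K * A ^ kap N P K) * ((∏ i ∈ Icc 1 N, (D * (E ^ (T i) / (T i).factorial))) * R ^ (∑ i ∈ Icc 1 N, T i)) := by ring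
        _ ≤ C * (∏ i, f (k i)) * ((∏ i ∈ Icc 1 N, (D * (E ^ (T i) / (T i).factorial))) * R ^ (∑ i ∈ Icc 1 N, T i)) := by
            have := Hm_le N P A hA1 K
            rw [hf2] at this
            gcongr
        _ = _ := by rw [hg2, mul_assoc]
    · rw [Set.indicator_of_notMem hq, mul_zero]
      simp only [S, Set.mem_ofPred_eq, not_forall, not_le] at hq
      obtain ⟨i, hi⟩ := hq
      have h0 : ‖den P ν v K L (i.val + 1)‖⁻¹ ≤ 0 := by
        have := hden K L (i.val + 1) (Finset.mem_Icc.2 ⟨by omega, by omega⟩)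
        rwa [if_neg (by rw [hL, extN_val]; exact not_le.2 hi)] at this
      have h1 : ‖den P ν v K L (i.val + 1)‖⁻¹ = 0 := le_antisymm h0 (by positivity)
      rw [Finset.prod_eq_zero (i := i.val + 1) (Finset.mem_Icc.2 ⟨by omega, by omega⟩) h1]
      simp

def RG (z : ℂ) : ℂ := (Complex.Gamma z)⁻¹

lemma RG_step (z : ℂ) : RG z = z * RG (z + 1) := by
  unfold RG
  exact Complex.one_div_Gamma_eq_self_mul_one_div_Gamma_add_one z

lemma RG_pred (α : ℂ) (k : ℂ) : RG (α - 1 - k) = (α - 1 - k) * RG (α - k) := by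
  rw [RG_step]; congr 2; ring

lemma RG_cont : Continuous RG := by
  unfold RG
  exact Complex.differentiable_one_div_Gamma.continuous

lemma RG_ne {z : ℂ} (hz : ∀ k : ℤ, z ≠ k) : RG z ≠ 0 := by
  unfold RG
  apply inv_ne_zero
  apply Complex.Gamma_ne_zero
  intro m h
  apply hz (-m)
  rw [h]; push_cast; rfl

lemma RG_prod (α : ℂ) (k : ℕ) : RG (α - k) = (∏ j ∈ range k, (α - 1 - j)) * RG α := by
  induction k with
  | zero => simp
  | succ k ih =>
    rw [Finset.prod_range_succ]
    have e : α - ((k + 1 : ℕ) : ℂ) = α - 1 - k := by push_cast; ring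
    rw [e, RG_pred, ih]; ring

def tr (φ : ℕ → ℂ) (α β : ℂ) (k : ℕ) : ℂ := φ k * (RG (α - k) * RG (β - k))

lemma dist_lin {z : ℂ} (hz : ∀ k : ℤ, z ≠ k) :
    ∃ c : ℝ, 0 < c ∧ ∀ j : ℕ, c * (j + 1) ≤ ‖z - 1 - j‖ := by
  obtain ⟨ε, hε, hε1, hd⟩ := exists_dist z hz
  refine ⟨ε / (ε + ‖z‖ + 1), by positivity, fun j => ?_⟩
  have h1 := hd (-(1 + j))
  have e : z + ((-(1 + j) : ℤ) : ℂ) = z - 1 - j := by push_cast; ring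
  rw [e] at h1
  have h2 : (j:ℝ) + 1 ≤ ‖z - 1 - j‖ + ‖z‖ := by
    have : ‖((j:ℂ) + 1)‖ = j + 1 := by
      have := Complex.norm_natCast (j + 1)
      push_cast at this
      exact this
    rw [← this]
    have e : (j:ℂ) + 1 = z - (z - 1 - j) := by ring
    rw [e]
    refine (norm_sub_le _ _).trans ?_
    linarith
  rw [div_mul_eq_mul_div, div_le_iff₀ (by positivity)]
  have := norm_nonneg z
  nlinarith [norm_nonneg (z - 1 - j)]

lemma sum_inv_AB {α β : ℂ} (hα : ∀ k : ℤ, α ≠ k) (hβ : ∀ k : ℤ, β ≠ k) :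
    ∃ T : ℝ, 0 ≤ T ∧ ∀ k : ℕ, ∑ j ∈ range k, ‖(α - 1 - j) * (β - 1 - j)‖⁻¹ ≤ T := by
  obtain ⟨c, hc, h1⟩ := dist_lin hα
  obtain ⟨c', hc', h2⟩ := dist_lin hβ
  have hs : Summable (fun j : ℕ => ‖(α - 1 - j) * (β - 1 - j)‖⁻¹) := by
    have h0 : Summable (fun j : ℕ => (c * c')⁻¹ * (1 / ((j + 1 : ℕ) : ℝ) ^ 2)) :=
      ((summable_nat_add_iff 1).2 (Real.summable_one_div_nat_pow.2 (by norm_num : 1 < 2))).mul_left _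
    refine Summable.of_nonneg_of_le (fun j => by positivity) (fun j => ?_) h0
    have e : (c * c')⁻¹ * (1 / ((j + 1 : ℕ) : ℝ) ^ 2) = ((c * (j + 1)) * (c' * (j + 1)))⁻¹ := by
      push_cast; field_simp
    rw [e, norm_mul]
    apply inv_anti₀ (by positivity)
    exact mul_le_mul (h1 j) (h2 j) (by positivity) (by positivity)
  exact ⟨∑' j : ℕ, ‖(α - 1 - j) * (β - 1 - j)‖⁻¹, tsum_nonneg fun j => by positivity,
    fun k => hs.sum_le_tsum _ fun j _ => by positivity⟩

set_option maxHeartbeats 400000 in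
lemma RGRG_bound {α β : ℂ} (hα : ∀ k : ℤ, α ≠ k) (hβ : ∀ k : ℤ, β ≠ k) (ρ : ℝ) (hρ : 0 ≤ ρ) :
    ∃ C : ℝ, 0 ≤ C ∧ ∀ w : ℂ, ‖w‖ ≤ ρ → ∀ k : ℕ,
      ‖RG (α + w - k) * RG (β - w - k)‖ ≤ C * ‖RG (α - k) * RG (β - k)‖ := by
  obtain ⟨T, hT, hsum⟩ := sum_inv_AB hα hβ
  set κ := ρ * (‖β - α‖ + ρ) with hκ
  have hκ0 : 0 ≤ κ := by positivity
  have hcont : Continuous (fun w : ℂ => RG (α + w) * RG (β - w)) :=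
    (RG_cont.comp (by fun_prop)).mul (RG_cont.comp (by fun_prop))
  obtain ⟨B, hB⟩ := (isCompact_closedBall (0:ℂ) ρ).exists_bound_of_continuousOn hcont.continuousOn
  have hR : 0 < ‖RG α * RG β‖ := norm_pos_iff.2 (mul_ne_zero (RG_ne hα) (RG_ne hβ))
  have hB0 : 0 ≤ B := (norm_nonneg _).trans (hB 0 (by simp [hρ]))
  refine ⟨Real.exp (κ * T) * B / ‖RG α * RG β‖, by positivity, fun w hw k => ?_⟩
  have hBw := hB w (by simpa using hw)
  rw [RG_prod, RG_prod (β - w), RG_prod α, RG_prod β]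
  have e1 : (∏ j ∈ range k, (α + w - 1 - j)) * RG (α + w) * ((∏ j ∈ range k, (β - w - 1 - j)) * RG (β - w))
      = (∏ j ∈ range k, ((α + w - 1 - j) * (β - w - 1 - j))) * (RG (α + w) * RG (β - w)) := by
    rw [Finset.prod_mul_distrib]; ring
  have e2 : (∏ j ∈ range k, (α - 1 - (j:ℂ))) * RG α * ((∏ j ∈ range k, (β - 1 - (j:ℂ))) * RG β)
      = (∏ j ∈ range k, ((α - 1 - (j:ℂ)) * (β - 1 - j))) * (RG α * RG β) := by
    rw [Finset.prod_mul_distrib]; ring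
  rw [e1, e2, norm_mul, norm_mul (∏ j ∈ range k, ((α - 1 - (j:ℂ)) * (β - 1 - j)))]
  have hmain : ‖∏ j ∈ range k, ((α + w - 1 - j) * (β - w - 1 - j))‖ ≤
      Real.exp (κ * T) * ‖∏ j ∈ range k, ((α - 1 - (j:ℂ)) * (β - 1 - j))‖ := by
    rw [norm_prod, norm_prod]
    have h1 : ∀ j ∈ range k, ‖(α + w - 1 - j) * (β - w - 1 - j)‖ ≤
        Real.exp (κ * ‖(α - 1 - (j:ℂ)) * (β - 1 - j)‖⁻¹) * ‖(α - 1 - (j:ℂ)) * (β - 1 - j)‖ := by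
      intro j _
      set X := (α - 1 - (j:ℂ)) * (β - 1 - j) with hX
      have hX0 : X ≠ 0 := by
        refine mul_ne_zero ?_ ?_
        · intro h; apply hα (1 + j); push_cast; linear_combination h
        · intro h; apply hβ (1 + j); push_cast; linear_combination h
      have hXp : 0 < ‖X‖ := norm_pos_iff.2 hX0
      have e : (α + w - 1 - j) * (β - w - 1 - j) = X + w * ((β - α) - w) := by rw [hX]; ring
      rw [e]
      have h2 : ‖w * ((β - α) - w)‖ ≤ κ := by
        rw [norm_mul, hκ]
        refine mul_le_mul hw ((norm_sub_le _ _).trans (by linarith)) (norm_nonneg _) hρ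
      calc ‖X + w * ((β - α) - w)‖ ≤ ‖X‖ + κ := (norm_add_le _ _).trans (by linarith)
        _ = (κ * ‖X‖⁻¹ + 1) * ‖X‖ := by field_simp; ring
        _ ≤ _ := by gcongr; exact Real.add_one_le_exp _
    refine (Finset.prod_le_prod (fun j _ => norm_nonneg _) h1).trans ?_
    rw [Finset.prod_mul_distrib, ← Real.exp_sum, ← Finset.mul_sum]
    gcongr
    exact hsum k
  calc _ ≤ (Real.exp (κ * T) * ‖∏ j ∈ range k, ((α - 1 - (j:ℂ)) * (β - 1 - j))‖) * B := by gcongr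
    _ = _ := by field_simp

lemma transfer {α β : ℂ} (hα : ∀ k : ℤ, α ≠ k) (hβ : ∀ k : ℤ, β ≠ k) (φ : ℕ → ℂ)
    (hs : Summable (fun k => ‖tr φ α β k‖)) :
    (∀ w : ℂ, Summable (fun k => ‖tr φ (α + w) (β - w) k‖)) ∧
      Continuous (fun w : ℂ => ∑' k, tr φ (α + w) (β - w) k) := by
  have hb : ∀ ρ : ℝ, 0 ≤ ρ → ∃ C : ℝ, 0 ≤ C ∧ ∀ w : ℂ, ‖w‖ ≤ ρ → ∀ k : ℕ,
      ‖tr φ (α + w) (β - w) k‖ ≤ C * ‖tr φ α β k‖ := by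
    intro ρ hρ
    obtain ⟨C, hC, h⟩ := RGRG_bound hα hβ ρ hρ
    refine ⟨C, hC, fun w hw k => ?_⟩
    unfold tr
    rw [norm_mul, norm_mul (φ k)]
    have := mul_le_mul_of_nonneg_left (h w hw k) (norm_nonneg (φ k))
    linarith
  constructor
  · intro w
    obtain ⟨C, hC, h⟩ := hb ‖w‖ (norm_nonneg _)
    exact Summable.of_nonneg_of_le (fun k => norm_nonneg _) (h w le_rfl) (hs.mul_left C)
  · rw [continuous_iff_continuousAt]
    intro w
    obtain ⟨C, hC, h⟩ := hb (‖w‖ + 1) (by positivity)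
    have hco : ContinuousOn (fun w : ℂ => ∑' k, tr φ (α + w) (β - w) k) (Metric.closedBall 0 (‖w‖ + 1)) := by
      refine continuousOn_tsum (u := fun k => C * ‖tr φ α β k‖) (fun k => ?_) (hs.mul_left C) ?_
      · apply Continuous.continuousOn
        unfold tr
        refine continuous_const.mul ((RG_cont.comp (by fun_prop)).mul (RG_cont.comp (by fun_prop)))
      · intro k x hx
        exact h x (by simpa using hx) k
    refine hco.continuousAt (Filter.mem_of_superset (Metric.ball_mem_nhds w one_pos) ?_)
    intro x hx
    rw [mem_closedBall_zero_iff]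
    rw [mem_ball_iff_norm] at hx
    have : x = w + (x - w) := by ring
    rw [this]
    refine (norm_add_le _ _).trans (by linarith)

lemma partial_sum (φ S : ℕ → ℂ) (q s d L α β : ℂ)
    (hrec : ∀ k : ℕ, (q + k ^ 2 - s * k + d * k) * φ k = (if k = 0 then 0 else φ (k - 1)) + S k)
    (hab : α + β = 2 - d + s + L) (M : ℕ) :
    ∑ k ∈ range (M + 1), (q - (α - 1) * (β - 1) + L * k) * tr φ α β k =
      ∑ k ∈ range (M + 1), tr S α β k - φ M * (RG (α - 1 - M) * RG (β - 1 - M)) := by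
  induction M with
  | zero =>
    have := hrec 0
    simp only [zero_add, Finset.sum_range_one, tr]
    rw [RG_pred, RG_pred]
    simp only [if_true, Nat.cast_zero] at this ⊢
    linear_combination (RG (α - 0) * RG (β - 0)) * this
  | succ M ih =>
    rw [Finset.sum_range_succ, ih, Finset.sum_range_succ _ (M + 1)]
    have := hrec (M + 1)
    rw [if_neg (by omega), Nat.add_sub_cancel] at this
    have eα : α - 1 - (M:ℂ) = α - ((M + 1 : ℕ) : ℂ) := by push_cast; ring
    have eβ : β - 1 - (M:ℂ) = β - ((M + 1 : ℕ) : ℂ) := by push_cast; ring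
    rw [eα, eβ, RG_pred α, RG_pred β]
    unfold tr
    linear_combination (RG (α - ((M + 1 : ℕ) : ℂ)) * RG (β - ((M + 1 : ℕ) : ℂ))) * this
      - (RG (α - ((M + 1 : ℕ) : ℂ)) * RG (β - ((M + 1 : ℕ) : ℂ))) * φ (M+1) * ((M + 1 : ℕ) : ℂ) * hab

open Filter Topology in
lemma lim_zero_of_summable {f : ℕ → ℂ} (hf : Summable (fun k => ‖f k‖)) (c b : ℂ)
    (h : Tendsto (fun M : ℕ => f M * (c - M)) atTop (𝓝 b)) : b = 0 := by
  by_contra hb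
  have hb' : 0 < ‖b‖ := norm_pos_iff.2 hb
  have h1 := h.norm
  have h2 : ∀ᶠ M : ℕ in atTop, ‖b‖ / 2 < ‖f M * (c - M)‖ :=
    h1.eventually (lt_mem_nhds (by linarith))
  have h3 : ∀ᶠ M : ℕ in atTop, ‖c‖ < M := by
    obtain ⟨m, hm⟩ := exists_nat_gt ‖c‖
    filter_upwards [eventually_ge_atTop m] with M hM
    exact hm.trans_le (by exact_mod_cast hM)
  have h4 : ∀ᶠ M : ℕ in atTop, ‖(1 / (M:ℝ))‖ ≤ (4 / ‖b‖) * ‖f M‖ := by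
    filter_upwards [h2, h3] with M h2 h3
    have hM : (0:ℝ) < M := (norm_nonneg c).trans_lt h3
    rw [norm_mul] at h2
    have h5 : ‖c - M‖ ≤ 2 * M := by
      refine (norm_sub_le _ _).trans ?_
      rw [Complex.norm_natCast]; linarith
    have h6 : ‖b‖ / 2 ≤ ‖f M‖ * (2 * M) := h2.le.trans (by gcongr)
    rw [Real.norm_of_nonneg (by positivity), div_le_iff₀ hM, div_mul_eq_mul_div, div_mul_eq_mul_div, le_div_iff₀ hb']
    linarith
  have := Summable.of_norm_bounded_eventually_nat (hf.mul_left (4 / ‖b‖)) h4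
  exact Real.not_summable_one_div_natCast this

open Filter Topology in
lemma bd_lim (φ S : ℕ → ℂ) (q s d α β : ℂ)
    (hrec : ∀ k : ℕ, (q + k ^ 2 - s * k + d * k) * φ k = (if k = 0 then 0 else φ (k - 1)) + S k)
    (hab : α + β = 2 - d + s) (h1 : Summable (fun k => ‖tr φ α β k‖))
    (h2 : Summable (fun k => ‖tr S α β k‖)) :
    Tendsto (fun M : ℕ => φ M * (RG (α - 1 - M) * RG (β - 1 - M))) atTop
      (𝓝 (∑' k, tr S α β k - (q - (α - 1) * (β - 1)) * ∑' k, tr φ α β k)) := by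
  have hp := partial_sum φ S q s d 0 α β hrec (by rw [hab, add_zero])
  have t1 := (h1.of_norm.hasSum.tendsto_sum_nat).comp (tendsto_add_atTop_nat 1)
  have t2 := (h2.of_norm.hasSum.tendsto_sum_nat).comp (tendsto_add_atTop_nat 1)
  refine (t2.sub (t1.const_mul (q - (α - 1) * (β - 1)))).congr ?_
  intro M
  have := hp M
  simp only [zero_mul, add_zero] at this
  rw [← Finset.mul_sum] at this
  simp only [Function.comp]
  linear_combination -this

open Filter Topology in
lemma step_id (φ S : ℕ → ℂ) (q s d L α β : ℂ)
    (hrec : ∀ k : ℕ, (q + k ^ 2 - s * k + d * k) * φ k = (if k = 0 then 0 else φ (k - 1)) + S k)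
    (hab : α + β = 2 - d + s + L) (h1 : Summable (fun k => ‖tr φ α β k‖))
    (h2 : Summable (fun k => ‖tr S α β k‖)) (h3 : Summable (fun k => ‖tr φ (α - 1) β k‖)) :
    (q - (α - 1) * (β - 1) + L * (α - 1)) * ∑' k, tr φ α β k =
      L * ∑' k, tr φ (α - 1) β k + ∑' k, tr S α β k := by
  have hp := partial_sum φ S q s d L α β hrec hab
  have t1 := (h1.of_norm.hasSum.tendsto_sum_nat).comp (tendsto_add_atTop_nat 1)
  have t2 := (h2.of_norm.hasSum.tendsto_sum_nat).comp (tendsto_add_atTop_nat 1)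
  have t3 := (h3.of_norm.hasSum.tendsto_sum_nat).comp (tendsto_add_atTop_nat 1)
  have := (t2.sub (t1.const_mul (q - (α - 1) * (β - 1) + L * (α - 1)))).add (t3.const_mul L)
  have h0 := lim_zero_of_summable h3 (β - 1) _ (this.congr (fun M => by
    have h4 := hp M
    have h5 : ∀ k ∈ range (M + 1), (q - (α - 1) * (β - 1) + L * k) * tr φ α β k =
        (q - (α - 1) * (β - 1) + L * (α - 1)) * tr φ α β k - L * tr φ (α - 1) β k := by
      intro k _
      unfold tr
      rw [RG_pred]; ring
    rw [Finset.sum_congr rfl h5, Finset.sum_sub_distrib, ← Finset.mul_sum, ← Finset.mul_sum] at h4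
    simp only [Function.comp]
    have h6 : φ M * (RG (α - 1 - M) * RG (β - 1 - M)) = tr φ (α - 1) β M * (β - 1 - M) := by
      unfold tr
      rw [RG_pred β]; ring
    rw [← h6]
    linear_combination -h4))
  linear_combination -h0

lemma tr_symm (φ : ℕ → ℂ) (α β : ℂ) : tr φ α β = tr φ β α := by
  funext k; unfold tr; ring

lemma step_id' (φ S : ℕ → ℂ) (q s d L α β : ℂ)
    (hrec : ∀ k : ℕ, (q + k ^ 2 - s * k + d * k) * φ k = (if k = 0 then 0 else φ (k - 1)) + S k)
    (hab : α + β = 2 - d + s + L) (h1 : Summable (fun k => ‖tr φ α β k‖))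
    (h2 : Summable (fun k => ‖tr S α β k‖)) (h3 : Summable (fun k => ‖tr φ α (β - 1) k‖)) :
    (q - (α - 1) * (β - 1) + L * (β - 1)) * ∑' k, tr φ α β k =
      L * ∑' k, tr φ α (β - 1) k + ∑' k, tr S α β k := by
  rw [tr_symm φ α β] at h1 ⊢
  rw [tr_symm S α β] at h2 ⊢
  rw [tr_symm φ α (β - 1)] at h3 ⊢
  have := step_id φ S q s d L β α hrec (by linear_combination hab) h1 h2 h3
  linear_combination this

def kp (α β : ℂ) : ℂ := RG α * RG (1 - α) * (RG β * RG (1 - β))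

lemma EX (α β : ℂ) (hα : ∀ k : ℤ, α ≠ k) (hβ : ∀ k : ℤ, β ≠ k) (M : ℕ) (hM : M ≠ 0) :
    RG (α - 1 - M) * RG (β - 1 - M) * (Complex.GammaSeq (1 - α) M * Complex.GammaSeq (1 - β) M) =
      RG α * RG β * ((M:ℂ) ^ (2 - α - β) * (M.factorial : ℂ) ^ 2) := by
  have h : ∀ γ : ℂ, (∀ k : ℤ, γ ≠ k) → RG (γ - 1 - M) * Complex.GammaSeq (1 - γ) M =
      (-1) ^ (M + 1) * RG γ * ((M:ℂ) ^ (1 - γ) * M.factorial) := by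
    intro γ hγ
    have e : γ - 1 - M = γ - ((M + 1 : ℕ) : ℂ) := by push_cast; ring
    rw [e, RG_prod, Complex.GammaSeq]
    have e2 : ∏ j ∈ range (M + 1), (γ - 1 - (j:ℂ)) =
        (-1) ^ (M + 1) * ∏ j ∈ range (M + 1), (1 - γ + (j:ℂ)) := by
      rw [← Finset.card_range (M + 1), ← Finset.prod_const, Finset.card_range, ← Finset.prod_mul_distrib]
      exact Finset.prod_congr rfl fun j _ => by ring
    have e3 : ∏ j ∈ range (M + 1), (1 - γ + (j:ℂ)) ≠ 0 := by
      rw [Finset.prod_ne_zero_iff]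
      intro j _ h0
      apply hγ (1 + j); push_cast; linear_combination -h0
    rw [e2]
    field_simp
  have h1 := h α hα
  have h2 := h β hβ
  have e : (M:ℂ) ^ (2 - α - β) = (M:ℂ) ^ (1 - α) * (M:ℂ) ^ (1 - β) := by
    rw [← Complex.cpow_add _ _ (by exact_mod_cast hM)]; congr 1; ring
  have hs : ((-1:ℂ) ^ (M + 1)) * (-1) ^ (M + 1) = 1 := by rw [← mul_pow]; norm_num
  calc _ = (RG (α - 1 - M) * Complex.GammaSeq (1 - α) M) * (RG (β - 1 - M) * Complex.GammaSeq (1 - β) M) := by ring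
    _ = (((-1:ℂ) ^ (M + 1)) * (-1) ^ (M + 1)) * (RG α * RG β * (((M:ℂ) ^ (1 - α) * (M:ℂ) ^ (1 - β)) * (M.factorial : ℂ) ^ 2)) := by
        rw [h1, h2]; ring
    _ = _ := by rw [hs, e, one_mul]

lemma nonint_one_sub {α : ℂ} (hα : ∀ k : ℤ, α ≠ k) : ∀ k : ℤ, 1 - α ≠ k := by
  intro k h; apply hα (1 - k); push_cast; linear_combination -h

lemma Gamma_RG {z : ℂ} (hz : ∀ k : ℤ, z ≠ k) : Complex.Gamma z * RG z = 1 := by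
  have := RG_ne hz
  unfold RG at *
  exact mul_inv_cancel₀ (fun h0 => this (by rw [h0, inv_zero]))

open Filter Topology in
lemma ratio_lim (φ : ℕ → ℂ) {α β α0 β0 b b0 : ℂ} (hα : ∀ k : ℤ, α ≠ k) (hβ : ∀ k : ℤ, β ≠ k)
    (hα0 : ∀ k : ℤ, α0 ≠ k) (hβ0 : ∀ k : ℤ, β0 ≠ k) (hab : α + β = α0 + β0)
    (h : Tendsto (fun M : ℕ => φ M * (RG (α - 1 - M) * RG (β - 1 - M))) atTop (𝓝 b))
    (h0 : Tendsto (fun M : ℕ => φ M * (RG (α0 - 1 - M) * RG (β0 - 1 - M))) atTop (𝓝 b0)) :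
    b * kp α0 β0 = b0 * kp α β := by
  have t1 := ((h.mul ((Complex.GammaSeq_tendsto_Gamma (1 - α)).mul
    (Complex.GammaSeq_tendsto_Gamma (1 - β)))).mul_const (RG α0 * RG β0))
  have t2 := ((h0.mul ((Complex.GammaSeq_tendsto_Gamma (1 - α0)).mul
    (Complex.GammaSeq_tendsto_Gamma (1 - β0)))).mul_const (RG α * RG β))
  have e := tendsto_nhds_unique_of_eventuallyEq t1 t2 (by
    filter_upwards [eventually_ne_atTop 0] with M hM
    have e1 := EX α β hα hβ M hM
    have e2 := EX α0 β0 hα0 hβ0 M hM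
    have e3 : 2 - α0 - β0 = 2 - α - β := by linear_combination hab
    rw [e3] at e2
    linear_combination φ M * RG α0 * RG β0 * e1 - φ M * RG α * RG β * e2)
  have g1 := Gamma_RG (nonint_one_sub hα)
  have g2 := Gamma_RG (nonint_one_sub hβ)
  have g3 := Gamma_RG (nonint_one_sub hα0)
  have g4 := Gamma_RG (nonint_one_sub hβ0)
  unfold kp
  have e5 : b * (RG α0 * RG (1 - α0) * (RG β0 * RG (1 - β0))) =
    (b * (Complex.Gamma (1 - α) * Complex.Gamma (1 - β)) * (RG α0 * RG β0)) *
      (RG (1 - α) * RG (1 - β) * RG (1 - α0) * RG (1 - β0)) := by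
    calc _ = b * (RG α0 * RG (1 - α0) * (RG β0 * RG (1 - β0))) * (Complex.Gamma (1 - α) * RG (1 - α)) * (Complex.Gamma (1 - β) * RG (1 - β)) := by rw [g1, g2]; ring
      _ = _ := by ring
  rw [e5, e]
  calc _ = b0 * (RG α * RG (1 - α) * (RG β * RG (1 - β))) * (Complex.Gamma (1 - α0) * RG (1 - α0)) * (Complex.Gamma (1 - β0) * RG (1 - β0)) := by ring
    _ = _ := by rw [g3, g4]; ring

lemma kp_ne {α β : ℂ} (hα : ∀ k : ℤ, α ≠ k) (hβ : ∀ k : ℤ, β ≠ k) : kp α β ≠ 0 :=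
  mul_ne_zero (mul_ne_zero (RG_ne hα) (RG_ne (nonint_one_sub hα)))
    (mul_ne_zero (RG_ne hβ) (RG_ne (nonint_one_sub hβ)))

lemma RGRG_sin (z : ℂ) : RG z * RG (1 - z) = Complex.sin (Real.pi * z) / Real.pi := by
  unfold RG
  rw [← mul_inv, Complex.Gamma_mul_Gamma_one_sub, inv_div]

lemma kp_swap (α β α' β' : ℂ) (m : ℤ) (h1 : α' + β = m) (h2 : α + β' = m) :
    kp α β = kp α' β' := by
  unfold kp
  simp only [RGRG_sin]
  have e1 : α' = -β + m := by linear_combination h1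
  have e2 : β' = -α + m := by linear_combination h2
  have e3 : ∀ z : ℂ, Complex.sin (Real.pi * (-z + m)) = -(((m.negOnePow : ℤ) : ℂ) * Complex.sin (Real.pi * z)) := by
    intro z
    have : (Real.pi : ℂ) * (-z + m) = -(Real.pi * z) + m * Real.pi := by ring
    rw [this, Complex.sin_antiperiodic.add_int_mul_eq, Complex.sin_neg]; ring
  rw [e1, e2, e3, e3]
  have hs : ((m.negOnePow : ℤ) : ℂ) * ((m.negOnePow : ℤ) : ℂ) = 1 := by
    rw [← Int.cast_mul, ← Units.val_mul, Int.units_mul_self]; simp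
  calc _ = (((m.negOnePow : ℤ) : ℂ) * ((m.negOnePow : ℤ) : ℂ)) * (Complex.sin (Real.pi * α) / Real.pi * (Complex.sin (Real.pi * β) / Real.pi)) := by rw [hs, one_mul]
    _ = _ := by ring

open Filter Topology in
lemma base_lim (φ : ℕ → ℂ) (d : ℂ) (hd : ∀ k : ℤ, d ≠ k)
    (h0 : φ 0 = 1) (hrec : ∀ k : ℕ, k ≠ 0 → ((k:ℂ) ^ 2 + d * k) * φ k = φ (k - 1))
    {α β b : ℂ} (hα : ∀ k : ℤ, α ≠ k) (hβ : ∀ k : ℤ, β ≠ k) (hab : α + β = 2 - d)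
    (h : Tendsto (fun M : ℕ => φ M * (RG (α - 1 - M) * RG (β - 1 - M))) atTop (𝓝 b)) :
    b = d * Complex.Gamma d * kp α β := by
  have hφ : ∀ M : ℕ, φ M * (M.factorial * ∏ j ∈ range (M + 1), (d + j)) = d := by
    intro M
    induction M with
    | zero => simp [h0]
    | succ M ih =>
      have := hrec (M + 1) (by omega)
      rw [Nat.add_sub_cancel] at this
      rw [Finset.prod_range_succ, Nat.factorial_succ]
      rw [← this] at ih
      push_cast at ih ⊢
      linear_combination ih
  have t1 := h.mul ((Complex.GammaSeq_tendsto_Gamma (1 - α)).mul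
    (Complex.GammaSeq_tendsto_Gamma (1 - β)))
  have t2 := ((Complex.GammaSeq_tendsto_Gamma d).const_mul (RG α * RG β * d))
  have e := tendsto_nhds_unique_of_eventuallyEq t1 t2 (by
    filter_upwards [eventually_ne_atTop 0] with M hM
    have e1 := EX α β hα hβ M hM
    have e3 : 2 - α - β = d := by linear_combination -hab
    rw [e3] at e1
    have hp : ∏ j ∈ range (M + 1), (d + (j:ℂ)) ≠ 0 := by
      rw [Finset.prod_ne_zero_iff]
      intro j _ h0
      apply hd (-j); push_cast; linear_combination h0
    rw [mul_assoc, e1, Complex.GammaSeq]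
    have := hφ M
    field_simp
    linear_combination (RG α * RG β * (M:ℂ) ^ d * (M.factorial:ℂ)) * this)
  have g1 := Gamma_RG (nonint_one_sub hα)
  have g2 := Gamma_RG (nonint_one_sub hβ)
  unfold kp
  calc b = b * (Complex.Gamma (1 - α) * RG (1 - α)) * (Complex.Gamma (1 - β) * RG (1 - β)) := by rw [g1, g2]; ring
    _ = (b * (Complex.Gamma (1 - α) * Complex.Gamma (1 - β))) * (RG (1 - α) * RG (1 - β)) := by ring
    _ = _ := by rw [e]; ring

lemma quad_countable (b c : ℂ) : {u : ℂ | u ^ 2 + b * u + c = 0}.Countable := by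
  by_cases h : ∃ r : ℂ, r ^ 2 + b * r + c = 0
  · obtain ⟨r, hr⟩ := h
    refine Set.Countable.mono (s₂ := {r, -b - r}) ?_ ((Set.finite_singleton _).insert _).countable
    intro u hu
    have hu' : u ^ 2 + b * u + c = 0 := hu
    have : (u - r) * (u - (-b - r)) = 0 := by linear_combination hu' - hr
    rcases mul_eq_zero.1 this with h | h
    · left; linear_combination h
    · right; show u = _; linear_combination h
  · push Not at h
    have : {u : ℂ | u ^ 2 + b * u + c = 0} = ∅ := by
      ext u; simp [h u]
    rw [this]; exact Set.countable_empty

lemma eq_zero_of_countable {J : ℂ → ℂ} (hJ : Continuous J) {S : Set ℂ} (hS : S.Countable)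
    (h : ∀ u, u ∉ S → J u = 0) (u : ℂ) : J u = 0 := by
  have hd : Dense Sᶜ := hS.dense_compl ℝ
  have := Continuous.ext_on hd hJ continuous_const (g := fun _ => 0) (fun x hx => h x hx)
  exact congrFun this u

lemma int_countable (c : ℂ) : {u : ℂ | ∃ k : ℤ, c - u = k}.Countable := by
  have : {u : ℂ | ∃ k : ℤ, c - u = k} ⊆ Set.range (fun k : ℤ => c - k) := by
    rintro u ⟨k, hk⟩
    exact ⟨k, by simp only; rw [← hk]; ring⟩
  exact (Set.countable_range _).mono this

lemma quad_root (b c : ℂ) : ∃ z : ℂ, z ^ 2 + b * z + c = 0 := by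
  obtain ⟨s, hs⟩ := IsAlgClosed.exists_pow_nat_eq (b ^ 2 / 4 - c) (n := 2) (by norm_num)
  exact ⟨s - b / 2, by linear_combination hs⟩

structure Br (N : ℕ) (P : Finset ℕ) (p : ℕ) (v : ℂ) (ν : ℕ → ℂ) : Prop where
  hP : P ⊆ Icc 1 N
  hp : Pt P p
  hpN : p + 1 ≤ N
  hz : ∀ i ∈ Icc 1 N, ∀ k : ℤ, ν i - v ≠ k
  hq : ∀ K : ℕ → ℕ, (∀ i, i ∉ Icc 1 N → K i = 0) → 0 < ∑ i ∈ Icc 1 N, K i → qB N K ν ≠ 0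
  hd : ∀ k : ℤ, ν p - ν (p + 1) ≠ k

def ph (N : ℕ) (ν : ℕ → ℂ) (p : ℕ) (K : ℕ → ℕ) (k : ℕ) : ℂ := cB N ν (Function.update K p k)

lemma upd_supp {N p : ℕ} {K : ℕ → ℕ} (h1 : 1 ≤ p) (h2 : p + 1 ≤ N)
    (hs : ∀ i, i ∉ Icc 1 N → K i = 0) (k : ℕ) :
    ∀ i, i ∉ Icc 1 N → Function.update K p k i = 0 := by
  intro i hi
  have : i ≠ p := by rintro rfl; apply hi; rw [mem_Icc]; omega
  rw [Function.update_of_ne this]; exact hs i hi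

lemma sum_two {N p : ℕ} (h1 : 1 ≤ p) (h2 : p + 1 ≤ N) (f g : ℕ → ℂ)
    (h : ∀ i, i ≠ p → i ≠ p + 1 → f i = g i) :
    ∑ i ∈ Icc 1 N, f i = ∑ i ∈ Icc 1 N, g i + (f p - g p) + (f (p + 1) - g (p + 1)) := by
  have e : ∑ i ∈ Icc 1 N, (f i - g i) = ∑ i ∈ ({p, p + 1} : Finset ℕ), (f i - g i) := by
    symm
    apply Finset.sum_subset
    · intro i hi
      rw [mem_insert, mem_singleton] at hi
      rw [mem_Icc]; omega
    · intro i _ hi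
      rw [mem_insert, mem_singleton, not_or] at hi
      rw [h i hi.1 hi.2, sub_self]
  rw [Finset.sum_pair (by omega), Finset.sum_sub_distrib] at e
  linear_combination e

lemma qB_upd {N p : ℕ} {K : ℕ → ℕ} (h1 : 1 ≤ p) (h2 : p + 1 ≤ N)
    (hs : ∀ i, i ∉ Icc 1 N → K i = 0) (hKp : K p = 0) (ν : ℕ → ℂ) (k : ℕ) :
    qB N (Function.update K p k) ν = qB N K ν + (k:ℂ) ^ 2
      - ((K (p - 1) : ℂ) + K (p + 1)) * k + (ν p - ν (p + 1)) * k := by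
  have z0 := upd_supp h1 h2 hs k 0 (by simp)
  rw [qB_eq N (by omega) _ z0, qB_eq N (by omega) _ (hs 0 (by simp))]
  rw [sum_two h1 h2 _ (fun i => ((dl K i:ℂ)^2/2 + ν i*(dl K i:ℂ)))]
  · have e1 : p - 1 ≠ p := by omega
    have e2 : p + 1 ≠ p := by omega
    simp only [dl, Function.update_self, Function.update_of_ne e1, Function.update_of_ne e2, hKp,
      Nat.add_sub_cancel]
    push_cast
    ring
  · intro i hi hi'
    have : i - 1 ≠ p ∨ i - 1 = 0 ∧ i = 0 := by omega
    simp only [dl, Function.update_of_ne hi]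
    rcases this with h | h
    · rw [Function.update_of_ne h]
    · have : i - 1 ≠ p := by omega
      rw [Function.update_of_ne this]

lemma qB_swap {N p : ℕ} {K : ℕ → ℕ} (h1 : 1 ≤ p) (h2 : p + 1 ≤ N)
    (hs : ∀ i, i ∉ Icc 1 N → K i = 0) (hKp : K p = 0) (ν μ : ℕ → ℂ)
    (m1 : μ p = ν (p + 1)) (m2 : μ (p + 1) = ν p) (m3 : ∀ i, i ≠ p → i ≠ p + 1 → μ i = ν i) :
    qB N K μ = qB N K ν + (ν p - ν (p + 1)) * ((K (p - 1) : ℂ) + K (p + 1)) := by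
  have z0 := hs 0 (by simp)
  rw [qB_eq N (by omega) _ z0, qB_eq N (by omega) _ z0]
  rw [sum_two h1 h2 _ (fun i => ((dl K i:ℂ)^2/2 + ν i*(dl K i:ℂ)))]
  · simp only [dl, m1, m2, Nat.add_sub_cancel, hKp]
    push_cast
    ring
  · intro i hi hi'
    rw [m3 i hi hi']

def Sph (N : ℕ) (ν : ℕ → ℂ) (p : ℕ) (K : ℕ → ℕ) (k : ℕ) : ℂ :=
  ∑ j ∈ (Icc 1 N).erase p, wt N j * (if K j = 0 then 0 else ph N ν p (dec K j) k)

lemma ph_rec {N p : ℕ} {K : ℕ → ℕ} (h1 : 1 ≤ p) (h2 : p + 1 ≤ N)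
    (hs : ∀ i, i ∉ Icc 1 N → K i = 0) (hKp : K p = 0) (ν : ℕ → ℂ)
    (hq : ∀ K : ℕ → ℕ, (∀ i, i ∉ Icc 1 N → K i = 0) → 0 < ∑ i ∈ Icc 1 N, K i → qB N K ν ≠ 0)
    (k : ℕ) :
    (qB N K ν + (k:ℂ) ^ 2 - ((K (p - 1) : ℂ) + K (p + 1)) * k + (ν p - ν (p + 1)) * k)
      * ph N ν p K k = (if k = 0 then 0 else ph N ν p K (k - 1)) + Sph N ν p K k := by
  rw [← qB_upd h1 h2 hs hKp]
  have us := upd_supp h1 h2 hs k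
  have hpm : p ∈ Icc 1 N := by rw [mem_Icc]; omega
  by_cases hpos : 0 < ∑ i ∈ Icc 1 N, Function.update K p k i
  · unfold ph
    rw [cB_rec N (by omega) ν _ (hq _ us hpos) hpos, ← Finset.add_sum_erase _ _ hpm]
    congr 1
    · have : p ≠ N := by omega
      rw [wt, if_neg this, one_mul, Function.update_self]
      congr 2
      unfold dec
      rw [Function.update_self, Function.update_idem]
    · unfold Sph ph
      refine Finset.sum_congr rfl fun j hj => ?_
      have hj' : j ≠ p := (mem_erase.1 hj).1
      rw [Function.update_of_ne hj']
      unfold dec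
      rw [Function.update_of_ne hj', Function.update_comm hj']
  · have hz : ∀ i ∈ Icc 1 N, Function.update K p k i = 0 := by
      have : ∑ i ∈ Icc 1 N, Function.update K p k i = 0 := by omega
      exact Finset.sum_eq_zero_iff.1 this
    have hk : k = 0 := by simpa using hz p hpm
    have hall : Function.update K p k = fun _ => 0 := by
      funext i
      by_cases hi : i ∈ Icc 1 N
      · exact hz i hi
      · exact us i hi
    have hS : Sph N ν p K k = 0 := by
      unfold Sph
      refine Finset.sum_eq_zero fun j hj => ?_
      have hj' := mem_erase.1 hj
      have := hz j hj'.2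
      rw [Function.update_of_ne hj'.1] at this
      rw [if_pos this, mul_zero]
    rw [hS, if_pos hk, hall]
    simp [qB]

lemma Bf_pos {P : Finset ℕ} {ν : ℕ → ℂ} {v : ℂ} {i : ℕ} (h : ∀ k : ℤ, ν i - v ≠ k) (δ : ℤ) :
    0 < Bf P ν v i δ := by
  unfold Bf
  split_ifs
  · have : Complex.Gamma (ν i - v + 1 + δ) ≠ 0 := Complex.Gamma_ne_zero fun m hm => h (-m - 1 - δ) (by
      push_cast; linear_combination hm)
    positivity
  · have : Complex.Gamma (ν i - v + δ) ≠ 0 := Complex.Gamma_ne_zero fun m hm => h (-m - δ) (by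
      push_cast; linear_combination hm)
    positivity

lemma Sbase {N p : ℕ} {P : Finset ℕ} {v : ℂ} {ν : ℕ → ℂ} (H : Br N P p v ν) {K : ℕ → ℕ}
    (hs : ∀ i, i ∉ Icc 1 N → K i = 0) (hKp : K p = 0) (x y : ℕ) :
    Summable (fun k => ‖tr (ph N ν p K) (1 - ν p + v + ((K (p - 1) + x : ℕ) : ℂ))
      (1 + ν (p + 1) - v + ((K (p + 1) + y : ℕ) : ℂ)) k‖) := by
  have h1 := H.hp.1
  have h2 := H.hpN
  have hpm : p ∈ Icc 1 N := by rw [mem_Icc]; omega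
  have hpm' : p + 1 ∈ Icc 1 N := by rw [mem_Icc]; omega
  have hpm'' : p + 1 ∈ (Icc 1 N).erase p := by rw [mem_erase]; exact ⟨by omega, hpm'⟩
  obtain ⟨C, hC, hb⟩ := gB_bound N (by omega) P H.hP ν v H.hz H.hq 1 le_rfl
  obtain ⟨ε, hε, -, hε'⟩ := exists_dist (ν p - v) (H.hz p hpm)
  obtain ⟨η, hη, -, hη'⟩ := exists_dist (ν (p+1) - v) (H.hz _ hpm')
  have hεa : ∀ m : ℤ, ε ≤ ‖(-(ν p - v) + 1) + m‖ := by
    intro m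
    have := hε' (-1 - m)
    have e : (-(ν p - v) + 1) + (m:ℂ) = -(ν p - v + ((-1 - m : ℤ) : ℂ)) := by push_cast; ring
    rw [e, norm_neg]; exact this
  have hηa : ∀ m : ℤ, η ≤ ‖(ν (p+1) - v + 1) + m‖ := by
    intro m
    have := hη' (1 + m)
    have e : (ν (p+1) - v + 1) + (m:ℂ) = ν (p+1) - v + ((1 + m : ℤ) : ℂ) := by push_cast; ring
    rw [e]; exact this
  set c1 : ℝ := (ε⁻¹) ^ x * (‖Complex.sin (Real.pi * (ν p - v))‖ / Real.pi) with hc1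
  set c2 : ℝ := (η⁻¹) ^ y with hc2
  set D : ℝ := ∏ i ∈ ((Icc 1 N).erase p).erase (p+1), Bf P ν v i (dl K i) with hD
  have hDpos : 0 < D := Finset.prod_pos fun i hi =>
    Bf_pos (H.hz i (mem_of_mem_erase (mem_of_mem_erase hi))) _
  set E : ℝ := ∏ j ∈ (Icc 1 N).erase p, if Pt P j then uu (K j) * 2 ^ (min (K j) (kap N P K)) else ((1:ℝ)⁻¹) ^ (K j) with hE
  have hEpos : 0 ≤ E := Finset.prod_nonneg fun j _ => by
    have := uu_pos (K j)
    split_ifs <;> positivity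
  have hkap : ∀ k, kap N P (Function.update K p k) = kap N P K := by
    intro k
    unfold kap
    refine Finset.sum_congr rfl fun j _ => ?_
    by_cases hj : j = p
    · subst hj; rw [if_pos H.hp, if_pos H.hp]
    · rw [Function.update_of_ne hj]
  have hHm : ∀ k, Hm N P 1 (Function.update K p k) ≤ (2 ^ (kap N P K) * E) * uu k := by
    intro k
    unfold Hm
    rw [← Finset.mul_prod_erase _ _ hpm, if_pos H.hp, Function.update_self, hkap]
    have : ∏ j ∈ (Icc 1 N).erase p, (if Pt P j then uu (Function.update K p k j) * 2 ^ (min (Function.update K p k j) (kap N P K)) else ((1:ℝ)⁻¹) ^ (Function.update K p k j)) = E := by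
      refine Finset.prod_congr rfl fun j hj => ?_
      rw [Function.update_of_ne (mem_erase.1 hj).1]
    rw [this]
    have h3 : (2:ℝ) ^ (min k (kap N P K)) ≤ 2 ^ (kap N P K) :=
      pow_le_pow_right₀ (by norm_num) (min_le_right _ _)
    have := (uu_pos k).le
    calc _ ≤ uu k * 2 ^ (kap N P K) * E := by gcongr
      _ = _ := by ring
  have hgB : ∀ k, ‖ph N ν p K k‖ * (Bf P ν v p ((k:ℤ) - K (p-1)) * Bf P ν v (p+1) ((K (p+1) : ℤ) - k)) * D
      = gB N P ν v (Function.update K p k) := by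
    intro k
    unfold gB ph
    rw [← Finset.mul_prod_erase _ _ hpm, ← Finset.mul_prod_erase _ _ hpm'']
    have : ∏ i ∈ ((Icc 1 N).erase p).erase (p+1), Bf P ν v i (dl (Function.update K p k) i) = D := by
      refine Finset.prod_congr rfl fun j hj => ?_
      have a1 := (mem_erase.1 hj).1
      have a2 := (mem_erase.1 (mem_of_mem_erase hj)).1
      have a3 : j - 1 ≠ p := by omega
      rw [dl, dl, Function.update_of_ne a2, Function.update_of_ne a3]
    rw [this]
    have e1 : p - 1 ≠ p := by omega
    have e2 : p + 1 ≠ p := by omega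
    simp only [dl, Function.update_self, Function.update_of_ne e1, Function.update_of_ne e2, Nat.add_sub_cancel]
    ring
  refine Summable.of_nonneg_of_le (fun k => norm_nonneg _) (fun k => ?_)
    (uu_summable.mul_left (c1 * c2 * D⁻¹ * (C * (2 ^ (kap N P K) * E))))
  have b1 : ‖RG (1 - ν p + v + ((K (p - 1) + x : ℕ) : ℂ) - k)‖ ≤ c1 * Bf P ν v p ((k:ℤ) - K (p-1)) := by
    have := Gamma_shift hε hεa (-((k:ℤ) - K (p-1))) x
    have r := (Gamma_refl_norm (ν p - v) ((k:ℤ) - K (p-1))).resolve_right (sin_ne_of_nonint (H.hz p hpm))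
    rw [RG, norm_inv, Bf, if_neg H.hp.2.1]
    have e1 : 1 - ν p + v + ((K (p - 1) + x : ℕ) : ℂ) - k = -(ν p - v) + 1 + ((-((k:ℤ) - K (p-1)) : ℤ) : ℂ) + x := by
      push_cast; ring
    have e2 : -(ν p - v) + 1 - (((k:ℤ) - K (p-1) : ℤ) : ℂ) = -(ν p - v) + 1 + ((-((k:ℤ) - K (p-1)) : ℤ) : ℂ) := by
      push_cast; ring
    rw [e2] at r
    rw [e1]
    refine this.trans ?_
    rw [hc1, mul_assoc]
    gcongr
  have b2 : ‖RG (1 + ν (p + 1) - v + ((K (p + 1) + y : ℕ) : ℂ) - k)‖ ≤ c2 * Bf P ν v (p+1) ((K (p+1) : ℤ) - k) := by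
    have := Gamma_shift hη hηa ((K (p+1) : ℤ) - k) y
    rw [RG, norm_inv, Bf, if_pos H.hp.2.2]
    have e1 : 1 + ν (p + 1) - v + ((K (p + 1) + y : ℕ) : ℂ) - k = ν (p+1) - v + 1 + (((K (p+1) : ℤ) - k : ℤ) : ℂ) + y := by
      push_cast; ring
    rw [e1]; exact this
  have n1 := Bf_nonneg P ν v p ((k:ℤ) - K (p-1))
  have n2 := Bf_nonneg P ν v (p+1) ((K (p+1) : ℤ) - k)
  have hc1' : 0 ≤ c1 := by positivity
  have hc2' : 0 ≤ c2 := by positivity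
  calc ‖tr (ph N ν p K) (1 - ν p + v + ((K (p - 1) + x : ℕ) : ℂ)) (1 + ν (p + 1) - v + ((K (p + 1) + y : ℕ) : ℂ)) k‖
      ≤ ‖ph N ν p K k‖ * ((c1 * Bf P ν v p ((k:ℤ) - K (p-1))) * (c2 * Bf P ν v (p+1) ((K (p+1) : ℤ) - k))) := by
        rw [tr, norm_mul, norm_mul]
        gcongr
    _ = c1 * c2 * D⁻¹ * (‖ph N ν p K k‖ * (Bf P ν v p ((k:ℤ) - K (p-1)) * Bf P ν v (p+1) ((K (p+1) : ℤ) - k)) * D) := by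
        field_simp
    _ ≤ c1 * c2 * D⁻¹ * (C * ((2 ^ (kap N P K) * E) * uu k)) := by
        rw [hgB]
        gcongr
        exact (hb _ (upd_supp h1 h2 hs k)).trans (by gcongr; exact hHm k)
    _ = _ := by ring

def II (N : ℕ) (ν : ℕ → ℂ) (p : ℕ) (K : ℕ → ℕ) (l l' : ℕ) (u : ℂ) : ℂ :=
  ∑' k, tr (ph N ν p K) (1 - ν p + u + l) (1 + ν (p + 1) - u + l') k

lemma II_facts {N p : ℕ} {P : Finset ℕ} {v : ℂ} {ν : ℕ → ℂ} (H : Br N P p v ν) {K : ℕ → ℕ}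
    (hs : ∀ i, i ∉ Icc 1 N → K i = 0) (hKp : K p = 0) {l l' : ℕ} (hl : K (p - 1) ≤ l)
    (hl' : K (p + 1) ≤ l') :
    (∀ u : ℂ, Summable (fun k => ‖tr (ph N ν p K) (1 - ν p + u + l) (1 + ν (p + 1) - u + l') k‖)) ∧
      Continuous (II N ν p K l l') := by
  have h1 := H.hp.1
  have h2 := H.hpN
  have hpm : p ∈ Icc 1 N := by rw [mem_Icc]; omega
  have hpm' : p + 1 ∈ Icc 1 N := by rw [mem_Icc]; omega
  obtain ⟨x, rfl⟩ := Nat.exists_eq_add_of_le hl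
  obtain ⟨y, rfl⟩ := Nat.exists_eq_add_of_le hl'
  have := transfer (α := 1 - ν p + v + ((K (p - 1) + x : ℕ) : ℂ)) (β := 1 + ν (p + 1) - v + ((K (p + 1) + y : ℕ) : ℂ))
    (by
      intro k h
      apply H.hz p hpm (1 + (K (p-1) + x : ℕ) - k)
      push_cast at h ⊢
      linear_combination -h)
    (by
      intro k h
      apply H.hz (p+1) hpm' (k - 1 - (K (p+1) + y : ℕ))
      push_cast at h ⊢
      linear_combination h)
    (ph N ν p K) (Sbase H hs hKp x y)
  have e1 : ∀ u : ℂ, 1 - ν p + v + ((K (p - 1) + x : ℕ) : ℂ) + (u - v) = 1 - ν p + u + ((K (p - 1) + x : ℕ) : ℂ) := fun u => by ring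
  have e2 : ∀ u : ℂ, 1 + ν (p + 1) - v + ((K (p + 1) + y : ℕ) : ℂ) - (u - v) = 1 + ν (p + 1) - u + ((K (p + 1) + y : ℕ) : ℂ) := fun u => by ring
  constructor
  · intro u
    have h := this.1 (u - v)
    rw [e1, e2] at h
    exact h
  · have h := this.2.comp (f := fun u => u - v) (by fun_prop)
    refine h.congr fun u => ?_
    simp only [Function.comp, e1, e2]
    rfl

lemma trS {N p : ℕ} {P : Finset ℕ} {v : ℂ} {ν : ℕ → ℂ} (H : Br N P p v ν) {K : ℕ → ℕ}
    (hs : ∀ i, i ∉ Icc 1 N → K i = 0) (hKp : K p = 0) {l l' : ℕ} (hl : K (p - 1) ≤ l)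
    (hl' : K (p + 1) ≤ l') (u : ℂ) :
    Summable (fun k => ‖tr (Sph N ν p K) (1 - ν p + u + l) (1 + ν (p + 1) - u + l') k‖) ∧
    ∑' k, tr (Sph N ν p K) (1 - ν p + u + l) (1 + ν (p + 1) - u + l') k =
      ∑ j ∈ (Icc 1 N).erase p, wt N j * (if K j = 0 then 0 else II N ν p (dec K j) l l' u) := by
  have e : ∀ k, tr (Sph N ν p K) (1 - ν p + u + l) (1 + ν (p + 1) - u + l') k =
      ∑ j ∈ (Icc 1 N).erase p, wt N j * (if K j = 0 then 0 else
        tr (ph N ν p (dec K j)) (1 - ν p + u + l) (1 + ν (p + 1) - u + l') k) := by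
    intro k
    simp only [tr, Sph]
    rw [Finset.sum_mul]
    refine Finset.sum_congr rfl fun j _ => ?_
    split_ifs <;> ring
  have hsum : ∀ j ∈ (Icc 1 N).erase p, Summable (fun k => ‖wt N j * (if K j = 0 then 0 else
        tr (ph N ν p (dec K j)) (1 - ν p + u + l) (1 + ν (p + 1) - u + l') k)‖) := by
    intro j hj
    by_cases h0 : K j = 0
    · simp only [h0, if_true, mul_zero, norm_zero]; exact summable_zero
    · simp only [h0, if_false, norm_mul]
      have hj' := (mem_erase.1 hj).1
      exact ((II_facts H (dec_supp hs j) (by rw [dec_ne _ _ _ hj'.symm, hKp])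
        ((dec_le _ _ _).trans hl) ((dec_le _ _ _).trans hl')).1 u).mul_left _
  constructor
  · simp only [e]
    refine Summable.of_nonneg_of_le (fun k => norm_nonneg _) (fun k => norm_sum_le _ _) (summable_sum hsum)
  · simp only [e]
    rw [Summable.tsum_finsetSum (fun j hj => (hsum j hj).of_norm)]
    refine Finset.sum_congr rfl fun j hj => ?_
    rw [tsum_mul_left]
    split_ifs
    · rw [tsum_zero]
    · rfl

def RHS (N : ℕ) (ν : ℕ → ℂ) (p : ℕ) (K : ℕ → ℕ) (l l' : ℕ) (u : ℂ) : ℂ :=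
  ∑ j ∈ (Icc 1 N).erase p, wt N j * (if K j = 0 then 0 else II N ν p (dec K j) l l' u)

section branch
variable {N p : ℕ} {P : Finset ℕ} {v : ℂ} {ν : ℕ → ℂ} {K : ℕ → ℕ}

lemma br_a (H : Br N P p v ν) (hs : ∀ i, i ∉ Icc 1 N → K i = 0) (hKp : K p = 0) (x y : ℕ) (u : ℂ) :
    (qB N K ν - (u - ν p + K (p - 1) + x + 1) * (ν (p + 1) - u + K (p + 1) + y)
      + ((x:ℂ) + 1 + y) * (u - ν p + K (p - 1) + x + 1)) * II N ν p K (K (p - 1) + (x + 1)) (K (p + 1) + y) u =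
    ((x:ℂ) + 1 + y) * II N ν p K (K (p - 1) + x) (K (p + 1) + y) u
      + RHS N ν p K (K (p - 1) + (x + 1)) (K (p + 1) + y) u := by
  have h1 := H.hp.1
  have h2 := H.hpN
  obtain ⟨t1, t2⟩ := trS H hs hKp (l := K (p - 1) + (x + 1)) (l' := K (p + 1) + y) (by omega) (by omega) u
  have f1 := (II_facts H hs hKp (l := K (p - 1) + (x + 1)) (l' := K (p + 1) + y) (by omega) (by omega)).1 u
  have f2 := (II_facts H hs hKp (l := K (p - 1) + x) (l' := K (p + 1) + y) (by omega) (by omega)).1 u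
  have e : 1 - ν p + u + ((K (p - 1) + x : ℕ) : ℂ) = 1 - ν p + u + ((K (p - 1) + (x + 1) : ℕ) : ℂ) - 1 := by
    push_cast; ring
  rw [e] at f2
  have := step_id (ph N ν p K) (Sph N ν p K) (qB N K ν) ((K (p - 1) : ℂ) + K (p + 1)) (ν p - ν (p + 1))
    ((x:ℂ) + 1 + y) _ _ (ph_rec h1 h2 hs hKp ν H.hq) (by push_cast; ring) f1 t1 f2
  rw [t2, ← e] at this
  simp only [II, RHS] at this ⊢
  rw [← this]
  push_cast
  ring

lemma br_b (H : Br N P p v ν) (hs : ∀ i, i ∉ Icc 1 N → K i = 0) (hKp : K p = 0) (y : ℕ) (u : ℂ) :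
    (qB N K ν - (u - ν p + K (p - 1)) * (ν (p + 1) - u + K (p + 1) + y + 1)
      + ((y:ℂ) + 1) * (ν (p + 1) - u + K (p + 1) + y + 1)) * II N ν p K (K (p - 1)) (K (p + 1) + (y + 1)) u =
    ((y:ℂ) + 1) * II N ν p K (K (p - 1)) (K (p + 1) + y) u
      + RHS N ν p K (K (p - 1)) (K (p + 1) + (y + 1)) u := by
  have h1 := H.hp.1
  have h2 := H.hpN
  obtain ⟨t1, t2⟩ := trS H hs hKp (l := K (p - 1)) (l' := K (p + 1) + (y + 1)) (by omega) (by omega) u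
  have f1 := (II_facts H hs hKp (l := K (p - 1)) (l' := K (p + 1) + (y + 1)) (by omega) (by omega)).1 u
  have f2 := (II_facts H hs hKp (l := K (p - 1)) (l' := K (p + 1) + y) (by omega) (by omega)).1 u
  have e : 1 + ν (p + 1) - u + ((K (p + 1) + y : ℕ) : ℂ) = 1 + ν (p + 1) - u + ((K (p + 1) + (y + 1) : ℕ) : ℂ) - 1 := by
    push_cast; ring
  rw [e] at f2
  have := step_id' (ph N ν p K) (Sph N ν p K) (qB N K ν) ((K (p - 1) : ℂ) + K (p + 1)) (ν p - ν (p + 1))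
    ((y:ℂ) + 1) _ _ (ph_rec h1 h2 hs hKp ν H.hq) (by push_cast; ring) f1 t1 f2
  rw [t2, ← e] at this
  simp only [II, RHS] at this ⊢
  rw [← this]
  push_cast
  ring

open Filter Topology in
lemma br_c (H : Br N P p v ν) (hs : ∀ i, i ∉ Icc 1 N → K i = 0) (hKp : K p = 0) (u : ℂ) :
    Tendsto (fun M : ℕ => ph N ν p K M * (RG (1 - ν p + u + K (p - 1) - 1 - M) *
      RG (1 + ν (p + 1) - u + K (p + 1) - 1 - M))) atTop
      (𝓝 (RHS N ν p K (K (p - 1)) (K (p + 1)) u -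
        (qB N K ν - (u - ν p + K (p - 1)) * (ν (p + 1) - u + K (p + 1))) *
          II N ν p K (K (p - 1)) (K (p + 1)) u)) := by
  have h1 := H.hp.1
  have h2 := H.hpN
  obtain ⟨t1, t2⟩ := trS H hs hKp (l := K (p - 1)) (l' := K (p + 1)) (by omega) (by omega) u
  have f1 := (II_facts H hs hKp (l := K (p - 1)) (l' := K (p + 1)) (by omega) (by omega)).1 u
  have := bd_lim (ph N ν p K) (Sph N ν p K) (qB N K ν) ((K (p - 1) : ℂ) + K (p + 1)) (ν p - ν (p + 1))
     _ _ (ph_rec h1 h2 hs hKp ν H.hq) (by ring) f1 t1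
  rw [t2] at this
  convert this using 2
  simp only [II, RHS]
  ring

end branch

lemma main_ind {N p : ℕ} {P : Finset ℕ} {v : ℂ} {ν μ : ℕ → ℂ} (H : Br N P p v ν) (H' : Br N P p v μ)
    (m1 : μ p = ν (p + 1)) (m2 : μ (p + 1) = ν p) (m3 : ∀ i, i ≠ p → i ≠ p + 1 → μ i = ν i) :
    ∀ s : ℕ, ∀ K : ℕ → ℕ, (∀ i, i ∉ Icc 1 N → K i = 0) → K p = 0 → ∑ i ∈ Icc 1 N, K i = s →
      ∀ L x y : ℕ, x + y = L → ∀ u : ℂ,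
      Complex.Gamma (-(ν p - ν (p + 1))) * II N ν p K (K (p - 1) + x) (K (p + 1) + y) u +
      Complex.Gamma (ν p - ν (p + 1)) * II N μ p K (K (p - 1) + x) (K (p + 1) + y) u = 0 := by
  intro s
  induction s using Nat.strong_induction_on with
  | _ s IH =>
  intro K hs hKp hsum
  have h1 := H.hp.1
  have h2 := H.hpN
  have hpm : p ∈ Icc 1 N := by rw [mem_Icc]; omega
  have hpm' : p + 1 ∈ Icc 1 N := by rw [mem_Icc]; omega
  set d := ν p - ν (p + 1) with hdd
  have hd := H.hd
  rw [← hdd] at hd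
  have hq := qB_swap h1 h2 hs hKp ν μ m1 m2 m3
  -- the right hand sides cancel
  have hR : ∀ l l', K (p - 1) ≤ l → K (p + 1) ≤ l' → ∀ u,
      Complex.Gamma (-d) * RHS N ν p K l l' u + Complex.Gamma d * RHS N μ p K l l' u = 0 := by
    intro l l' hl hl' u
    unfold RHS
    rw [Finset.mul_sum, Finset.mul_sum, ← Finset.sum_add_distrib]
    refine Finset.sum_eq_zero fun j hj => ?_
    by_cases h0 : K j = 0
    · simp [h0]
    · have hj' := mem_erase.1 hj
      have b1 : dec K j (p - 1) ≤ l := (dec_le _ _ _).trans hl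
      have b2 : dec K j (p + 1) ≤ l' := (dec_le _ _ _).trans hl'
      have b3 := sum_dec N K j hj'.2 (by omega)
      have := IH (∑ i ∈ Icc 1 N, dec K j i) (by omega) (dec K j) (dec_supp hs j)
        (by rw [dec_ne _ _ _ hj'.1.symm, hKp]) rfl _ (l - dec K j (p - 1)) (l' - dec K j (p + 1)) rfl u
      rw [Nat.add_sub_cancel' b1, Nat.add_sub_cancel' b2] at this
      simp only [h0, if_false]
      linear_combination wt N j * this
  have hJc : ∀ x y : ℕ, Continuous (fun u =>
      Complex.Gamma (-d) * II N ν p K (K (p - 1) + x) (K (p + 1) + y) u +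
      Complex.Gamma d * II N μ p K (K (p - 1) + x) (K (p + 1) + y) u) := by
    intro x y
    exact (continuous_const.mul (II_facts H hs hKp (by omega) (by omega)).2).add
      (continuous_const.mul (II_facts H' hs hKp (by omega) (by omega)).2)
  intro L
  induction L with
  | zero =>
    intro x y hxy
    obtain ⟨rfl, rfl⟩ : x = 0 ∧ y = 0 := by omega
    simp only [add_zero]
    have hJ0 := hJc 0 0
    simp only [add_zero] at hJ0
    set l := K (p - 1) with hl
    set l' := K (p + 1) with hl'
    set q := qB N K ν with hqq
    set F : ℂ → ℂ := fun u => q - (u - ν p + l) * (ν (p + 1) - u + l') with hF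
    set J : ℂ → ℂ := fun u => Complex.Gamma (-d) * II N ν p K l l' u + Complex.Gamma d * II N μ p K l l' u with hJ
    set b1 : ℂ → ℂ := fun u => RHS N ν p K l l' u - F u * II N ν p K l l' u with hb1
    set b2 : ℂ → ℂ := fun u => RHS N μ p K l l' u - F u * II N μ p K l l' u with hb2
    have hB : ∀ u, Complex.Gamma (-d) * b1 u + Complex.Gamma d * b2 u = - F u * J u := by
      intro u
      have := hR l l' le_rfl le_rfl u
      simp only [hb1, hb2, hJ]
      linear_combination this
    have c1 : ∀ u, Filter.Tendsto (fun M : ℕ => ph N ν p K M * (RG (1 - ν p + u + l - 1 - M) *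
        RG (1 + ν (p + 1) - u + l' - 1 - M))) Filter.atTop (nhds (b1 u)) := fun u => br_c H hs hKp u
    have c2 : ∀ u, Filter.Tendsto (fun M : ℕ => ph N μ p K M * (RG (1 - ν (p + 1) + u + l - 1 - M) *
        RG (1 + ν p - u + l' - 1 - M))) Filter.atTop (nhds (b2 u)) := by
      intro u
      have := br_c H' hs hKp u
      rw [m1, m2] at this
      convert this using 2
      simp only [hb2, hF]
      rw [hq]
      rw [← hl, ← hl']
      ring
    have nA : ∀ u : ℂ, (∀ k : ℤ, ν p - u ≠ k) → ∀ k : ℤ, 1 - ν p + u + l ≠ k := by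
      intro u h k hk
      apply h (1 + l - k); push_cast; linear_combination -hk
    have nB : ∀ u : ℂ, (∀ k : ℤ, ν (p+1) - u ≠ k) → ∀ k : ℤ, 1 + ν (p + 1) - u + l' ≠ k := by
      intro u h k hk
      apply h (k - 1 - l'); push_cast; linear_combination hk
    have nA' : ∀ u : ℂ, (∀ k : ℤ, ν (p+1) - u ≠ k) → ∀ k : ℤ, 1 - ν (p+1) + u + l ≠ k := by
      intro u h k hk
      apply h (1 + l - k); push_cast; linear_combination -hk
    have nB' : ∀ u : ℂ, (∀ k : ℤ, ν p - u ≠ k) → ∀ k : ℤ, 1 + ν p - u + l' ≠ k := by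
      intro u h k hk
      apply h (k - 1 - l'); push_cast; linear_combination hk
    set kk : ℂ → ℂ := fun u => kp (1 - ν p + u + l) (1 + ν (p + 1) - u + l') with hkk
    have hkk' : ∀ u, kp (1 - ν (p+1) + u + l) (1 + ν p - u + l') = kk u := by
      intro u
      rw [hkk]
      symm
      apply kp_swap _ _ _ _ (2 + l + l') <;> push_cast <;> ring
    have g0 := H.hz p hpm
    have g1 := H.hz (p+1) hpm'
    have hkv : kk v ≠ 0 := kp_ne (nA v g0) (nB v g1)
    have ratio : ∀ u : ℂ, (∀ k : ℤ, ν p - u ≠ k) → (∀ k : ℤ, ν (p+1) - u ≠ k) →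
        (-F u * J u) * kk v = (-F v * J v) * kk u := by
      intro u hu hu'
      rw [← hB, ← hB]
      have r1 := ratio_lim _ (nA u hu) (nB u hu') (nA v g0) (nB v g1) (by ring) (c1 u) (c1 v)
      have r2 := ratio_lim _ (nA' u hu') (nB' u hu) (nA' v g1) (nB' v g0) (by ring) (c2 u) (c2 v)
      rw [hkk', hkk'] at r2
      change _ * kk v = _ * kk u at r1
      linear_combination Complex.Gamma (-d) * r1 + Complex.Gamma d * r2
    have hv0 : -F v * J v = 0 := by
      by_cases hK0 : ∑ i ∈ Icc 1 N, K i = 0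
      · have hKz : ∀ i, K i = 0 := by
          intro i
          by_cases hi : i ∈ Icc 1 N
          · exact Finset.sum_eq_zero_iff.1 hK0 i hi
          · exact hs i hi
        have hl0 : l = 0 := hKz _
        have hl0' : l' = 0 := hKz _
        have hqz : ∀ ν : ℕ → ℂ, qB N K ν = 0 := by intro ν; simp [qB, hKz]
        have hSz : ∀ (ν : ℕ → ℂ) k, Sph N ν p K k = 0 := by
          intro ν k; simp [Sph, hKz]
        have hph0 : ∀ ν : ℕ → ℂ, ph N ν p K 0 = 1 := by
          intro ν
          unfold ph
          apply cB_zero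
          refine Finset.sum_eq_zero fun i _ => ?_
          by_cases hi : i = p
          · subst hi; rw [Function.update_self]
          · rw [Function.update_of_ne hi, hKz]
        have rec1 : ∀ k : ℕ, k ≠ 0 → ((k:ℂ) ^ 2 + d * k) * ph N ν p K k = ph N ν p K (k - 1) := by
          intro k hk
          have := ph_rec h1 h2 hs hKp ν H.hq k
          rw [hqz, hSz, if_neg hk, hKz, hKz] at this
          push_cast at this
          linear_combination this
        have rec2 : ∀ k : ℕ, k ≠ 0 → ((k:ℂ) ^ 2 + (-d) * k) * ph N μ p K k = ph N μ p K (k - 1) := by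
          intro k hk
          have := ph_rec h1 h2 hs hKp μ H'.hq k
          rw [hqz, hSz, if_neg hk, hKz, hKz, m1, m2] at this
          push_cast at this
          rw [hdd]
          linear_combination this
        have e1 := base_lim _ d hd (hph0 ν) rec1 (nA v g0) (nB v g1) (by rw [hl0, hl0', hdd]; push_cast; ring) (c1 v)
        have e2 := base_lim _ (-d) (fun k h => hd (-k) (by push_cast; linear_combination -h)) (hph0 μ) rec2
          (nA' v g1) (nB' v g0) (by rw [hl0, hl0', hdd]; push_cast; ring) (c2 v)
        rw [hkk'] at e2
        change _ = _ * kk v at e1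
        rw [← hB, e1, e2]; ring
      · have hpos : ∀ k, 0 < ∑ i ∈ Icc 1 N, Function.update K p k i := by
          intro k
          refine lt_of_lt_of_le (Nat.pos_of_ne_zero hK0) (Finset.sum_le_sum fun i _ => ?_)
          by_cases hi : i = p
          · subst hi; rw [hKp]; exact Nat.zero_le _
          · rw [Function.update_of_ne hi]
        have q1 : ∀ k : ℕ, q + (k:ℂ) ^ 2 - ((l:ℂ) + l') * k + d * k ≠ 0 := by
          intro k
          have := H.hq _ (upd_supp h1 h2 hs k) (hpos k)
          rw [qB_upd h1 h2 hs hKp] at this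
          exact this
        have q2 : ∀ k : ℕ, q + d * ((l:ℂ) + l') + (k:ℂ) ^ 2 - ((l:ℂ) + l') * k - d * k ≠ 0 := by
          intro k h0
          have := H'.hq _ (upd_supp h1 h2 hs k) (hpos k)
          rw [qB_upd h1 h2 hs hKp, hq, m1, m2] at this
          apply this
          rw [← hl, ← hl', ← h0, hdd]; ring
        obtain ⟨z, hz⟩ := quad_root (d - ((l:ℂ) + l')) q
        have z1 : ∀ k : ℤ, z ≠ k := by
          intro m hm
          rw [hm] at hz
          rcases le_or_gt 0 m with h | h
          · obtain ⟨k, rfl⟩ := Int.eq_ofNat_of_zero_le h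
            apply q1 k; push_cast at hz; linear_combination hz
          · obtain ⟨k, hk⟩ := Int.eq_ofNat_of_zero_le (neg_nonneg.2 h.le)
            have hk' : (m:ℂ) = -(k:ℂ) := by
              have : m = -(k:ℤ) := by omega
              rw [this]; push_cast; ring
            rw [hk'] at hz
            apply q2 (l + l' + k); push_cast; linear_combination hz
        have z2 : ∀ k : ℤ, z + d ≠ k := by
          intro m hm
          have hm' : z = m - d := by linear_combination hm
          rw [hm'] at hz
          rcases le_or_gt 0 m with h | h
          · obtain ⟨k, rfl⟩ := Int.eq_ofNat_of_zero_le h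
            apply q2 k; push_cast at hz; linear_combination hz
          · obtain ⟨k, hk⟩ := Int.eq_ofNat_of_zero_le (neg_nonneg.2 h.le)
            have hk' : (m:ℂ) = -(k:ℂ) := by
              have : m = -(k:ℤ) := by omega
              rw [this]; push_cast; ring
            rw [hk'] at hz
            apply q1 (l + l' + k); push_cast; linear_combination hz
        have u1 : ∀ k : ℤ, ν p - (z + ν p - l) ≠ k := by
          intro k hk; apply z1 (l - k); push_cast; linear_combination -hk
        have u2 : ∀ k : ℤ, ν (p+1) - (z + ν p - l) ≠ k := by
          intro k hk; apply z2 (l - k); push_cast; linear_combination -hk + hdd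
        have hFz : F (z + ν p - l) = 0 := by
          simp only [hF]
          rw [← hz, hdd]; ring
        have := ratio _ u1 u2
        rw [hFz, neg_zero, zero_mul, zero_mul] at this
        exact (mul_eq_zero.1 this.symm).resolve_right (kp_ne (nA _ u1) (nB _ u2))
    intro u
    refine eq_zero_of_countable (J := J) hJ0
      (S := ({u | ∃ k : ℤ, ν p - u = k} ∪ {u | ∃ k : ℤ, ν (p+1) - u = k}) ∪
        {u | u ^ 2 + (-ν p + l - ν (p+1) - l') * u + ((-ν p + l) * (-ν (p+1) - l') + q) = 0})
      (((int_countable _).union (int_countable _)).union (quad_countable _ _)) ?_ u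
    intro w hw
    simp only [Set.mem_union, Set.mem_ofPred_eq, not_or, not_exists] at hw
    have := ratio w hw.1.1 hw.1.2
    rw [hv0, zero_mul] at this
    have h3 := (mul_eq_zero.1 this).resolve_right hkv
    refine (mul_eq_zero.1 h3).resolve_left (fun h4 => hw.2 ?_)
    simp only [hF] at h4
    linear_combination -h4
  | succ L ihL =>
    intro x y hxy u
    rcases x with _ | x
    · obtain rfl : y = L + 1 := by omega
      refine eq_zero_of_countable (hJc 0 (L + 1))
        (quad_countable (-ν p + K (p-1) - ν (p+1) - K (p+1) - (L + 1) - (L + 1))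
          (qB N K ν + (-ν p + K (p-1)) * (-ν (p+1) - K (p+1) - (L + 1)) + (L + 1) * (ν (p+1) + K (p+1) + (L + 1)))) ?_ u
      intro w hw
      have a1 := br_b H hs hKp L w
      have a2 := br_b H' hs hKp L w
      rw [hq, m1, m2] at a2
      have a3 := hR (K (p-1)) (K (p+1) + (L+1)) le_rfl (by omega) w
      have a4 := ihL 0 L (by omega) w
      simp only [add_zero] at a4 ⊢
      have : (qB N K ν - (w - ν p + K (p - 1)) * (ν (p + 1) - w + K (p + 1) + L + 1)
        + ((L:ℂ) + 1) * (ν (p + 1) - w + K (p + 1) + L + 1)) * (Complex.Gamma (-d) * II N ν p K (K (p - 1)) (K (p + 1) + (L + 1)) w +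
          Complex.Gamma d * II N μ p K (K (p - 1)) (K (p + 1) + (L + 1)) w) = 0 := by
        linear_combination Complex.Gamma (-d) * a1 + Complex.Gamma d * a2 + a3 + ((L:ℂ) + 1) * a4
      refine (mul_eq_zero.1 this).resolve_left (fun h4 => hw ?_)
      show _ = _
      linear_combination h4
    · obtain rfl : L = x + y := by omega
      refine eq_zero_of_countable (hJc (x + 1) y)
        (quad_countable (-ν p + K (p-1) + x + 1 - ν (p+1) - K (p+1) - y + (x + 1 + y))
          (qB N K ν + (-ν p + K (p-1) + x + 1) * (-ν (p+1) - K (p+1) - y) + (x + 1 + y) * (-ν p + K (p-1) + x + 1))) ?_ u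
      intro w hw
      have a1 := br_a H hs hKp x y w
      have a2 := br_a H' hs hKp x y w
      rw [hq, m1, m2] at a2
      have a3 := hR (K (p-1) + (x + 1)) (K (p+1) + y) (by omega) (by omega) w
      have a4 := ihL x y (by omega) w
      have : (qB N K ν - (w - ν p + K (p - 1) + x + 1) * (ν (p + 1) - w + K (p + 1) + y)
        + ((x:ℂ) + 1 + y) * (w - ν p + K (p - 1) + x + 1)) * (Complex.Gamma (-d) * II N ν p K (K (p - 1) + (x + 1)) (K (p + 1) + y) w +
          Complex.Gamma d * II N μ p K (K (p - 1) + (x + 1)) (K (p + 1) + y) w) = 0 := by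
        linear_combination Complex.Gamma (-d) * a1 + Complex.Gamma d * a2 + a3 + ((x:ℂ) + 1 + y) * a4
      refine (mul_eq_zero.1 this).resolve_left (fun h4 => hw ?_)
      show _ = _
      linear_combination h4

lemma wAct_perm (n : ℕ) (τ : Equiv.Perm (Fin n)) (ν : ℕ → ℂ) (i : ℕ) (h : 1 ≤ i ∧ i ≤ n) :
    wAct n (τ, fun _ => false) ν i = ν ((τ ⟨i - 1, by omega⟩ : Fin n).val + 1) := by
  simp [wAct, h]

lemma reg_diff {n : ℕ} {ν : ℕ → ℂ} (hreg : Regular n ν) (a b : Fin n) (hab : a ≠ b) (k : ℤ) :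
    ν (a.val + 1) - ν (b.val + 1) ≠ k := by
  intro h
  refine hreg.2 (1, fun _ => false) (Equiv.swap a b, fun _ => false) ?_ ?_
  · intro he
    have := congrArg (fun w : SignedPerm n => w.1 a) he
    simp at this
    exact hab this
  · intro i hi
    rw [mem_Icc] at hi
    rw [wAct_perm _ _ _ _ hi, wAct_perm _ _ _ _ hi]
    by_cases h1 : (⟨i - 1, by omega⟩ : Fin n) = a
    · rw [h1, Equiv.swap_apply_left]; exact ⟨k, by simpa using h⟩
    · by_cases h2 : (⟨i - 1, by omega⟩ : Fin n) = b
      · rw [h2, Equiv.swap_apply_right]; refine ⟨-k, ?_⟩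
        simp only [Equiv.Perm.coe_one, id]; push_cast; linear_combination -h
      · rw [Equiv.swap_apply_of_ne_of_ne h1 h2]; exact ⟨0, by simp⟩

lemma reg_diff' {n : ℕ} {ν : ℕ → ℂ} (hreg : Regular n ν) {i j : ℕ} (hi : 1 ≤ i) (hi' : i ≤ n)
    (hj : 1 ≤ j) (hj' : j ≤ n) (hij : i ≠ j) (k : ℤ) : ν i - ν j ≠ k := by
  have := reg_diff hreg ⟨i - 1, by omega⟩ ⟨j - 1, by omega⟩ (by simp; omega) k
  simpa [Nat.sub_add_cancel hi, Nat.sub_add_cancel hj] using this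

lemma reg_q {n : ℕ} (hn : 2 ≤ n) {ν : ℕ → ℂ} (hreg : Regular n ν) (τ : Equiv.Perm (Fin n))
    (f : ℕ → ℂ) (hf : ∀ i : Fin n, f (i.val + 1) = ν ((τ i).val + 1)) (K : ℕ → ℕ)
    (hs : ∀ i, i ∉ Icc 1 (n - 1) → K i = 0) (hpos : 0 < ∑ i ∈ Icc 1 (n - 1), K i) :
    qB (n - 1) K f ≠ 0 := by
  obtain ⟨N, rfl⟩ : ∃ N, n = N + 1 := ⟨n - 1, by omega⟩
  rw [Nat.add_sub_cancel] at *
  have hK0 := hs 0 (by simp)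
  have hshift : ∀ (M : Type) [AddCommMonoid M] (g : ℕ → M), ∑ i ∈ Icc 1 (N + 1), g i = g 1 + ∑ i ∈ Icc 1 N, g (i + 1) := by
    intro M _ g
    rw [← Finset.add_sum_Ioc_eq_sum_Icc (by omega)]
    congr 1
    have : Ioc 1 (N + 1) = (Icc 1 N).image (· + 1) := by
      ext i; simp only [mem_Ioc, mem_image, mem_Icc]
      constructor
      · intro h; exact ⟨i - 1, by omega, by omega⟩
      · rintro ⟨a, ha, rfl⟩; omega
    rw [this, Finset.sum_image (by intro a _ b _ h; simpa using h)]
  have h1 := hreg.1 (τ * (finRotate (N + 1)).symm, fun _ => false) (fun i => K (i - 1)) (by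
    rw [hshift]; simp only [Nat.add_sub_cancel]; omega)
  rw [qB_eq _ (by omega) _ (by simpa using hK0), hshift] at h1
  rw [qB_eq _ (by omega) _ hK0]
  convert h1 using 1
  have e0 : dl (fun i => K (i - 1)) 1 = 0 := by simp [dl]
  rw [e0]
  simp only [Int.cast_zero, mul_zero, add_zero]
  norm_num
  refine Finset.sum_congr rfl fun j hj => ?_
  rw [mem_Icc] at hj
  have e1 : dl (fun i => K (i - 1)) (j + 1) = dl K j := by simp [dl]
  rw [e1, wAct_perm _ _ _ _ (by omega)]
  have e2 : (finRotate (N + 1)).symm ⟨j + 1 - 1, by omega⟩ = ⟨j - 1, by omega⟩ := by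
    rw [Equiv.symm_apply_eq, finRotate_of_lt (by omega)]
    ext; simp; omega
  rw [Equiv.Perm.mul_apply, e2, ← hf]
  simp only [Nat.sub_add_cancel hj.1]

abbrev sw (p : ℕ) (ν : ℕ → ℂ) : ℕ → ℂ :=
  fun i => if i = p then ν (p + 1) else if i = p + 1 then ν p else ν i

lemma Br_nu {n : ℕ} {ν : ℕ → ℂ} (hreg : Regular n ν) {P : Finset ℕ} (hP : P ⊆ Icc 1 (n - 1))
    {p : ℕ} (hp : p ∈ Icc 1 (n - 2)) (hp1 : p ∉ P) (hp2 : p + 1 ∈ P) : Br (n - 1) P p (ν n) ν := by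
  rw [mem_Icc] at hp
  refine ⟨hP, ⟨hp.1, hp1, hp2⟩, by omega, ?_, ?_, ?_⟩
  · intro i hi k
    rw [mem_Icc] at hi
    exact reg_diff' hreg hi.1 (by omega) (by omega) le_rfl (by omega) k
  · exact reg_q (by omega) hreg 1 ν (fun i => rfl)
  · exact reg_diff' hreg hp.1 (by omega) (by omega) (by omega) (by omega)

lemma Br_sw {n : ℕ} {ν : ℕ → ℂ} (hreg : Regular n ν) {P : Finset ℕ} (hP : P ⊆ Icc 1 (n - 1))
    {p : ℕ} (hp : p ∈ Icc 1 (n - 2)) (hp1 : p ∉ P) (hp2 : p + 1 ∈ P) : Br (n - 1) P p (ν n) (sw p ν) := by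
  rw [mem_Icc] at hp
  refine ⟨hP, ⟨hp.1, hp1, hp2⟩, by omega, ?_, ?_, ?_⟩
  · intro i hi k
    rw [mem_Icc] at hi
    simp only [sw]
    split_ifs
    · exact reg_diff' hreg (by omega) (by omega) (by omega) le_rfl (by omega) k
    · exact reg_diff' hreg (by omega) (by omega) (by omega) le_rfl (by omega) k
    · exact reg_diff' hreg hi.1 (by omega) (by omega) le_rfl (by omega) k
  · refine reg_q (by omega) hreg (Equiv.swap ⟨p - 1, by omega⟩ ⟨p, by omega⟩) (sw p ν) (fun i => ?_)
    rw [Equiv.swap_apply_def]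
    simp only [sw]
    have a1 : i = ⟨p - 1, by omega⟩ ↔ i.val + 1 = p := by rw [Fin.ext_iff]; simp; omega
    have a2 : i = ⟨p, by omega⟩ ↔ i.val + 1 = p + 1 := by rw [Fin.ext_iff]; simp
    simp only [a1, a2]
    split_ifs
    · rfl
    · simp only [Nat.sub_add_cancel hp.1]
    · rfl
  · intro k
    have : p + 1 ≠ p := by omega
    simp only [sw, if_true, this, if_false]
    exact reg_diff' hreg (by omega) (by omega) (by omega) (by omega) (by omega) k

lemma sw_eq (p : ℕ) (ν : ℕ → ℂ) (i : ℕ) : sw p ν i = ν (Equiv.swap p (p + 1) i) := by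
  simp only [sw, Equiv.swap_apply_def]
  split_ifs <;> rfl

lemma prod_two {s : Finset ℕ} {p : ℕ} (h1 : p ∈ s) (h2 : p + 1 ∈ s) (f : ℕ → ℂ) :
    ∏ i ∈ s, f i = f p * f (p + 1) * ∏ i ∈ (s.erase p).erase (p + 1), f i := by
  rw [← Finset.mul_prod_erase _ _ h1, ← Finset.mul_prod_erase (s.erase p) _ (mem_erase.2 ⟨by omega, h2⟩), mul_assoc]

lemma GammaN_sw {N p : ℕ} (h1 : 1 ≤ p) (h2 : p + 1 ≤ N) (ν : ℕ → ℂ) :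
    GammaN N ν * Complex.Gamma (ν p - ν (p + 1)) =
      GammaN N (sw p ν) * Complex.Gamma (-(ν p - ν (p + 1))) := by
  have hpm : p ∈ Icc 1 N := by rw [mem_Icc]; omega
  have hpm' : p + 1 ∈ Icc 1 N := by rw [mem_Icc]; omega
  have e1 : ∏ i ∈ Icc 1 N, Complex.Gamma (-(2 * sw p ν i)) = ∏ i ∈ Icc 1 N, Complex.Gamma (-(2 * ν i)) := by
    rw [prod_two hpm hpm', prod_two hpm hpm']
    have : p + 1 ≠ p := by omega
    simp only [sw, if_true, this, if_false]
    congr 1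
    · ring
    · refine Finset.prod_congr rfl fun i hi => ?_
      have a1 := (mem_erase.1 hi).1
      have a2 := (mem_erase.1 (mem_of_mem_erase hi)).1
      rw [if_neg a2, if_neg a1]
  unfold GammaN
  rw [e1]
  rw [Finset.prod_sigma' (Icc 1 N) (fun i => Icc (i+1) N), Finset.prod_sigma' (Icc 1 N) (fun i => Icc (i+1) N)]
  set S := (Icc 1 N).sigma (fun i => Icc (i+1) N) with hS
  have hm : (⟨p, p + 1⟩ : (_ : ℕ) × ℕ) ∈ S := by
    rw [hS, mem_sigma, mem_Icc, mem_Icc]; simp only; omega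
  rw [← Finset.mul_prod_erase S _ hm, ← Finset.mul_prod_erase S _ hm]
  have e2 : ∏ x ∈ S.erase ⟨p, p + 1⟩, Complex.Gamma (-sw p ν x.1 - sw p ν x.2) * Complex.Gamma (-sw p ν x.1 + sw p ν x.2)
      = ∏ x ∈ S.erase ⟨p, p + 1⟩, Complex.Gamma (-ν x.1 - ν x.2) * Complex.Gamma (-ν x.1 + ν x.2) := by
    have key : ∀ x : (_ : ℕ) × ℕ, x ∈ S.erase ⟨p, p + 1⟩ →
        (⟨Equiv.swap p (p+1) x.1, Equiv.swap p (p+1) x.2⟩ : (_ : ℕ) × ℕ) ∈ S.erase ⟨p, p + 1⟩ := by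
      rintro ⟨a, b⟩ hx
      rw [hS, mem_erase, mem_sigma, mem_Icc, mem_Icc, Ne, Sigma.mk.injEq, heq_eq_eq] at hx ⊢
      simp only [Equiv.swap_apply_def] at hx ⊢
      split_ifs <;> omega
    refine Finset.prod_nbij' (fun x => ⟨Equiv.swap p (p+1) x.1, Equiv.swap p (p+1) x.2⟩)
      (fun x => ⟨Equiv.swap p (p+1) x.1, Equiv.swap p (p+1) x.2⟩) key key ?_ ?_ ?_
    · intro x _; simp
    · intro x _; simp
    · intro x _; simp only [sw_eq]
  rw [e2]
  have : p + 1 ≠ p := by omega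
  simp only [sw, if_true, this, if_false]
  have e3 : -ν p + ν (p + 1) = -(ν p - ν (p + 1)) := by ring
  have e4 : -ν (p + 1) + ν p = ν p - ν (p + 1) := by ring
  have e5 : -ν (p + 1) - ν p = -ν p - ν (p + 1) := by ring
  rw [e3, e4, e5]
  ring

lemma refl_sym (a b : ℂ) :
    Complex.Gamma a * Complex.Gamma (1 - a) * (Complex.Gamma (-b) * Complex.Gamma (1 + b)) =
    Complex.Gamma b * Complex.Gamma (1 - b) * (Complex.Gamma (-a) * Complex.Gamma (1 + a)) := by
  have h1 := Complex.Gamma_mul_Gamma_one_sub a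
  have h2 := Complex.Gamma_mul_Gamma_one_sub b
  have h3 := Complex.Gamma_mul_Gamma_one_sub (-a)
  have h4 := Complex.Gamma_mul_Gamma_one_sub (-b)
  rw [sub_neg_eq_add, mul_neg, Complex.sin_neg] at h3 h4
  rw [h1, h2, h3, h4]
  ring

lemma GammaP_sw {n p : ℕ} {P : Finset ℕ} (hp : p ∈ Icc 1 (n - 2)) (hp1 : p ∉ P) (hp2 : p + 1 ∈ P)
    (ν : ℕ → ℂ) :
    GammaP n P ν * (Complex.Gamma (-ν p + ν n + 1) * Complex.Gamma (ν (p + 1) - ν n + 1)) * Complex.Gamma (ν p - ν (p + 1))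
    = GammaP n P (sw p ν) * (Complex.Gamma (-ν (p + 1) + ν n + 1) * Complex.Gamma (ν p - ν n + 1))
      * Complex.Gamma (-(ν p - ν (p + 1))) := by
  rw [mem_Icc] at hp
  have hpm : p ∈ Icc 1 (n-1) := by rw [mem_Icc]; omega
  have hpm' : p + 1 ∈ Icc 1 (n-1) := by rw [mem_Icc]; omega
  have hG : ∀ ν, GammaP n P ν = GammaN (n - 1) ν *
      ∏ i ∈ Icc 1 (n-1), if i ∈ P then Complex.Gamma (-ν i + ν n) else Complex.Gamma (ν i - ν n) := by
    intro ν
    rw [GammaP, Finset.prod_ite, mul_assoc]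
  rw [hG, hG, prod_two hpm hpm', prod_two hpm hpm']
  have e1 : ∏ i ∈ ((Icc 1 (n-1)).erase p).erase (p+1), (if i ∈ P then Complex.Gamma (-sw p ν i + sw p ν n) else Complex.Gamma (sw p ν i - sw p ν n))
     = ∏ i ∈ ((Icc 1 (n-1)).erase p).erase (p+1), (if i ∈ P then Complex.Gamma (-ν i + ν n) else Complex.Gamma (ν i - ν n)) := by
    refine Finset.prod_congr rfl fun i hi => ?_
    have a1 := (mem_erase.1 hi).1
    have a2 := (mem_erase.1 (mem_of_mem_erase hi)).1
    have a3 : n ≠ p := by omega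
    have a4 : n ≠ p + 1 := by omega
    simp only [sw, if_neg a1, if_neg a2, if_neg a3, if_neg a4]
  rw [e1]
  have a3 : n ≠ p := by omega
  have a4 : n ≠ p + 1 := by omega
  have : p + 1 ≠ p := by omega
  have g := GammaN_sw hp.1 (by omega : p + 1 ≤ n - 1) ν
  have r := refl_sym (ν p - ν n) (ν (p + 1) - ν n)
  have s1 : sw p ν p = ν (p + 1) := by simp [sw]
  have s2 : sw p ν (p + 1) = ν p := by simp [sw]
  have s3 : sw p ν n = ν n := by simp [sw, a3, a4]
  simp only [if_neg hp1, if_pos hp2, s1, s2, s3]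
  have w1 : 1 - (ν p - ν n) = -ν p + ν n + 1 := by ring
  have w2 : 1 - (ν (p+1) - ν n) = -ν (p+1) + ν n + 1 := by ring
  have w3 : -(ν p - ν n) = -ν p + ν n := by ring
  have w4 : -(ν (p+1) - ν n) = -ν (p+1) + ν n := by ring
  have w5 : 1 + (ν p - ν n) = ν p - ν n + 1 := by ring
  have w6 : 1 + (ν (p+1) - ν n) = ν (p+1) - ν n + 1 := by ring
  rw [w1, w2, w3, w4, w5, w6] at r
  set Q := ∏ i ∈ ((Icc 1 (n-1)).erase p).erase (p+1), (if i ∈ P then Complex.Gamma (-ν i + ν n) else Complex.Gamma (ν i - ν n))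
  calc _ = (GammaN (n - 1) ν * Complex.Gamma (ν p - ν (p + 1))) * Q * (Complex.Gamma (ν p - ν n) * Complex.Gamma (-ν p + ν n + 1) *
      (Complex.Gamma (-ν (p+1) + ν n) * Complex.Gamma (ν (p+1) - ν n + 1))) := by ring
    _ = _ := by rw [g, r]; ring

/-- The completed summation vector. -/
def kv (n : ℕ) (l : Fin n → ℕ) (k : Fin (n - 2) → ℕ) : ℕ → ℕ :=
  fun i => if i = n - 1 then extN n l n else extN (n - 2) k i

def TT (n : ℕ) (P : Finset ℕ) (ν : ℕ → ℂ) (l : Fin n → ℕ) (k : Fin (n - 2) → ℕ) : ℂ :=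
  cB (n - 1) ν (kv n l k) * ∏ i ∈ Icc 1 (n - 1), (den P ν (ν n) (kv n l k) (extN n l) i)⁻¹

lemma kv_supp {n : ℕ} (hn : 3 ≤ n) (l : Fin n → ℕ) (k : Fin (n - 2) → ℕ) :
    ∀ i, i ∉ Icc 1 (n - 1) → kv n l k i = 0 := by
  intro i hi
  rw [mem_Icc] at hi
  have h : ¬ i = n - 1 := by omega
  have h' : ¬ (1 ≤ i ∧ i ≤ n - 2) := by omega
  simp only [kv, h, if_false, extN, h', dite_false]

lemma bP_eq {n : ℕ} (hn : 3 ≤ n) (P : Finset ℕ) (ν : ℕ → ℂ) (l : Fin n → ℕ) :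
    bP n P ν (fun i => (extN n l i : ℤ)) =
      if extN n l n ≤ extN n l (n - 1) then (-1) ^ (extN n l n : ℤ) * ∑' k, TT n P ν l k else 0 := by
  unfold bP
  have hc : ((∀ i ∈ Icc 1 n, (0:ℤ) ≤ (extN n l i : ℤ)) ∧ (extN n l n : ℤ) ≤ extN n l (n - 1)) ↔
      extN n l n ≤ extN n l (n - 1) := by
    constructor
    · intro h; exact_mod_cast h.2
    · intro h; exact ⟨fun i _ => by positivity, by exact_mod_cast h⟩
  by_cases h : extN n l n ≤ extN n l (n - 1)
  swap
  · rw [if_neg (fun hh => h (hc.1 hh)), if_neg h]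
  rw [if_pos (hc.2 h), if_pos h]
  congr 1
  refine tsum_congr fun k => ?_
  rw [TT, div_eq_mul_inv, Finset.prod_inv_distrib]
  have hkv : (fun i => if i = n - 1 then (extN n l n : ℤ).toNat else extN (n - 2) k i) = kv n l k := by
    funext i; simp [kv]
  rw [hkv]
  congr 2
  have hI : Icc 1 (n - 1) = insert (n - 1) (Icc 1 (n - 2)) := by
    ext i; rw [mem_insert, mem_Icc, mem_Icc]; omega
  rw [hI, Finset.prod_insert (by rw [mem_Icc]; omega), mul_comm]
  congr 1
  · have e1 : kv n l k (n - 1) = extN n l n := by simp [kv]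
    have e2 : kv n l k (n - 1 - 1) = extN (n - 2) k (n - 2) := by
      have : n - 1 - 1 ≠ n - 1 := by omega
      rw [kv, if_neg this]; rfl
    rw [den, e1, e2]
  · have : ∀ i ∈ Icc 1 (n - 2), den P ν (ν n) (kv n l k) (extN n l) i =
        if i ∈ P then zfact ((extN n l i : ℤ) - (extN (n - 2) k i : ℤ)) *
                poch (ν i - ν n + 1) ((extN n l i : ℤ) - (extN (n - 2) k (i - 1) : ℤ))
        else zfact ((extN n l i : ℤ) - (extN (n - 2) k (i - 1) : ℤ)) *
                poch (-ν i + ν n + 1) ((extN n l i : ℤ) - (extN (n - 2) k i : ℤ)) := by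
      intro i hi
      rw [mem_Icc] at hi
      have e1 : i ≠ n - 1 := by omega
      have e2 : i - 1 ≠ n - 1 := by omega
      have f1 : kv n l k i = extN (n - 2) k i := by rw [kv, if_neg e1]
      have f2 : kv n l k (i - 1) = extN (n - 2) k (i - 1) := by rw [kv, if_neg e2]
      rw [den, f1, f2]
    rw [Finset.prod_congr rfl this, Finset.prod_ite]

lemma TT_joint {n : ℕ} (hn : 3 ≤ n) {P : Finset ℕ} {p : ℕ} {ν : ℕ → ℂ} (H : Br (n - 1) P p (ν n) ν)
    (R : ℝ) (hR : 1 ≤ R) :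
    Summable (fun q : (Fin n → ℕ) × (Fin (n - 2) → ℕ) =>
      ‖TT n P ν q.1 q.2‖ * R ^ (∑ i ∈ Icc 1 n, extN n q.1 i)) := by
  have J := joint_summable (n - 1) (by omega) P H.hP ν (ν n) H.hz H.hq R hR
  let g : (Fin n → ℕ) × (Fin (n - 2) → ℕ) → (Fin (n - 1) → ℕ) × (Fin (n - 1) → ℕ) :=
    fun q => (fun i => kv n q.1 q.2 (i.val + 1), fun i => extN n q.1 (i.val + 1))
  have hg : Function.Injective g := by
    rintro ⟨l, k⟩ ⟨l', k'⟩ h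
    rw [Prod.mk.injEq] at h
    obtain ⟨h1, h2⟩ := h
    have hk : ∀ j : ℕ, 1 ≤ j → j ≤ n - 1 → kv n l k j = kv n l' k' j := by
      intro j hj hj'
      have := congrFun h1 ⟨j - 1, by omega⟩
      simpa only [Nat.sub_add_cancel hj] using this
    have hl : ∀ j : ℕ, 1 ≤ j → j ≤ n - 1 → extN n l j = extN n l' j := by
      intro j hj hj'
      have := congrFun h2 ⟨j - 1, by omega⟩
      simpa only [Nat.sub_add_cancel hj] using this
    rw [Prod.mk.injEq]
    constructor
    · funext i
      rw [← extN_val n l i, ← extN_val n l' i]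
      by_cases hi : i.val + 1 ≤ n - 1
      · exact hl _ (by omega) hi
      · have := hk (n - 1) (by omega) le_rfl
        simp only [kv, if_true] at this
        have e : i.val + 1 = n := by omega
        rw [e, this]
    · funext i
      rw [← extN_val (n - 2) k i, ← extN_val (n - 2) k' i]
      have := hk (i.val + 1) (by omega) (by omega)
      have e : ¬ (i.val + 1 = n - 1) := by omega
      simpa only [kv, e, if_false] using this
  refine (J.comp_injective hg).congr fun q => ?_
  obtain ⟨l, k⟩ := q
  have e1 : extN (n - 1) (fun i => kv n l k (i.val + 1)) = kv n l k :=
    (supp_extN (n - 1) (kv n l k) (kv_supp hn l k)).symm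
  have e2 : ∀ i ∈ Icc 1 (n - 1), extN (n - 1) (fun i => extN n l (i.val + 1)) i = extN n l i := by
    intro i hi
    rw [mem_Icc] at hi
    conv_lhs => unfold extN
    rw [dif_pos hi]
    simp only [Nat.sub_add_cancel hi.1]
    rfl
  simp only [Function.comp, g]
  rw [e1, TT, norm_mul, norm_prod]
  congr 1
  · congr 1
    refine Finset.prod_congr rfl fun i hi => ?_
    rw [norm_inv, den, den, e2 i hi]
  · congr 1
    rw [Finset.sum_congr rfl e2]
    have hI : Icc 1 n = insert n (Icc 1 (n - 1)) := by
      ext i; rw [mem_insert, mem_Icc, mem_Icc]; omega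
    rw [hI, Finset.sum_insert (by rw [mem_Icc]; omega), add_comm]
    simp [kv]

lemma TT_k {n : ℕ} (hn : 3 ≤ n) {P : Finset ℕ} {p : ℕ} {ν : ℕ → ℂ} (H : Br (n - 1) P p (ν n) ν)
    (l : Fin n → ℕ) : Summable (fun k => ‖TT n P ν l k‖) := by
  have := (TT_joint hn H 1 le_rfl).prod_factor l
  simpa using this

lemma TT_l {n : ℕ} (hn : 3 ≤ n) {P : Finset ℕ} {p : ℕ} {ν : ℕ → ℂ} (H : Br (n - 1) P p (ν n) ν)
    (R : ℝ) (hR : 1 ≤ R) :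
    Summable (fun l => (∑' k, ‖TT n P ν l k‖) * R ^ (∑ i ∈ Icc 1 n, extN n l i)) := by
  have := (TT_joint hn H R hR).prod
  simpa only [tsum_mul_right] using this

lemma bP_norm {n : ℕ} (hn : 3 ≤ n) {P : Finset ℕ} {p : ℕ} {ν : ℕ → ℂ} (H : Br (n - 1) P p (ν n) ν)
    (l : Fin n → ℕ) : ‖bP n P ν (fun i => (extN n l i : ℤ))‖ ≤ ∑' k, ‖TT n P ν l k‖ := by
  rw [bP_eq hn]
  split_ifs
  · rw [norm_mul, norm_zpow, norm_neg, norm_one, one_zpow, one_mul]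
    exact norm_tsum_le_tsum_norm (TT_k hn H l)
  · rw [norm_zero]; exact tsum_nonneg fun _ => norm_nonneg _

def cc (n : ℕ) (P : Finset ℕ) (μ : ℕ → ℂ) (i : ℕ) : ℂ :=
  if i = n ∨ i ∈ P then ∑ j ∈ Icc 1 i, μ j else ∑ j ∈ Icc 1 (i - 1), μ j + μ n

lemma SPt_eq {n : ℕ} (hn : 3 ≤ n) (P : Finset ℕ) (μ : ℕ → ℂ) (x : ℕ → ℝ) (l : Fin n → ℕ) :
    SPt n P μ x l = bP n P μ (fun i => (extN n l i : ℤ)) *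
      ∏ i ∈ Icc 1 n, ((Real.pi * x i : ℝ) : ℂ) ^ (2 * ((extN n l i : ℂ) + cc n P μ i)) := by
  rw [SPt, mul_assoc]
  congr 1
  rw [← Finset.prod_filter_mul_prod_filter_not (Icc 1 n) (fun i => i = n ∨ i ∈ P)]
  congr 1
  · refine Finset.prod_congr rfl fun i hi => ?_
    rw [mem_filter] at hi
    rw [cc, if_pos hi.2]
  · have : (Icc 1 (n - 1)).filter (· ∉ P) = (Icc 1 n).filter (fun i => ¬ (i = n ∨ i ∈ P)) := by
      ext i
      rw [mem_filter, mem_filter, mem_Icc, mem_Icc, not_or]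
      constructor
      · rintro ⟨h1, h2⟩; exact ⟨by omega, by omega, h2⟩
      · rintro ⟨h1, h2, h3⟩; exact ⟨by omega, h3⟩
    rw [this]
    refine Finset.prod_congr rfl fun i hi => ?_
    rw [mem_filter] at hi
    rw [cc, if_neg hi.2, add_assoc]

lemma sum_sw {p : ℕ} (ν : ℕ → ℂ) {i : ℕ} (hp : 1 ≤ p) (hi : i ≠ p) :
    ∑ j ∈ Icc 1 i, sw p ν j = ∑ j ∈ Icc 1 i, ν j := by
  by_cases h : i < p
  · refine Finset.sum_congr rfl fun j hj => ?_
    rw [mem_Icc] at hj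
    have a : ¬ j = p := by omega
    have b : ¬ j = p + 1 := by omega
    simp only [sw, a, b, if_false]
  · rw [sum_two hp (by omega : p + 1 ≤ i) (sw p ν) ν (by
      intro j a b; simp only [sw, a, b, if_false])]
    simp [sw]
    ring

lemma cc_sw {n p : ℕ} {P : Finset ℕ} (hp : p ∈ Icc 1 (n - 2)) (hp1 : p ∉ P) (hp2 : p + 1 ∈ P)
    (ν : ℕ → ℂ) (i : ℕ) : cc n P (sw p ν) i = cc n P ν i := by
  rw [mem_Icc] at hp
  unfold cc
  have a3 : n ≠ p := by omega
  have a4 : n ≠ p + 1 := by omega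
  have s3 : sw p ν n = ν n := by simp [sw, a3, a4]
  rw [s3]
  split_ifs with h
  · rw [sum_sw ν hp.1]
    rintro rfl
    rcases h with h | h
    · omega
    · exact hp1 h
  · rw [sum_sw ν hp.1]
    intro e
    apply h; right
    have : i = p + 1 := by omega
    rw [this]; exact hp2

lemma SPt_summable {n : ℕ} (hn : 3 ≤ n) {P : Finset ℕ} {p : ℕ} {ν : ℕ → ℂ}
    (H : Br (n - 1) P p (ν n) ν) (x : ℕ → ℝ) (hx : ∀ i ∈ Icc 1 n, 0 < x i) :
    Summable (fun l => ‖SPt n P ν x l‖) := by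
  set R : ℝ := 1 + ∑ i ∈ Icc 1 n, (Real.pi * x i) ^ 2 with hRd
  have hR : 1 ≤ R := by
    have : 0 ≤ ∑ i ∈ Icc 1 n, (Real.pi * x i) ^ 2 := Finset.sum_nonneg fun i _ => sq_nonneg _
    linarith
  have hRi : ∀ i ∈ Icc 1 n, (Real.pi * x i) ^ 2 ≤ R := by
    intro i hi
    have := Finset.single_le_sum (f := fun i => (Real.pi * x i) ^ 2) (fun i _ => sq_nonneg _) hi
    linarith
  refine Summable.of_nonneg_of_le (fun _ => norm_nonneg _) (fun l => ?_)
    ((TT_l hn H R hR).mul_right (∏ i ∈ Icc 1 n, ‖((Real.pi * x i : ℝ) : ℂ) ^ (2 * cc n P ν i)‖))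
  rw [SPt_eq hn, norm_mul, norm_prod, mul_assoc]
  refine mul_le_mul (bP_norm hn H l) ?_ (Finset.prod_nonneg fun _ _ => norm_nonneg _)
    (tsum_nonneg fun _ => norm_nonneg _)
  rw [← Finset.prod_pow_eq_pow_sum, ← Finset.prod_mul_distrib]
  refine Finset.prod_le_prod (fun _ _ => norm_nonneg _) fun i hi => ?_
  have hpos : 0 < Real.pi * x i := mul_pos Real.pi_pos (hx i hi)
  have hne : ((Real.pi * x i : ℝ) : ℂ) ≠ 0 := by
    exact_mod_cast hpos.ne'
  rw [mul_add, Complex.cpow_add _ _ hne, norm_mul]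
  refine mul_le_mul_of_nonneg_right ?_ (norm_nonneg _)
  have e : (2 * (extN n l i : ℂ)) = ((2 * extN n l i : ℕ) : ℂ) := by push_cast; ring
  rw [e, Complex.cpow_natCast, norm_pow, Complex.norm_real, Real.norm_eq_abs, abs_of_pos hpos, pow_mul]
  exact pow_le_pow_left₀ (sq_nonneg _) (hRi i hi) _

lemma tsum_fib {m : ℕ} (i0 : Fin m) (f : (Fin m → ℕ) → ℂ) (hf : Summable f)
    (h : ∀ r, ∑' a, f (Function.update r i0 a) = 0) : ∑' k, f k = 0 := by
  classical
  let e := Equiv.funSplitAt i0 ℕ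
  have hs : Summable (fun q : ℕ × ({j // j ≠ i0} → ℕ) => f (e.symm q)) := e.symm.summable_iff.2 hf
  rw [← e.symm.tsum_eq f]
  have hs2 := hs.prod_symm
  rw [← (Equiv.prodComm _ _).tsum_eq (fun q => f (e.symm q))]
  rw [Summable.tsum_prod (by exact hs2)]
  have : ∀ r : ({j // j ≠ i0} → ℕ), ∑' a, f (e.symm (a, r)) = 0 := by
    intro r
    rw [← h (e.symm (0, r))]
    refine tsum_congr fun a => ?_
    congr 1
    funext j
    by_cases hj : j = i0
    · subst hj; simp [e, Equiv.funSplitAt, Equiv.piSplitAt]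
    · rw [Function.update_of_ne hj]; simp [e, Equiv.funSplitAt, Equiv.piSplitAt, hj]
  simp [this]

def c0 (n : ℕ) (P : Finset ℕ) (μ : ℕ → ℂ) (p : ℕ) (K L : ℕ → ℕ) : ℂ :=
  (zfact ((L p : ℤ) - K (p - 1)))⁻¹ * (zfact ((L (p + 1) : ℤ) - K (p + 1)))⁻¹ *
    ∏ i ∈ ((Icc 1 (n - 1)).erase p).erase (p + 1), (den P μ (μ n) K L i)⁻¹

lemma kv_upd {n p : ℕ} (hp1 : 1 ≤ p) (hp2 : p ≤ n - 2) (l : Fin n → ℕ)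
    (r : Fin (n - 2) → ℕ) (a : ℕ) :
    kv n l (Function.update r ⟨p - 1, by omega⟩ a) =
      Function.update (Function.update (kv n l r) p 0) p a := by
  funext j
  rw [Function.update_idem]
  by_cases hj : j = p
  · subst hj
    have : ¬ j = n - 1 := by omega
    rw [Function.update_self]
    simp only [kv, this, if_false, extN]
    rw [dif_pos ⟨hp1, hp2⟩, Function.update_self]
  · rw [Function.update_of_ne hj]
    simp only [kv, extN]
    split_ifs
    · rfl
    · rfl
    · rw [Function.update_of_ne]
      rw [ne_eq, Fin.mk.injEq]; omega
    · rfl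

lemma poch_inv (A : ℂ) (m : ℤ) : (poch A m)⁻¹ = Complex.Gamma A * RG (A + m) := by
  rw [poch, RG, inv_div, div_eq_mul_inv]

lemma TT_fib {n p : ℕ} {P : Finset ℕ} (hp : p ∈ Icc 1 (n - 2)) (hp1 : p ∉ P) (hp2 : p + 1 ∈ P)
    (μ : ℕ → ℂ) (l : Fin n → ℕ) (r : Fin (n - 2) → ℕ) (i0 : Fin (n - 2)) (hi0 : i0.val = p - 1)
    (K : ℕ → ℕ) (hK : K = Function.update (kv n l r) p 0) (a : ℕ) :
    TT n P μ l (Function.update r i0 a) =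
      c0 n P μ p K (extN n l) * (Complex.Gamma (-μ p + μ n + 1) * Complex.Gamma (μ (p + 1) - μ n + 1)) *
        tr (ph (n - 1) μ p K) (1 - μ p + μ n + extN n l p) (1 + μ (p + 1) - μ n + extN n l (p + 1)) a := by
  rw [mem_Icc] at hp
  have hi : i0 = ⟨p - 1, by omega⟩ := Fin.ext hi0
  rw [TT, hi, kv_upd hp.1 hp.2, ← hK, prod_two (p := p) (by rw [mem_Icc]; omega) (by rw [mem_Icc]; omega)]
  have d1 : den P μ (μ n) (Function.update K p a) (extN n l) p =
      zfact ((extN n l p : ℤ) - K (p - 1)) * poch (-μ p + μ n + 1) ((extN n l p : ℤ) - a) := by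
    rw [den, if_neg hp1, Function.update_self, Function.update_of_ne (by omega)]
  have d2 : den P μ (μ n) (Function.update K p a) (extN n l) (p + 1) =
      zfact ((extN n l (p + 1) : ℤ) - K (p + 1)) * poch (μ (p + 1) - μ n + 1) ((extN n l (p + 1) : ℤ) - a) := by
    rw [den, if_pos hp2, Nat.add_sub_cancel, Function.update_self, Function.update_of_ne (by omega)]
  have d3 : ∀ i ∈ ((Icc 1 (n - 1)).erase p).erase (p + 1),
      (den P μ (μ n) (Function.update K p a) (extN n l) i)⁻¹ = (den P μ (μ n) K (extN n l) i)⁻¹ := by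
    intro i hi
    rw [mem_erase, mem_erase, mem_Icc] at hi
    rw [den, den, Function.update_of_ne (by omega), Function.update_of_ne (by omega)]
  rw [d1, d2, Finset.prod_congr rfl d3, c0, tr, ph, mul_inv, mul_inv, poch_inv, poch_inv]
  have e1 : -μ p + μ n + 1 + (((extN n l p : ℤ) - a : ℤ) : ℂ) = 1 - μ p + μ n + extN n l p - a := by
    push_cast; ring
  have e2 : μ (p + 1) - μ n + 1 + (((extN n l (p + 1) : ℤ) - a : ℤ) : ℂ) =
      1 + μ (p + 1) - μ n + extN n l (p + 1) - a := by
    push_cast; ring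
  rw [e1, e2]
  ring

lemma c0_sw {n p : ℕ} {P : Finset ℕ} (hp : p ∈ Icc 1 (n - 2)) (ν : ℕ → ℂ) (K L : ℕ → ℕ) :
    c0 n P (sw p ν) p K L = c0 n P ν p K L := by
  rw [mem_Icc] at hp
  unfold c0
  congr 1
  refine Finset.prod_congr rfl fun i hi => ?_
  rw [mem_erase, mem_erase, mem_Icc] at hi
  have a1 : ¬ n = p := by omega
  have a2 : ¬ n = p + 1 := by omega
  have a3 : ¬ i = p := by omega
  have a4 : ¬ i = p + 1 := by omega
  simp only [den, sw, a1, a2, a3, a4, if_false]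

lemma bP_sw {n : ℕ} {ν : ℕ → ℂ} (hreg : Regular n ν) {P : Finset ℕ} (hP : P ⊆ Icc 1 (n - 1))
    {p : ℕ} (hp : p ∈ Icc 1 (n - 2)) (hp1 : p ∉ P) (hp2 : p + 1 ∈ P) (l : Fin n → ℕ) :
    GammaP n P ν * bP n P ν (fun i => (extN n l i : ℤ)) +
      GammaP n P (sw p ν) * bP n P (sw p ν) (fun i => (extN n l i : ℤ)) = 0 := by
  have hpp := hp
  rw [mem_Icc] at hpp
  have hn : 3 ≤ n := by omega
  have H := Br_nu hreg hP hp hp1 hp2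
  have H' := Br_sw hreg hP hp hp1 hp2
  have a3 : n ≠ p := by omega
  have a4 : n ≠ p + 1 := by omega
  have s3 : sw p ν n = ν n := by simp [sw, a3, a4]
  have H'' : Br (n - 1) P p (sw p ν n) (sw p ν) := by rw [s3]; exact H'
  have s1 : sw p ν p = ν (p + 1) := by simp [sw]
  have s2 : sw p ν (p + 1) = ν p := by simp [sw]
  rw [bP_eq hn, bP_eq hn]
  split_ifs with hc
  swap
  · ring
  suffices hz : ∑' k, (GammaP n P ν * TT n P ν l k + GammaP n P (sw p ν) * TT n P (sw p ν) l k) = 0 by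
    rw [Summable.tsum_add ((TT_k hn H l).of_norm.mul_left _) ((TT_k hn H'' l).of_norm.mul_left _),
      tsum_mul_left, tsum_mul_left] at hz
    linear_combination (-1) ^ (extN n l n : ℤ) * hz
  refine tsum_fib ⟨p - 1, by omega⟩ _
    (((TT_k hn H l).of_norm.mul_left _).add ((TT_k hn H'' l).of_norm.mul_left _)) fun r => ?_
  obtain ⟨K, hK⟩ : ∃ K, K = Function.update (kv n l r) p 0 := ⟨_, rfl⟩
  have hKs : ∀ i, i ∉ Icc 1 (n - 1) → K i = 0 := by
    rw [hK]; exact upd_supp hpp.1 (by omega) (kv_supp hn l r) 0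
  have hKp : K p = 0 := by rw [hK, Function.update_self]
  simp only [TT_fib hp hp1 hp2 _ l r ⟨p - 1, by omega⟩ rfl K hK, c0_sw hp, s1, s2, s3]
  by_cases hx : K (p - 1) ≤ extN n l p
  swap
  · have : c0 n P ν p K (extN n l) = 0 := by
      rw [c0, zfact_neg (by omega)]; simp
    simp [this]
  by_cases hy : K (p + 1) ≤ extN n l (p + 1)
  swap
  · have : c0 n P ν p K (extN n l) = 0 := by
      rw [c0, zfact_neg (z := (extN n l (p + 1) : ℤ) - K (p + 1)) (by omega)]; simp
    simp [this]
  have M := main_ind H H' s1 s2 (by intro i b1 b2; simp [sw, b1, b2]) _ K hKs hKp rfl _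
    (extN n l p - K (p - 1)) (extN n l (p + 1) - K (p + 1)) rfl (ν n)
  rw [Nat.add_sub_cancel' hx, Nat.add_sub_cancel' hy] at M
  have F1 := (II_facts H hKs hKp hx hy).1 (ν n)
  have F2 := (II_facts H' hKs hKp hx hy).1 (ν n)
  have G := GammaP_sw hp hp1 hp2 ν
  have hd := H.hd
  have hd' : ∀ k : ℤ, -(ν p - ν (p + 1)) ≠ k := by
    intro k hk; apply hd (-k); push_cast; rw [← hk]; ring
  have g1 : Complex.Gamma (ν p - ν (p + 1)) ≠ 0 := left_ne_zero_of_mul_eq_one (Gamma_RG hd)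
  rw [s1, s2] at F2
  have q1 : ∑' a, tr (ph (n - 1) ν p K) (1 - ν p + ν n + extN n l p) (1 + ν (p + 1) - ν n + extN n l (p + 1)) a
    = II (n - 1) ν p K (extN n l p) (extN n l (p + 1)) (ν n) := rfl
  have q2 : ∑' a, tr (ph (n - 1) (sw p ν) p K) (1 - ν (p + 1) + ν n + extN n l p)
      (1 + ν p - ν n + extN n l (p + 1)) a
    = II (n - 1) (sw p ν) p K (extN n l p) (extN n l (p + 1)) (ν n) := by rw [II, s1, s2]
  rw [Summable.tsum_add ((F1.of_norm.mul_left _).mul_left _) ((F2.of_norm.mul_left _).mul_left _),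
    tsum_mul_left, tsum_mul_left, tsum_mul_left, tsum_mul_left, q1, q2]
  apply mul_left_cancel₀ g1
  linear_combination c0 n P ν p K (extN n l) * II (n - 1) ν p K (extN n l p) (extN n l (p + 1)) (ν n) * G +
    c0 n P ν p K (extN n l) * GammaP n P (sw p ν) * Complex.Gamma (-ν (p + 1) + ν n + 1) *
      Complex.Gamma (ν p - ν n + 1) * M

lemma final {n : ℕ} {ν : ℕ → ℂ} (hreg : Regular n ν) {P : Finset ℕ} (hP : P ⊆ Icc 1 (n - 1))
    {p : ℕ} (hp : p ∈ Icc 1 (n - 2)) (hp1 : p ∉ P) (hp2 : p + 1 ∈ P) (x : ℕ → ℝ)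
    (hx : ∀ i ∈ Icc 1 n, 0 < x i) :
    Summable (fun l => ‖SPt n P ν x l‖) ∧ Summable (fun l => ‖SPt n P (sw p ν) x l‖) ∧
    GammaP n P ν * SP n P ν x + GammaP n P (sw p ν) * SP n P (sw p ν) x = 0 := by
  have hpp := hp
  rw [mem_Icc] at hpp
  have hn : 3 ≤ n := by omega
  have a3 : n ≠ p := by omega
  have a4 : n ≠ p + 1 := by omega
  have s3 : sw p ν n = ν n := by simp [sw, a3, a4]
  have H'' : Br (n - 1) P p (sw p ν n) (sw p ν) := by rw [s3]; exact Br_sw hreg hP hp hp1 hp2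
  have S1 := SPt_summable hn (Br_nu hreg hP hp hp1 hp2) x hx
  have S2 := SPt_summable hn H'' x hx
  refine ⟨S1, S2, ?_⟩
  unfold SP
  rw [← tsum_mul_left, ← tsum_mul_left,
    ← Summable.tsum_add (S1.of_norm.mul_left _) (S2.of_norm.mul_left _)]
  have : ∀ l, GammaP n P ν * SPt n P ν x l + GammaP n P (sw p ν) * SPt n P (sw p ν) x l = 0 := by
    intro l
    rw [SPt_eq hn, SPt_eq hn]
    simp only [cc_sw hp hp1 hp2]
    linear_combination (∏ i ∈ Icc 1 n, ((Real.pi * x i : ℝ) : ℂ) ^ (2 * ((extN n l i : ℂ) + cc n P ν i))) *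
      bP_sw hreg hP hp hp1 hp2 l
  simp only [this, tsum_zero]

/-- cancellation of the terms attached to `P` when `P̃ ≠ ∅`, under the
transposition exchanging the `p₀`-th and `(p₀+1)`-th coordinates. -/
theorem stmt11 (n : ℕ) (hn : 2 ≤ n) (ν : ℕ → ℂ) (hreg : Regular n ν)
    (P : Finset ℕ) (hP : P ⊆ Finset.Icc 1 (n - 1))
    (p₀ : ℕ) (hp₀ : p₀ ∈ Finset.Icc 1 (n - 2)) (hp₀P : p₀ ∉ P) (hp₀P' : p₀ + 1 ∈ P)
    (x : ℕ → ℝ) (hx : ∀ i ∈ Finset.Icc 1 n, 0 < x i) :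
    Summable (fun l : Fin n → ℕ => ‖SPt n P ν x l‖) ∧
    Summable (fun l : Fin n → ℕ =>
      ‖SPt n P (fun i => if i = p₀ then ν (p₀ + 1) else if i = p₀ + 1 then ν p₀ else ν i)
        x l‖) ∧
    GammaP n P ν * SP n P ν x +
      GammaP n P (fun i => if i = p₀ then ν (p₀ + 1) else if i = p₀ + 1 then ν p₀ else ν i) *
        SP n P (fun i => if i = p₀ then ν (p₀ + 1) else if i = p₀ + 1 then ν p₀ else ν i) x
      = 0 := by
  exact final hreg hP hp₀ hp₀P hp₀P' x hx

end SO
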